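/- Assume ξ''(t) > 0 for t ∈ (0,1] and that t ↦ ξ'''(t) / ξ''(t)^{3/2} is non-decreasing on (0,1). Then inf_{γ ∈ 𝒰} P(γ) = ∫₀¹ √( ξ''(t) ) dt, and consequently lim_{N→∞} (1/N) E[ max_{σ ∈ S_N} H_N(σ) ] = ∫₀¹ √( ξ''(t) ) dt. -/

import Mathlib

open MeasureTheory ProbabilityTheory Filter
open scoped ENNReal NNReal

noncomputable section

/-- Euclidean dot product on `ℝ^N`. -/
def dotp {N : ℕ} (σ τ : Fin N → ℝ) : ℝ := ∑ i, σ i * τ i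

/-- The sphere `S_N = {σ : ‖σ‖₂² = N}`. -/
def sphereSet (N : ℕ) : Set (Fin N → ℝ) := {σ | ∑ i, (σ i) ^ 2 = (N : ℝ)}

/-- The mixture `ξ(x) = Σ_{k=2}^P c_k² x^k`. -/
def xiFun (P : ℕ) (c : ℕ → ℝ) (x : ℝ) : ℝ := ∑ k ∈ Finset.Icc 2 P, (c k) ^ 2 * x ^ k

/-- `ξ'`. -/
def xiD1 (P : ℕ) (c : ℕ → ℝ) (x : ℝ) : ℝ :=
  ∑ k ∈ Finset.Icc 2 P, (k : ℝ) * (c k) ^ 2 * x ^ (k - 1)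

/-- `ξ''`. -/
def xiD2 (P : ℕ) (c : ℕ → ℝ) (x : ℝ) : ℝ :=
  ∑ k ∈ Finset.Icc 2 P, (k : ℝ) * ((k : ℝ) - 1) * (c k) ^ 2 * x ^ (k - 2)

/-- The mixed p-spin Hamiltonian built from couplings `g`. -/
def hamiltonian (N P : ℕ) (c : ℕ → ℝ) (g : (k : ℕ) → (Fin k → Fin N) → ℝ)
    (σ : Fin N → ℝ) : ℝ :=
  ∑ k ∈ Finset.Icc 2 P, c k * (N : ℝ) ^ (-(((k : ℝ) - 1) / 2)) *
    ∑ j : Fin k → Fin N, g k j * ∏ i, σ (j i)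

/-- Index set for the entries of all the coupling tensors. -/
abbrev GIdx (N P : ℕ) : Type := Σ k : {k : ℕ // k ∈ Finset.Icc 2 P}, (Fin (k : ℕ) → Fin N)

/-- Flatten the couplings into a single Gaussian vector. -/
def flatten (N P : ℕ) (g : (k : ℕ) → (Fin k → Fin N) → ℝ) : GIdx N P → ℝ :=
  fun i => g i.1 i.2

/-- The couplings `(G^{(k)})_{2 ≤ k ≤ P}` are i.i.d. standard Gaussians. -/
def StdGaussianCouplings {Ω : Type*} [MeasureSpace Ω] (N P : ℕ)
    (G : Ω → (k : ℕ) → (Fin k → Fin N) → ℝ) : Prop :=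
  Measure.map (fun ω => flatten N P (G ω)) ℙ = Measure.pi fun _ : GIdx N P => gaussianReal 0 1

/-- The maximum of the Hamiltonian over the sphere. -/
def maxH (N P : ℕ) (c : ℕ → ℝ) (g : (k : ℕ) → (Fin k → Fin N) → ℝ) : ℝ :=
  ⨆ σ : sphereSet N, hamiltonian N P c g σ.1


/-- Euclidean gradient of the Hamiltonian. -/
def gradH (N P : ℕ) (c : ℕ → ℝ) (g : (k : ℕ) → (Fin k → Fin N) → ℝ)
    (σ : Fin N → ℝ) : Fin N → ℝ :=
  fun i => fderiv ℝ (hamiltonian N P c g) σ (Pi.single i 1)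

/-- Euclidean Hessian of the Hamiltonian, as a bilinear form. -/
def hessH (N P : ℕ) (c : ℕ → ℝ) (g : (k : ℕ) → (Fin k → Fin N) → ℝ)
    (σ v w : Fin N → ℝ) : ℝ :=
  fderiv ℝ (fun τ => fderiv ℝ (hamiltonian N P c g) τ w) σ v

/-- `σ` is a spherical critical point: `∇H(σ) = (⟨∇H(σ),σ⟩/N) σ`. -/
def IsCritPt (N P : ℕ) (c : ℕ → ℝ) (g : (k : ℕ) → (Fin k → Fin N) → ℝ)
    (σ : Fin N → ℝ) : Prop :=
  σ ∈ sphereSet N ∧ gradH N P c g σ = (dotp (gradH N P c g σ) σ / N) • σ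

/-- Cardinality of a set, valued in `ℝ≥0∞`. -/
def ecount {α : Type*} (s : Set α) : ℝ≥0∞ := ∑' _ : s, 1

/-- Spherical critical points with energy at least `Nη`. -/
def crtSet (N P : ℕ) (c : ℕ → ℝ) (g : (k : ℕ) → (Fin k → Fin N) → ℝ)
    (η : ℝ) : Set (Fin N → ℝ) :=
  {σ | IsCritPt N P c g σ ∧ (N : ℝ) * η ≤ hamiltonian N P c g σ}

/-- Index (number of negative eigenvalues) of the spherical Hessian quadratic form at `σ`:
maximal dimension of a subspace of the tangent space on which the form is negative definite. -/
def critIndex (N P : ℕ) (c : ℕ → ℝ) (g : (k : ℕ) → (Fin k → Fin N) → ℝ)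
    (σ : Fin N → ℝ) : ℕ :=
  sSup {d : ℕ | ∃ W : Submodule ℝ (Fin N → ℝ), Module.finrank ℝ W = d ∧
    (∀ v ∈ W, dotp v σ = 0) ∧
    ∀ v ∈ W, v ≠ 0 →
      hessH N P c g σ v v - (dotp (gradH N P c g σ) σ / N) * ∑ i, (v i) ^ 2 < 0}

/-- Critical points of index `N-1-k` in the superlevel set. -/
def crtSetIdx (N P : ℕ) (c : ℕ → ℝ) (g : (k : ℕ) → (Fin k → Fin N) → ℝ)
    (η : ℝ) (k : ℕ) : Set (Fin N → ℝ) :=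
  {σ | σ ∈ crtSet N P c g η ∧ critIndex N P c g σ = N - 1 - k}

/-- Coefficients of the pure p-spin model. -/
def pureC (p : ℕ) : ℕ → ℝ := fun k => if k = p then 1 else 0

/-- The uniform probability measure on the sphere `S_N`. -/
def sphereUniform (N : ℕ) : Measure (Fin N → ℝ) :=
  Measure.map (fun g i => Real.sqrt N * g i / Real.sqrt (∑ j, (g j) ^ 2))
    (Measure.pi fun _ : Fin N => gaussianReal 0 1)

/-- The band around `m`. -/
def band (N : ℕ) (m : Fin N → ℝ) (δ : ℝ) : Set (Fin N → ℝ) :=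
  {σ | σ ∈ sphereSet N ∧ |dotp (σ - m) m| < N * δ}

/-- `k`-tuples from the band with pairwise overlaps close to `⟨m,m⟩`. -/
def bandK (N k : ℕ) (m : Fin N → ℝ) (δ ε : ℝ) : Set (Fin k → Fin N → ℝ) :=
  {σs | (∀ i, σs i ∈ band N m δ) ∧
    ∀ i j, i ≠ j → |dotp (σs i) (σs j) - dotp m m| < N * ε}

/-- `∫₀ᵗ γ(s) ds`, valued in `ℝ≥0∞`. -/
def gammaLInt (γ : ℝ → ℝ) (t : ℝ) : ℝ≥0∞ := ∫⁻ s in Set.Ioo 0 t, ENNReal.ofReal (γ s)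

/-- The zero-temperature spherical Parisi functional (Crisanti–Sommers form), with the
convention `1/0 = +∞`. -/
def PFunE (P : ℕ) (c : ℕ → ℝ) (γ : ℝ → ℝ) : ℝ≥0∞ :=
  ⨅ L ∈ {L : ℝ | gammaLInt γ 1 ≤ ENNReal.ofReal L},
    (∫⁻ t in Set.Ioo (0 : ℝ) 1,
      (ENNReal.ofReal (xiD2 P c t * (L - (gammaLInt γ t).toReal))
        + (ENNReal.ofReal (L - (gammaLInt γ t).toReal))⁻¹)) / 2

/-- The space `𝒰` of order parameters: non-decreasing, non-negative, integrable on `[0,1)`. -/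
def calU : Set (ℝ → ℝ) :=
  {γ | (∀ t ∈ Set.Ico (0 : ℝ) 1, 0 ≤ γ t) ∧ MonotoneOn γ (Set.Ico 0 1) ∧
    IntegrableOn γ (Set.Ioo 0 1)}

/-- The support of `γ`: points of `[0,1]` near which `γ` is not constant. -/
def suppGamma (γ : ℝ → ℝ) : Set ℝ :=
  {q | q ∈ Set.Icc (0 : ℝ) 1 ∧ ∀ ε > 0, ∃ s ∈ Set.Ico (0 : ℝ) 1, ∃ t ∈ Set.Ico (0 : ℝ) 1,
    |s - q| < ε ∧ |t - q| < ε ∧ γ s ≠ γ t}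

/-- The superlevel set `L_N(η)`. -/
def levelSet (N P : ℕ) (c : ℕ → ℝ) (g : (k : ℕ) → (Fin k → Fin N) → ℝ)
    (η : ℝ) : Set (Fin N → ℝ) :=
  {σ | σ ∈ sphereSet N ∧ (N : ℝ) * η ≤ hamiltonian N P c g σ}

/-- Threshold energy of the pure p-spin model. -/
def THRp (p : ℕ) : ℝ := 2 * Real.sqrt (((p : ℝ) - 1) / p)

/-- The function `J` of the pure p-spin complexity. -/
def Jp (p : ℕ) (η : ℝ) : ℝ :=
  η / (THRp p) ^ 2 * Real.sqrt (η ^ 2 - (THRp p) ^ 2)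
    - Real.log (η + Real.sqrt (η ^ 2 - (THRp p) ^ 2)) + Real.log (THRp p)

/-- The annealed complexity of the pure p-spin spherical model. -/
def SigmaPure (p : ℕ) (η : ℝ) : ℝ :=
  if η ≤ 0 then Real.log ((p : ℝ) - 1) / 2
  else if η ≤ THRp p then
    Real.log ((p : ℝ) - 1) / 2 - ((p : ℝ) - 2) / (4 * ((p : ℝ) - 1)) * η ^ 2
  else Real.log ((p : ℝ) - 1) / 2 - ((p : ℝ) - 2) / (4 * ((p : ℝ) - 1)) * η ^ 2 - Jp p η

/-- Couplings, unflattened from a vector indexed by `GIdx N P`. -/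
def unflatten (N P : ℕ) (g : GIdx N P → ℝ) : (k : ℕ) → (Fin k → Fin N) → ℝ :=
  fun k j => if h : k ∈ Finset.Icc 2 P then g ⟨⟨k, h⟩, j⟩ else 0

/-- `ξ'''`. -/
def xiD3 (P : ℕ) (c : ℕ → ℝ) (x : ℝ) : ℝ :=
  ∑ k ∈ Finset.Icc 2 P, (k : ℝ) * ((k : ℝ) - 1) * ((k : ℝ) - 2) * (c k) ^ 2 * x ^ (k - 3)

set_option linter.unusedSectionVars false

namespace SpinGlass

open scoped RealInnerProductSpace

section GaussianFamilies

variable {Ω Ω' U : Type*} [MeasurableSpace Ω] [MeasurableSpace Ω'] [Fintype U]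

/-- `X` is a centred Gaussian family with covariance `K` under `μ`. -/
structure IsGaussFamily (μ : Measure Ω) (X : U → Ω → ℝ) (K : U → U → ℝ) : Prop where
  meas : ∀ u, Measurable (X u)
  char : ∀ t : U → ℝ, ∫ ω, Complex.exp ((∑ u, t u * X u ω : ℝ) * Complex.I) ∂μ
    = Complex.exp (-(∑ u, ∑ u', t u * t u' * K u u' : ℝ) / 2)

lemma IsGaussFamily.measurable {μ : Measure Ω} {X : U → Ω → ℝ} {K : U → U → ℝ}
    (hX : IsGaussFamily μ X K) : Measurable (fun ω u => X u ω) :=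
  measurable_pi_lambda _ hX.meas

lemma IsGaussFamily.map_eq {μ : Measure Ω} {ν : Measure Ω'} [IsProbabilityMeasure μ]
    [IsProbabilityMeasure ν] {X : U → Ω → ℝ} {Y : U → Ω' → ℝ} {K : U → U → ℝ}
    (hX : IsGaussFamily μ X K) (hY : IsGaussFamily ν Y K) :
    μ.map (fun ω u => X u ω) = ν.map (fun ω u => Y u ω) := by
  classical
  have := Measure.isProbabilityMeasure_map (μ := μ) hX.measurable.aemeasurable
  have := Measure.isProbabilityMeasure_map (μ := ν) hY.measurable.aemeasurable
  apply Measure.ext_of_charFunDual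
  ext L
  have key : ∀ f : U → ℝ, L f = ∑ u, L (Pi.single u 1) * f u := by
    intro f
    conv_lhs => rw [pi_eq_sum_univ' f]
    rw [map_sum]
    refine Finset.sum_congr rfl fun u _ => ?_
    rw [map_smul, smul_eq_mul, mul_comm]
  rw [charFunDual_apply, charFunDual_apply, integral_map hX.measurable.aemeasurable,
    integral_map hY.measurable.aemeasurable]
  · have e1 : ∀ (W : U → ℝ), Complex.exp (L W * Complex.I)
        = Complex.exp ((∑ u, L (Pi.single u 1) * W u : ℝ) * Complex.I) := fun W => by rw [← key]
    rw [integral_congr_ae (ae_of_all _ fun ω => e1 _), integral_congr_ae (ae_of_all _ fun ω => e1 _),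
      hX.char (fun u => L (Pi.single u 1)), hY.char (fun u => L (Pi.single u 1))]
  · exact (by fun_prop : Continuous _).aestronglyMeasurable
  · exact (by fun_prop : Continuous _).aestronglyMeasurable

lemma IsGaussFamily.integral_eq {μ : Measure Ω} {ν : Measure Ω'} [IsProbabilityMeasure μ]
    [IsProbabilityMeasure ν] {X : U → Ω → ℝ} {Y : U → Ω' → ℝ} {K : U → U → ℝ}
    (hX : IsGaussFamily μ X K) (hY : IsGaussFamily ν Y K) {Φ : (U → ℝ) → ℝ} (hΦ : Measurable Φ) :
    ∫ ω, Φ (fun u => X u ω) ∂μ = ∫ ω, Φ (fun u => Y u ω) ∂ν := by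
  rw [← integral_map hX.measurable.aemeasurable hΦ.aestronglyMeasurable, hX.map_eq hY,
    integral_map hY.measurable.aemeasurable hΦ.aestronglyMeasurable]

end GaussianFamilies

section StdGaussian

variable {E F : Type*} [NormedAddCommGroup E] [InnerProductSpace ℝ E] [FiniteDimensional ℝ E]
  [MeasurableSpace E] [BorelSpace E]
  [NormedAddCommGroup F] [InnerProductSpace ℝ F] [FiniteDimensional ℝ F]
  [MeasurableSpace F] [BorelSpace F]

lemma isGaussFamily_inner {U : Type*} [Fintype U] (z : U → E) :
    IsGaussFamily (stdGaussian E) (fun u g => ⟪z u, g⟫) (fun u u' => ⟪z u, z u'⟫) where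
  meas u := by fun_prop
  char t := by
    have h := charFun_stdGaussian (∑ u, t u • z u)
    rw [charFun_apply] at h
    convert h using 3 with g
    · simp only [inner_sum, real_inner_smul_right, real_inner_comm]
    · rw [← Complex.ofReal_pow, ← real_inner_self_eq_norm_sq]
      simp only [inner_sum, sum_inner, real_inner_smul_right, real_inner_smul_left]
      congr 2
      rw [Finset.sum_comm]
      exact Finset.sum_congr rfl fun u _ => Finset.sum_congr rfl fun u' _ => by
        rw [real_inner_comm]; ring

lemma map_eq_stdGaussian_of_char {Ω : Type*} [MeasurableSpace Ω] {μ : Measure Ω}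
    [IsProbabilityMeasure μ] {f : Ω → E} (hf : Measurable f)
    (h : ∀ t, ∫ ω, Complex.exp (⟪f ω, t⟫ * Complex.I) ∂μ = Complex.exp (-‖t‖ ^ 2 / 2)) :
    μ.map f = stdGaussian E := by
  have := Measure.isProbabilityMeasure_map (μ := μ) hf.aemeasurable
  apply Measure.ext_of_charFun
  ext t
  rw [charFun_stdGaussian, charFun_apply, integral_map hf.aemeasurable, h]
  exact (by fun_prop : Continuous _).aestronglyMeasurable

lemma map_prod_stdGaussian :
    ((stdGaussian E).prod (stdGaussian F)).map (WithLp.toLp 2) =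
      stdGaussian (WithLp 2 (E × F)) := by
  have : IsProbabilityMeasure (((stdGaussian E).prod (stdGaussian F)).map (WithLp.toLp 2)) :=
    Measure.isProbabilityMeasure_map (by fun_prop)
  apply Measure.ext_of_charFun
  ext t
  rw [charFun_prod, charFun_stdGaussian, charFun_stdGaussian, charFun_stdGaussian, ← Complex.exp_add,
    ← Complex.ofReal_pow, ← Complex.ofReal_pow, ← Complex.ofReal_pow, WithLp.prod_norm_sq_eq_of_L2]
  change _ = Complex.exp (-((‖t.ofLp.1‖ ^ 2 + ‖t.ofLp.2‖ ^ 2 : ℝ) : ℂ) / 2)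
  congr 1
  push_cast
  ring

lemma measurePreserving_toLp_prod :
    MeasurePreserving (WithLp.toLp 2 : E × F → WithLp 2 (E × F))
      ((stdGaussian E).prod (stdGaussian F)) (stdGaussian (WithLp 2 (E × F))) :=
  ⟨by fun_prop, map_prod_stdGaussian⟩

lemma integral_stdGaussian_charFun (s : E) :
    ∫ g, Complex.exp (⟪g, s⟫ * Complex.I) ∂(stdGaussian E) = Complex.exp (-‖s‖ ^ 2 / 2) := by
  rw [← charFun_stdGaussian, charFun_apply]

lemma integral_gaussianReal_charFun (s : ℝ) :
    ∫ x, Complex.exp ((x * s : ℝ) * Complex.I) ∂(gaussianReal 0 1)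
      = Complex.exp (-(s : ℂ) ^ 2 / 2) := by
  have := charFun_gaussianReal (μ := 0) (v := 1) s
  rw [charFun_apply_real] at this
  convert this using 3
  · push_cast; ring_nf
  · simp [neg_div]

/-- Resampling of the component of a standard Gaussian vector in a projection `p`. -/
lemma map_resample (p : E →L[ℝ] E) (hp : ∀ x y, ⟪p x, y⟫ = ⟪x, p y⟫) (hpp : ∀ x, p (p x) = p x) :
    ((stdGaussian E).prod (stdGaussian E)).map (fun g => p g.1 + (g.2 - p g.2))
      = stdGaussian E := by
  apply map_eq_stdGaussian_of_char (by fun_prop)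
  intro t
  have h1 : ∀ g : E × E, Complex.exp (⟪p g.1 + (g.2 - p g.2), t⟫ * Complex.I)
      = Complex.exp (⟪g.1, p t⟫ * Complex.I) * Complex.exp (⟪g.2, t - p t⟫ * Complex.I) := by
    intro g
    rw [← Complex.exp_add, ← add_mul, ← Complex.ofReal_add]
    congr 3
    rw [inner_add_left, inner_sub_left, inner_sub_right, hp, hp]
  simp_rw [h1]
  rw [integral_prod_mul (fun g : E => Complex.exp (⟪g, p t⟫ * Complex.I))
    (fun g : E => Complex.exp (⟪g, t - p t⟫ * Complex.I)),
    integral_stdGaussian_charFun, integral_stdGaussian_charFun, ← Complex.exp_add]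
  congr 1
  have h2 : ‖t‖ ^ 2 = ‖p t‖ ^ 2 + ‖t - p t‖ ^ 2 := by
    have := norm_add_sq_real (p t) (t - p t)
    rw [add_sub_cancel, inner_sub_right, hp, hp, hpp, sub_self] at this
    linarith
  rw [← Complex.ofReal_pow, ← Complex.ofReal_pow, ← Complex.ofReal_pow, h2]
  push_cast
  ring

/-- Resampling of a single coordinate of a standard Gaussian vector. -/
lemma map_resample_unit (h : E) (hh : ‖h‖ = 1) :
    ((stdGaussian E).prod (gaussianReal 0 1)).map (fun g => g.1 - ⟪h, g.1⟫ • h + g.2 • h)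
      = stdGaussian E := by
  apply map_eq_stdGaussian_of_char (by fun_prop)
  intro t
  have h1 : ∀ g : E × ℝ, Complex.exp (⟪g.1 - ⟪h, g.1⟫ • h + g.2 • h, t⟫ * Complex.I)
      = Complex.exp (⟪g.1, t - ⟪h, t⟫ • h⟫ * Complex.I)
        * Complex.exp ((g.2 * ⟪h, t⟫ : ℝ) * Complex.I) := by
    intro g
    rw [← Complex.exp_add, ← add_mul, ← Complex.ofReal_add]
    congr 3
    simp only [inner_add_left, inner_sub_left, inner_sub_right, real_inner_smul_left,
      real_inner_smul_right]
    rw [real_inner_comm h g.1]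
    ring
  simp_rw [h1]
  rw [integral_prod_mul (fun g : E => Complex.exp (⟪g, t - ⟪h, t⟫ • h⟫ * Complex.I))
    (fun x : ℝ => Complex.exp ((x * ⟪h, t⟫ : ℝ) * Complex.I)),
    integral_stdGaussian_charFun, integral_gaussianReal_charFun, ← Complex.exp_add]
  congr 1
  have h2 : ‖t‖ ^ 2 = ‖t - ⟪h, t⟫ • h‖ ^ 2 + ⟪h, t⟫ ^ 2 := by
    rw [norm_sub_sq_real, real_inner_smul_right, norm_smul, hh, real_inner_comm]
    simp only [Real.norm_eq_abs, mul_one, sq_abs]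
    ring
  rw [← Complex.ofReal_pow, ← Complex.ofReal_pow, ← Complex.ofReal_pow, h2]
  push_cast
  ring

end StdGaussian

section LogSumExp

variable {U : Type*} [Fintype U] [Nonempty U]

/-- The log-sum-exp function. -/
def LSE (x : U → ℝ) : ℝ := Real.log (∑ u, Real.exp (x u))

/-- The Gibbs weights. -/
def gibbs (x : U → ℝ) (u : U) : ℝ := Real.exp (x u) / ∑ u', Real.exp (x u')

lemma sum_exp_pos (x : U → ℝ) : 0 < ∑ u, Real.exp (x u) :=
  Finset.sum_pos (fun _ _ => Real.exp_pos _) Finset.univ_nonempty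

lemma gibbs_pos (x : U → ℝ) (u : U) : 0 < gibbs x u :=
  div_pos (Real.exp_pos _) (sum_exp_pos x)

lemma sum_gibbs (x : U → ℝ) : ∑ u, gibbs x u = 1 := by
  unfold gibbs
  rw [← Finset.sum_div, div_self (sum_exp_pos x).ne']

lemma gibbs_le_one (x : U → ℝ) (u : U) : gibbs x u ≤ 1 := by
  rw [← sum_gibbs x]
  exact Finset.single_le_sum (fun v _ => (gibbs_pos x v).le) (Finset.mem_univ u)

lemma exp_LSE (x : U → ℝ) : Real.exp (LSE x) = ∑ u, Real.exp (x u) :=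
  Real.exp_log (sum_exp_pos x)

lemma le_LSE (x : U → ℝ) (u : U) : x u ≤ LSE x := by
  rw [← Real.exp_le_exp, exp_LSE]
  exact Finset.single_le_sum (f := fun u => Real.exp (x u))
    (fun v _ => (Real.exp_pos _).le) (Finset.mem_univ u)

lemma LSE_le (x : U → ℝ) (b : ℝ) (h : ∀ u, x u ≤ b) :
    LSE x ≤ Real.log (Fintype.card U) + b := by
  have hc : (0 : ℝ) < Fintype.card U := by exact_mod_cast Fintype.card_pos
  rw [← Real.exp_le_exp, exp_LSE, Real.exp_add, Real.exp_log hc]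
  calc ∑ u, Real.exp (x u) ≤ ∑ _u : U, Real.exp b :=
        Finset.sum_le_sum fun u _ => Real.exp_le_exp.2 (h u)
    _ = _ := by simp

lemma LSE_mono {x y : U → ℝ} (h : ∀ u, x u ≤ y u) : LSE x ≤ LSE y :=
  Real.log_le_log (sum_exp_pos x) (Finset.sum_le_sum fun u _ => Real.exp_le_exp.2 (h u))

lemma abs_LSE_le (x : U → ℝ) : |LSE x| ≤ Real.log (Fintype.card U) + ∑ u, |x u| := by
  have hc : (0 : ℝ) ≤ Real.log (Fintype.card U) := Real.log_nonneg (by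
    exact_mod_cast Fintype.card_pos)
  have h1 : ∀ u, |x u| ≤ ∑ u, |x u| := fun u =>
    Finset.single_le_sum (f := fun u => |x u|) (fun v _ => abs_nonneg _) (Finset.mem_univ u)
  rw [abs_le]
  constructor
  · obtain ⟨u⟩ := ‹Nonempty U›
    have := le_LSE x u
    have := h1 u
    have := neg_abs_le (x u)
    linarith
  · exact LSE_le _ _ fun u => (le_abs_self _).trans (h1 u)

lemma continuous_LSE : Continuous (LSE : (U → ℝ) → ℝ) := by
  unfold LSE
  exact Continuous.log (by fun_prop) fun x => (sum_exp_pos x).ne'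

lemma continuous_gibbs (u : U) : Continuous (fun x : U → ℝ => gibbs x u) := by
  unfold gibbs
  exact Continuous.div (by fun_prop) (by fun_prop) fun x => (sum_exp_pos x).ne'

lemma hasDerivAt_sum_exp {x : ℝ → U → ℝ} {x' : U → ℝ} {t : ℝ}
    (h : ∀ u, HasDerivAt (fun s => x s u) (x' u) t) :
    HasDerivAt (fun s => ∑ u, Real.exp (x s u)) (∑ u, Real.exp (x t u) * x' u) t :=
  HasDerivAt.fun_sum fun u _ => (h u).exp

lemma hasDerivAt_LSE {x : ℝ → U → ℝ} {x' : U → ℝ} {t : ℝ}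
    (h : ∀ u, HasDerivAt (fun s => x s u) (x' u) t) :
    HasDerivAt (fun s => LSE (x s)) (∑ u, gibbs (x t) u * x' u) t := by
  refine ((hasDerivAt_sum_exp h).log (sum_exp_pos _).ne').congr_deriv ?_
  rw [Finset.sum_div]
  exact Finset.sum_congr rfl fun u _ => by unfold gibbs; ring

lemma hasDerivAt_gibbs {x : ℝ → U → ℝ} {x' : U → ℝ} {t : ℝ}
    (h : ∀ u, HasDerivAt (fun s => x s u) (x' u) t) (u : U) :
    HasDerivAt (fun s => gibbs (x s) u)
      (gibbs (x t) u * (x' u - ∑ u', gibbs (x t) u' * x' u')) t := by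
  refine ((h u).exp.fun_div (hasDerivAt_sum_exp h) (sum_exp_pos _).ne').congr_deriv ?_
  have e : ∑ u', gibbs (x t) u' * x' u'
      = (∑ u', Real.exp (x t u') * x' u') / ∑ u', Real.exp (x t u') := by
    rw [Finset.sum_div]
    exact Finset.sum_congr rfl fun u _ => by unfold gibbs; ring
  rw [e]
  unfold gibbs
  have := (sum_exp_pos (x t)).ne'
  field_simp

lemma LSE_add_const (x : U → ℝ) (b : ℝ) : LSE (fun u => x u + b) = LSE x + b := by
  unfold LSE
  simp_rw [Real.exp_add]
  rw [← Finset.sum_mul, Real.log_mul (sum_exp_pos x).ne' (Real.exp_pos _).ne', Real.log_exp]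

lemma LSE_prod {V : Type*} [Fintype V] [Nonempty V] (x : U → ℝ) (y : V → ℝ) :
    LSE (fun p : U × V => x p.1 + y p.2) = LSE x + LSE y := by
  unfold LSE
  simp_rw [Real.exp_add]
  rw [← Real.log_mul (sum_exp_pos x).ne' (sum_exp_pos y).ne', Finset.sum_mul_sum,
    Fintype.sum_prod_type]

/-- Gibbs expectations are bounded by uniform bounds. -/
lemma abs_gibbs_sum_le (x : U → ℝ) (a : U → ℝ) (b : ℝ) (h : ∀ u, |a u| ≤ b) :
    |∑ u, gibbs x u * a u| ≤ b := by
  calc |∑ u, gibbs x u * a u| ≤ ∑ u, |gibbs x u * a u| := Finset.abs_sum_le_sum_abs _ _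
    _ ≤ ∑ u, gibbs x u * b := Finset.sum_le_sum fun u _ => by
        rw [abs_mul, abs_of_pos (gibbs_pos x u)]
        exact mul_le_mul_of_nonneg_left (h u) (gibbs_pos x u).le
    _ = b := by rw [← Finset.sum_mul, sum_gibbs, one_mul]

end LogSumExp

section Stein

lemma hasDerivAt_gaussianPDF (x : ℝ) :
    HasDerivAt (gaussianPDFReal 0 1) (-(x * gaussianPDFReal 0 1 x)) x := by
  have h : HasDerivAt (fun x : ℝ => (Real.sqrt (2 * Real.pi * (1 : ℝ≥0)))⁻¹ *
      Real.exp (-(x - 0) ^ 2 / (2 * (1 : ℝ≥0)))) ((Real.sqrt (2 * Real.pi * (1 : ℝ≥0)))⁻¹ *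
      (Real.exp (-(x - 0) ^ 2 / (2 * (1 : ℝ≥0))) * (-(2 * x) / (2 * (1 : ℝ≥0))))) x := by
    refine HasDerivAt.const_mul _ (HasDerivAt.exp (HasDerivAt.div_const ?_ _))
    simpa using (hasDerivAt_pow 2 x).fun_neg
  refine h.congr_deriv ?_
  unfold gaussianPDFReal
  simp only [NNReal.coe_one, mul_one, sub_zero]
  ring

lemma gaussian_stein_real {f f' : ℝ → ℝ} (hf : ∀ x, HasDerivAt f (f' x) x) {C : ℝ}
    (hfC : ∀ x, |f x| ≤ C) (hf'C : ∀ x, |f' x| ≤ C) (hf'm : Measurable f') :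
    ∫ x, x * f x ∂(gaussianReal 0 1) = ∫ x, f' x ∂(gaussianReal 0 1) := by
  have hfm : Measurable f :=
    (continuous_iff_continuousAt.2 fun x => (hf x).continuousAt).measurable
  have i0 : Integrable (gaussianPDFReal 0 1) := integrable_gaussianPDFReal 0 1
  have i1 : Integrable (fun x => x * gaussianPDFReal 0 1 x) := by
    have h : Integrable (fun x : ℝ => x) (gaussianReal 0 1) := IsGaussian.integrable_id
    rw [gaussianReal_of_var_ne_zero 0 one_ne_zero] at h
    unfold gaussianPDF at h
    rw [integrable_withDensity_iff_integrable_smul₀' (by fun_prop) (by simp)] at h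
    refine h.congr (ae_of_all _ fun x => ?_)
    simp [ENNReal.toReal_ofReal (gaussianPDFReal_nonneg 0 1 x), mul_comm]
  rw [integral_gaussianReal_eq_integral_smul one_ne_zero,
    integral_gaussianReal_eq_integral_smul one_ne_zero]
  simp only [smul_eq_mul]
  have key := integral_mul_deriv_eq_deriv_mul_of_integrable (u := f) (v := gaussianPDFReal 0 1)
    (u' := f') (v' := fun x => -(x * gaussianPDFReal 0 1 x)) (fun x _ => hf x)
    (fun x _ => hasDerivAt_gaussianPDF x)
    (i1.neg.bdd_mul hfm.aestronglyMeasurable (ae_of_all _ hfC))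
    (i0.bdd_mul hf'm.aestronglyMeasurable (ae_of_all _ hf'C))
    (i0.bdd_mul hfm.aestronglyMeasurable (ae_of_all _ hfC))
  have e1 : ∀ x, gaussianPDFReal 0 1 x * (x * f x) = -(f x * -(x * gaussianPDFReal 0 1 x)) :=
    fun x => by ring
  have e2 : ∀ x, gaussianPDFReal 0 1 x * f' x = f' x * gaussianPDFReal 0 1 x := fun x => by ring
  simp_rw [e1, e2]
  rw [integral_neg, key, neg_neg]

variable {E : Type*} [NormedAddCommGroup E] [InnerProductSpace ℝ E] [FiniteDimensional ℝ E]
  [MeasurableSpace E] [BorelSpace E]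

lemma integrable_norm_stdGaussian : Integrable (fun g : E => ‖g‖) (stdGaussian E) :=
  IsGaussian.integrable_id.norm

lemma integrable_inner_stdGaussian (h : E) : Integrable (fun g : E => ⟪h, g⟫) (stdGaussian E) :=
  IsGaussian.integrable_id.const_inner h

lemma stein_unit {h : E} (hh : ‖h‖ = 1) {F F' : E → ℝ}
    (hF : ∀ g, HasDerivAt (fun s : ℝ => F (g + s • h)) (F' g) 0)
    {C : ℝ} (hFC : ∀ g, |F g| ≤ C) (hF'C : ∀ g, |F' g| ≤ C) (hFm : Measurable F)
    (hF'm : Measurable F') :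
    ∫ g, ⟪h, g⟫ * F g ∂(stdGaussian E) = ∫ g, F' g ∂(stdGaussian E) := by
  have hmap := map_resample_unit h hh
  have hm : Measurable (fun g : E × ℝ => g.1 - ⟪h, g.1⟫ • h + g.2 • h) := by fun_prop
  have hin : ∀ (g : E) (s : ℝ), ⟪h, g - ⟪h, g⟫ • h + s • h⟫ = s := by
    intro g s
    rw [inner_add_right, inner_sub_right, real_inner_smul_right, real_inner_smul_right,
      real_inner_self_eq_norm_sq, hh]
    ring
  have hI1 : Integrable (fun g => ⟪h, g⟫ * F g) (stdGaussian E) :=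
    (integrable_inner_stdGaussian h).mul_bdd hFm.aestronglyMeasurable (ae_of_all _ hFC)
  have hI2 : Integrable F' (stdGaussian E) :=
    Integrable.of_bound hF'm.aestronglyMeasurable C (ae_of_all _ hF'C)
  rw [← hmap] at hI1 hI2
  rw [integrable_map_measure hI1.aestronglyMeasurable hm.aemeasurable] at hI1
  rw [integrable_map_measure hI2.aestronglyMeasurable hm.aemeasurable] at hI2
  conv_lhs => rw [← hmap]
  conv_rhs => rw [← hmap]
  rw [integral_map hm.aemeasurable (by fun_prop), integral_map hm.aemeasurable (by fun_prop)]
  refine (integral_prod _ hI1).trans (Eq.trans ?_ (integral_prod _ hI2).symm)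
  refine integral_congr_ae (ae_of_all _ fun g => ?_)
  simp only [Function.comp_apply, hin]
  refine gaussian_stein_real (f := fun s => F (g - ⟪h, g⟫ • h + s • h)) (C := C)
    (fun s => ?_) (fun s => hFC _) (fun s => hF'C _) (hF'm.comp (by fun_prop))
  have h1 := hF (g - ⟪h, g⟫ • h + s • h)
  have h2 : HasDerivAt (fun s' : ℝ => s' - s) 1 s := (hasDerivAt_id s).sub_const s
  rw [← sub_self s] at h1
  have h3 := HasDerivAt.comp (h := fun s' : ℝ => s' - s) s h1 h2
  rw [mul_one] at h3
  refine h3.congr_of_eventuallyEq (Eventually.of_forall fun s' => ?_)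
  simp only [Function.comp_apply, sub_smul]
  congr 1
  abel

/-- Gaussian integration by parts. -/
lemma stein {h : E} {F F' : E → ℝ}
    (hF : ∀ g, HasDerivAt (fun s : ℝ => F (g + s • h)) (F' g) 0)
    {C : ℝ} (hFC : ∀ g, |F g| ≤ C) (hF'C : ∀ g, |F' g| ≤ C) (hFm : Measurable F)
    (hF'm : Measurable F') :
    ∫ g, ⟪h, g⟫ * F g ∂(stdGaussian E) = ∫ g, F' g ∂(stdGaussian E) := by
  by_cases h0 : h = 0
  · subst h0
    have : ∀ g, F' g = 0 := fun g => (hF g).unique (by simpa using hasDerivAt_const (0 : ℝ) (F g))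
    simp [this]
  have hn : 0 < ‖h‖ := norm_pos_iff.2 h0
  have key := stein_unit (h := ‖h‖⁻¹ • h) (F := F) (F' := fun g => ‖h‖⁻¹ * F' g)
    (C := max C (‖h‖⁻¹ * C))
    (by rw [norm_smul, norm_inv, norm_norm, inv_mul_cancel₀ hn.ne']) (fun g => by
      have h1 := hF g
      have h2 : HasDerivAt (fun s : ℝ => s * ‖h‖⁻¹) (‖h‖⁻¹) 0 := by
        simpa using (hasDerivAt_id (0 : ℝ)).mul_const (‖h‖⁻¹)
      rw [← zero_mul (‖h‖⁻¹)] at h1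
      have h3 := HasDerivAt.comp (h := fun s : ℝ => s * ‖h‖⁻¹) (0 : ℝ) h1 h2
      rw [mul_comm] at h3
      refine h3.congr_of_eventuallyEq (Eventually.of_forall fun s' => ?_)
      simp [smul_smul])
    (fun g => (hFC g).trans (le_max_left _ _))
    (fun g => by
      rw [abs_mul, abs_of_pos (inv_pos.2 hn)]
      exact (mul_le_mul_of_nonneg_left (hF'C g) (inv_pos.2 hn).le).trans (le_max_right _ _))
    hFm (by fun_prop)
  simp_rw [real_inner_smul_left, mul_assoc] at key
  rw [integral_const_mul, integral_const_mul] at key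
  exact mul_left_cancel₀ (inv_ne_zero hn.ne') key

end Stein

section FreeEnergy

variable {E F : Type*} [NormedAddCommGroup E] [InnerProductSpace ℝ E] [FiniteDimensional ℝ E]
  [MeasurableSpace E] [BorelSpace E] {U : Type*} [Fintype U] [Nonempty U]

/-- The Gaussian field with deterministic part `w` and feature vectors `z`. -/
def field (w : U → ℝ) (z : U → E) (g : E) (u : U) : ℝ := w u + ⟪z u, g⟫

/-- The free energy of a Gaussian field. -/
def freeE (w : U → ℝ) (z : U → E) : ℝ := ∫ g, LSE (field w z g) ∂(stdGaussian E)

lemma continuous_field (w : U → ℝ) (z : U → E) : Continuous (field w z) := by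
  unfold field
  fun_prop

lemma continuous_LSE_field (w : U → ℝ) (z : U → E) : Continuous (fun g => LSE (field w z g)) :=
  continuous_LSE.comp (continuous_field w z)

lemma continuous_gibbs_field (w : U → ℝ) (z : U → E) (u : U) :
    Continuous (fun g => gibbs (field w z g) u) :=
  (continuous_gibbs u).comp (continuous_field w z)

lemma integrable_LSE_field (w : U → ℝ) (z : U → E) :
    Integrable (fun g => LSE (field w z g)) (stdGaussian E) := by
  have hi : Integrable (fun g : E => Real.log (Fintype.card U) + ∑ u, |field w z g u|)
      (stdGaussian E) := by
    refine (integrable_const _).add (integrable_finsetSum _ fun u _ => Integrable.abs ?_)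
    exact (integrable_const (w u)).add (integrable_inner_stdGaussian (z u))
  exact hi.mono' (continuous_LSE_field w z).aestronglyMeasurable
    (ae_of_all _ fun g => abs_LSE_le _)

lemma hasDerivAt_field_line (w : U → ℝ) (z : U → E) (g h : E) (u : U) :
    HasDerivAt (fun s : ℝ => field w z (g + s • h) u) ⟪z u, h⟫ 0 := by
  unfold field
  simp only [inner_add_right, real_inner_smul_right]
  have := (((hasDerivAt_id (0 : ℝ)).mul_const ⟪z u, h⟫).const_add ⟪z u, g⟫).const_add (w u)
  simpa using this

lemma hasDerivAt_gibbs_line (w : U → ℝ) (z : U → E) (g h : E) (u : U) :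
    HasDerivAt (fun s : ℝ => gibbs (field w z (g + s • h)) u)
      (gibbs (field w z g) u * (⟪z u, h⟫ - ∑ u', gibbs (field w z g) u' * ⟪z u', h⟫)) 0 := by
  have := hasDerivAt_gibbs (x := fun s : ℝ => field w z (g + s • h))
    (fun u => hasDerivAt_field_line w z g h u) u
  simpa using this

lemma gibbs_stein_one (w : U → ℝ) (z : U → E) (h : E) (u : U) :
    ∫ g, ⟪h, g⟫ * gibbs (field w z g) u ∂(stdGaussian E) =
      ∫ g, gibbs (field w z g) u * (⟪z u, h⟫ - ∑ u', gibbs (field w z g) u' * ⟪z u', h⟫)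
        ∂(stdGaussian E) := by
  set B : ℝ := ∑ u, |⟪z u, h⟫| with hB
  have hB0 : ∀ u, |⟪z u, h⟫| ≤ B := fun u =>
    Finset.single_le_sum (f := fun u => |⟪z u, h⟫|) (fun v _ => abs_nonneg _) (Finset.mem_univ u)
  have hBn : 0 ≤ B := Finset.sum_nonneg fun _ _ => abs_nonneg _
  have hc := continuous_gibbs_field w z
  refine stein (C := 1 + 2 * B) (fun g => hasDerivAt_gibbs_line w z g h u) (fun g => ?_) (fun g => ?_)
    (hc u).measurable (by fun_prop)
  · rw [abs_of_pos (gibbs_pos _ u)]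
    linarith [gibbs_le_one (field w z g) u]
  · rw [abs_mul, abs_of_pos (gibbs_pos _ u)]
    have h1 : |⟪z u, h⟫ - ∑ u', gibbs (field w z g) u' * ⟪z u', h⟫| ≤ 2 * B := by
      refine (abs_sub _ _).trans ?_
      linarith [hB0 u, abs_gibbs_sum_le (field w z g) (fun u => ⟪z u, h⟫) B hB0]
    calc _ ≤ 1 * (2 * B) := mul_le_mul (gibbs_le_one _ _) h1 (abs_nonneg _) zero_le_one
      _ ≤ _ := by linarith

lemma gibbs_stein_two (w : U → ℝ) (z : U → E) (h : E) (u v : U) :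
    ∫ g, ⟪h, g⟫ * (gibbs (field w z g) u * gibbs (field w z g) v) ∂(stdGaussian E) =
      ∫ g, gibbs (field w z g) u * gibbs (field w z g) v *
        (⟪z u, h⟫ + ⟪z v, h⟫ - 2 * ∑ u', gibbs (field w z g) u' * ⟪z u', h⟫)
        ∂(stdGaussian E) := by
  set B : ℝ := ∑ u, |⟪z u, h⟫| with hB
  have hB0 : ∀ u, |⟪z u, h⟫| ≤ B := fun u =>
    Finset.single_le_sum (f := fun u => |⟪z u, h⟫|) (fun v _ => abs_nonneg _) (Finset.mem_univ u)
  have hBn : 0 ≤ B := Finset.sum_nonneg fun _ _ => abs_nonneg _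
  have hc := continuous_gibbs_field w z
  have hp : ∀ g, |gibbs (field w z g) u * gibbs (field w z g) v| ≤ 1 := fun g => by
    rw [abs_of_pos (mul_pos (gibbs_pos _ u) (gibbs_pos _ v))]
    exact mul_le_one₀ (gibbs_le_one _ _) (gibbs_pos _ _).le (gibbs_le_one _ _)
  refine stein (C := 1 + 4 * B) (fun g => ?_) (fun g => ?_) (fun g => ?_)
    (by fun_prop) (by fun_prop)
  · refine ((hasDerivAt_gibbs_line w z g h u).fun_mul
      (hasDerivAt_gibbs_line w z g h v)).congr_deriv ?_
    simp only [zero_smul, add_zero]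
    ring
  · linarith [hp g]
  · rw [abs_mul]
    have h1 : |⟪z u, h⟫ + ⟪z v, h⟫ - 2 * ∑ u', gibbs (field w z g) u' * ⟪z u', h⟫| ≤ 4 * B := by
      have a1 := abs_le.1 (hB0 u)
      have a2 := abs_le.1 (hB0 v)
      have a3 := abs_le.1 (abs_gibbs_sum_le (field w z g) (fun u => ⟪z u, h⟫) B hB0)
      rw [abs_le]
      constructor <;> linarith [a1.1, a1.2, a2.1, a2.2, a3.1, a3.2]
    calc _ ≤ 1 * (4 * B) := mul_le_mul (hp g) h1 (abs_nonneg _) zero_le_one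
      _ ≤ _ := by linarith

lemma integrable_gibbs_mul (w : U → ℝ) (z : U → E) (u : U) {f : E → ℝ}
    (hf : Integrable f (stdGaussian E)) :
    Integrable (fun g => gibbs (field w z g) u * f g) (stdGaussian E) := by
  refine hf.bdd_mul (c := 1) (continuous_gibbs_field w z u).aestronglyMeasurable
    (ae_of_all _ fun g => ?_)
  rw [Real.norm_eq_abs, abs_of_pos (gibbs_pos _ _)]
  exact gibbs_le_one _ _

lemma integrable_gibbs (w : U → ℝ) (z : U → E) (u : U) :
    Integrable (fun g => gibbs (field w z g) u) (stdGaussian E) := by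
  simpa using integrable_gibbs_mul w z u (integrable_const (1 : ℝ))

/-- Two-replica averages. -/
def avg2 (w : U → ℝ) (z : U → E) (f : U → U → ℝ) : ℝ :=
  ∫ g, ∑ u, ∑ v, gibbs (field w z g) u * gibbs (field w z g) v * f u v ∂(stdGaussian E)

lemma integrable_avg2 (w : U → ℝ) (z : U → E) (f : U → U → ℝ) :
    Integrable (fun g => ∑ u, ∑ v, gibbs (field w z g) u * gibbs (field w z g) v * f u v)
      (stdGaussian E) := by
  refine integrable_finsetSum _ fun u _ => integrable_finsetSum _ fun v _ => ?_
  exact (integrable_gibbs_mul w z u (integrable_gibbs w z v)).mul_const _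

/-- One-replica averages. -/
def avg1 (w : U → ℝ) (z : U → E) (f : U → ℝ) : ℝ :=
  ∫ g, ∑ u, gibbs (field w z g) u * f u ∂(stdGaussian E)

lemma integrable_avg1 (w : U → ℝ) (z : U → E) (f : U → ℝ) :
    Integrable (fun g => ∑ u, gibbs (field w z g) u * f u) (stdGaussian E) :=
  integrable_finsetSum _ fun u _ => (integrable_gibbs w z u).mul_const _

lemma gibbs_stein_avg (w : U → ℝ) (z h : U → E) :
    ∫ g, ∑ u, gibbs (field w z g) u * ⟪h u, g⟫ ∂(stdGaussian E)
      = avg1 w z (fun u => ⟪z u, h u⟫) - avg2 w z (fun u v => ⟪h u, z v⟫) := by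
  unfold avg1 avg2
  rw [← integral_sub (integrable_avg1 w z _) (integrable_avg2 w z _),
    integral_finsetSum _ fun u _ =>
      integrable_gibbs_mul w z u (integrable_inner_stdGaussian (h u))]
  have e : ∀ g, (∑ u, gibbs (field w z g) u * ⟪z u, h u⟫
      - ∑ u, ∑ v, gibbs (field w z g) u * gibbs (field w z g) v * ⟪h u, z v⟫)
      = ∑ u, gibbs (field w z g) u * (⟪z u, h u⟫ - ∑ u', gibbs (field w z g) u' * ⟪z u', h u⟫) := by
    intro g
    rw [← Finset.sum_sub_distrib]
    refine Finset.sum_congr rfl fun u _ => ?_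
    rw [mul_sub, Finset.mul_sum]
    congr 1
    refine Finset.sum_congr rfl fun v _ => ?_
    rw [real_inner_comm, mul_assoc]
  simp_rw [e]
  rw [integral_finsetSum]
  · refine Finset.sum_congr rfl fun u _ => ?_
    rw [← gibbs_stein_one w z (h u) u]
    simp_rw [mul_comm]
  · intro u _
    refine integrable_gibbs_mul w z u ((integrable_const _).sub ?_)
    exact integrable_avg1 w z (fun u' => ⟪z u', h u⟫)

/-- Derivative of the free energy along a curve of features. -/
lemma hasDerivAt_freeE (w : U → ℝ) {z z' : ℝ → U → E}
    (hz : ∀ t u, HasDerivAt (fun s => z s u) (z' t u) t) {C : ℝ}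
    (hC : ∀ t u, ‖z' t u‖ ≤ C) (t : ℝ) :
    HasDerivAt (fun s => freeE w (z s))
      (avg1 w (z t) (fun u => ⟪z t u, z' t u⟫) - avg2 w (z t) (fun u v => ⟪z' t u, z t v⟫)) t := by
  rw [← gibbs_stein_avg]
  unfold freeE
  refine (hasDerivAt_integral_of_dominated_loc_of_deriv_le (s := Set.univ)
    (bound := fun g => C * ‖g‖) (F' := fun s g => ∑ u, gibbs (field w (z s) g) u * ⟪z' s u, g⟫)
    Filter.univ_mem
    (Eventually.of_forall fun s => (continuous_LSE_field w (z s)).aestronglyMeasurable)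
    (integrable_LSE_field w (z t)) ?_ (ae_of_all _ fun g s _ => ?_)
    (integrable_norm_stdGaussian.const_mul C) (ae_of_all _ fun g s _ => ?_)).2
  · have := continuous_gibbs_field w (z t)
    exact (by fun_prop : Continuous _).aestronglyMeasurable
  · refine abs_gibbs_sum_le _ _ _ fun u => (abs_real_inner_le_norm _ _).trans ?_
    exact mul_le_mul_of_nonneg_right (hC s u) (norm_nonneg g)
  · refine hasDerivAt_LSE (x := fun s => field w (z s) g) fun u => ?_
    unfold field
    have := ((hz s u).inner ℝ (hasDerivAt_const s g)).const_add (w u)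
    simpa using this

lemma avg2_nonneg_inner (w : U → ℝ) (z v : U → E) : 0 ≤ avg2 w z (fun a b => ⟪v a, v b⟫) := by
  refine integral_nonneg fun g => ?_
  have : ∑ a, ∑ b, gibbs (field w z g) a * gibbs (field w z g) b * ⟪v a, v b⟫
      = ⟪∑ a, gibbs (field w z g) a • v a, ∑ a, gibbs (field w z g) a • v a⟫ := by
    simp only [sum_inner, inner_sum, real_inner_smul_left, real_inner_smul_right]
    refine Finset.sum_congr rfl fun a _ => Finset.sum_congr rfl fun b _ => ?_
    rw [real_inner_comm (v a) (v b)]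
    ring
  rw [this]
  exact real_inner_self_nonneg

lemma avg1_mono (w : U → ℝ) (z : U → E) {f f' : U → ℝ} (h : ∀ u, f u ≤ f' u) :
    avg1 w z f ≤ avg1 w z f' :=
  integral_mono (integrable_avg1 w z f) (integrable_avg1 w z f') fun _ =>
    Finset.sum_le_sum fun u _ => mul_le_mul_of_nonneg_left (h u) (gibbs_pos _ u).le

lemma avg1_const (w : U → ℝ) (z : U → E) (b : ℝ) : avg1 w z (fun _ => b) = b := by
  unfold avg1
  simp [← Finset.sum_mul, sum_gibbs]

lemma avg2_mono (w : U → ℝ) (z : U → E) {f f' : U → U → ℝ} (h : ∀ u v, f u v ≤ f' u v) :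
    avg2 w z f ≤ avg2 w z f' :=
  integral_mono (integrable_avg2 w z f) (integrable_avg2 w z f') fun _ =>
    Finset.sum_le_sum fun u _ => Finset.sum_le_sum fun v _ =>
      mul_le_mul_of_nonneg_left (h u v) (mul_pos (gibbs_pos _ u) (gibbs_pos _ v)).le

lemma avg2_add (w : U → ℝ) (z : U → E) (f f' : U → U → ℝ) :
    avg2 w z (fun u v => f u v + f' u v) = avg2 w z f + avg2 w z f' := by
  unfold avg2
  rw [← integral_add (integrable_avg2 w z f) (integrable_avg2 w z f')]
  simp_rw [mul_add, Finset.sum_add_distrib]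

lemma avg2_const_mul (w : U → ℝ) (z : U → E) (b : ℝ) (f : U → U → ℝ) :
    avg2 w z (fun u v => b * f u v) = b * avg2 w z f := by
  unfold avg2
  rw [← integral_const_mul]
  simp_rw [Finset.mul_sum]
  refine integral_congr_ae (ae_of_all _ fun g => ?_)
  refine Finset.sum_congr rfl fun u _ => Finset.sum_congr rfl fun v _ => ?_
  ring

/-- The rotation curve interpolating between the features `y + v` and `x + v`. -/
def rotCurve (y x v : U → E) (t : ℝ) (u : U) : E := Real.cos t • y u + Real.sin t • x u + v u

lemma hasDerivAt_freeE_rotCurve (w : U → ℝ) (y x v : U → E) (hxy : ∀ a b, ⟪x a, y b⟫ = 0)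
    (hxv : ∀ a b, ⟪x a, v b⟫ = 0) (hyv : ∀ a b, ⟪y a, v b⟫ = 0) (t : ℝ) :
    HasDerivAt (fun s => freeE w (rotCurve y x v s))
      (Real.sin t * Real.cos t * (avg1 w (rotCurve y x v t) (fun a => ‖x a‖ ^ 2 - ‖y a‖ ^ 2)
        - avg2 w (rotCurve y x v t) (fun a b => ⟪x a, x b⟫ - ⟪y a, y b⟫))) t := by
  have hyx : ∀ a b, ⟪y a, x b⟫ = 0 := fun a b => by rw [real_inner_comm, hxy]
  have hvx : ∀ a b, ⟪v a, x b⟫ = 0 := fun a b => by rw [real_inner_comm, hxv]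
  have hvy : ∀ a b, ⟪v a, y b⟫ = 0 := fun a b => by rw [real_inner_comm, hyv]
  refine (hasDerivAt_freeE w (z := rotCurve y x v)
    (z' := fun t u => -Real.sin t • y u + Real.cos t • x u)
    (C := ∑ u, (‖y u‖ + ‖x u‖)) (fun t u => ?_) (fun t u => ?_) t).congr_deriv ?_
  · unfold rotCurve
    exact (((Real.hasDerivAt_cos t).smul_const (y u)).add
      ((Real.hasDerivAt_sin t).smul_const (x u))).add_const (v u)
  · refine le_trans ?_ (Finset.single_le_sum (f := fun u => ‖y u‖ + ‖x u‖)
      (fun _ _ => by positivity) (Finset.mem_univ u))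
    refine (norm_add_le _ _).trans (add_le_add ?_ ?_)
    · rw [norm_smul, norm_neg, Real.norm_eq_abs]
      exact mul_le_of_le_one_left (norm_nonneg _) (Real.abs_sin_le_one t)
    · rw [norm_smul, Real.norm_eq_abs]
      exact mul_le_of_le_one_left (norm_nonneg _) (Real.abs_cos_le_one t)
  · have e1 : ∀ a b, ⟪-Real.sin t • y a + Real.cos t • x a, rotCurve y x v t b⟫
        = Real.sin t * Real.cos t * (⟪x a, x b⟫ - ⟪y a, y b⟫) := by
      intro a b
      unfold rotCurve
      simp only [inner_add_left, inner_add_right, real_inner_smul_left, real_inner_smul_right,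
        hxy, hyx, hxv, hyv]
      ring
    simp_rw [fun a => real_inner_comm (-Real.sin t • y a + Real.cos t • x a) (rotCurve y x v t a),
      e1, avg2_const_mul, real_inner_self_eq_norm_sq]
    rw [mul_sub]
    congr 1
    unfold avg1
    rw [← integral_const_mul]
    simp_rw [Finset.mul_sum]
    refine integral_congr_ae (ae_of_all _ fun g => Finset.sum_congr rfl fun u _ => ?_)
    ring

lemma sin_mul_cos_mem {t : ℝ} (ht : t ∈ Set.Icc (0 : ℝ) (Real.pi / 2)) :
    0 ≤ Real.sin t * Real.cos t ∧ Real.sin t * Real.cos t ≤ 1 / 2 := by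
  constructor
  · exact mul_nonneg (Real.sin_nonneg_of_nonneg_of_le_pi ht.1 (by linarith [ht.2, Real.pi_pos]))
      (Real.cos_nonneg_of_neg_pi_div_two_le_of_le (by linarith [ht.1, Real.pi_pos]) ht.2)
  · nlinarith [sq_nonneg (Real.sin t - Real.cos t), Real.sin_sq_add_cos_sq t]

lemma sub_le_of_hasDerivAt_le {φ φ' : ℝ → ℝ} (h : ∀ t, HasDerivAt φ (φ' t) t) {C : ℝ}
    (hC : ∀ t ∈ Set.Icc (0 : ℝ) (Real.pi / 2), φ' t ≤ C) :
    φ (Real.pi / 2) - φ 0 ≤ C * (Real.pi / 2) := by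
  have := Convex.image_sub_le_mul_sub_of_deriv_le (convex_Icc (0 : ℝ) (Real.pi / 2))
    (f := φ) (C := C) (fun t _ => (h t).continuousAt.continuousWithinAt)
    (fun t _ => (h t).differentiableAt.differentiableWithinAt)
    (fun t ht => by rw [(h t).deriv]; exact hC t (interior_subset ht))
    0 ⟨le_rfl, by positivity⟩ (Real.pi / 2) ⟨by positivity, le_rfl⟩ (by positivity)
  simpa using this

/-- Adding an independent field increases the free energy by at most its maximal variance. -/
lemma freeE_add_le (w : U → ℝ) (z v : U → E) (hzv : ∀ a b, ⟪z a, v b⟫ = 0) {B : ℝ}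
    (hB : ∀ u, ‖v u‖ ^ 2 ≤ B) :
    freeE w (fun u => z u + v u) ≤ freeE w z + B ∧ freeE w z ≤ freeE w (fun u => z u + v u) := by
  have hd := hasDerivAt_freeE_rotCurve w (fun _ => 0) v z (by simp)
    (fun a b => by rw [real_inner_comm, hzv]) (by simp)
  have hB0 : 0 ≤ B := by
    obtain ⟨u⟩ := ‹Nonempty U›
    exact (sq_nonneg _).trans (hB u)
  have e0 : rotCurve (fun _ => 0) v z 0 = z := by ext u; simp [rotCurve]
  have e1 : rotCurve (fun _ => 0) v z (Real.pi / 2) = fun u => z u + v u := by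
    ext u; simp [rotCurve, add_comm]
  simp only [norm_zero, ne_eq, OfNat.ofNat_ne_zero, not_false_eq_true, zero_pow, sub_zero,
    inner_zero_left] at hd
  constructor
  · have := sub_le_of_hasDerivAt_le hd (C := B / 2) (fun t ht => by
      have h1 : avg1 w (rotCurve (fun _ => 0) v z t) (fun a => ‖v a‖ ^ 2) ≤ B := by
        rw [← avg1_const w (rotCurve (fun _ => 0) v z t) B]
        exact avg1_mono _ _ hB
      have h2 := avg2_nonneg_inner w (rotCurve (fun _ => 0) v z t) v
      have h3 := sin_mul_cos_mem ht
      nlinarith [h3.1, h3.2])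
    rw [e0, e1] at this
    nlinarith [Real.pi_le_four]
  · have hd' := fun t => (hd t).fun_neg
    have := sub_le_of_hasDerivAt_le hd' (C := 0) (fun t ht => by
      have h1 : avg2 w (rotCurve (fun _ => 0) v z t) (fun a b => ⟪v a, v b⟫)
          ≤ avg1 w (rotCurve (fun _ => 0) v z t) (fun a => ‖v a‖ ^ 2) := by
        unfold avg1 avg2
        refine integral_mono (integrable_avg2 w _ _) (integrable_avg1 w _ _) fun g => ?_
        set p := gibbs (field w (rotCurve (fun _ => 0) v z t) g) with hp
        have hs : ∑ u, p u = 1 := sum_gibbs _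
        calc ∑ a, ∑ b, p a * p b * ⟪v a, v b⟫
            ≤ ∑ a, ∑ b, p a * p b * ((‖v a‖ ^ 2 + ‖v b‖ ^ 2) / 2) := by
              refine Finset.sum_le_sum fun a _ => Finset.sum_le_sum fun b _ =>
                mul_le_mul_of_nonneg_left ?_ (mul_pos (gibbs_pos _ a) (gibbs_pos _ b)).le
              have := norm_sub_sq_real (v a) (v b)
              nlinarith [sq_nonneg ‖v a - v b‖]
          _ = ∑ a, p a * ‖v a‖ ^ 2 := by
              have s1 : ∀ a, ∑ b, p a * p b * ((‖v a‖ ^ 2 + ‖v b‖ ^ 2) / 2)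
                  = p a * ‖v a‖ ^ 2 / 2 * (∑ b, p b) + p a / 2 * ∑ b, p b * ‖v b‖ ^ 2 := by
                intro a
                rw [Finset.mul_sum, Finset.mul_sum, ← Finset.sum_add_distrib]
                exact Finset.sum_congr rfl fun b _ => by ring
              simp_rw [s1, hs]
              rw [Finset.sum_add_distrib, ← Finset.sum_mul, ← Finset.sum_mul, ← Finset.sum_div,
                ← Finset.sum_div, hs]
              ring
      have h3 := sin_mul_cos_mem ht
      nlinarith [h3.1, h3.2])
    rw [e0, e1] at this
    linarith

end FreeEnergy

section Concentration

variable {E : Type*} [NormedAddCommGroup E] [InnerProductSpace ℝ E] [FiniteDimensional ℝ E]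
  [MeasurableSpace E] [BorelSpace E]

lemma map_inner_stdGaussian (h : E) :
    (stdGaussian E).map (fun g => ⟪h, g⟫) = gaussianReal 0 (‖h‖₊ ^ 2) := by
  have h1 := IsGaussian.map_eq_gaussianReal (μ := stdGaussian E) (innerSL ℝ h)
  rw [integral_strongDual_stdGaussian, variance_dual_stdGaussian] at h1
  rw [show (fun g => ⟪h, g⟫) = ⇑(innerSL ℝ h) from rfl, h1]
  congr 1
  rw [innerSL_apply_norm]
  ext
  simp

lemma integrable_inner_sq (h : E) : Integrable (fun g : E => ⟪h, g⟫ ^ 2) (stdGaussian E) := by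
  have h1 : Integrable (fun x : ℝ => x ^ 2) ((stdGaussian E).map (fun g => ⟪h, g⟫)) := by
    rw [map_inner_stdGaussian]
    exact (memLp_id_gaussianReal 2).integrable_sq
  exact (integrable_map_measure h1.aestronglyMeasurable (by fun_prop)).1 h1

lemma integral_inner_sq (h : E) : ∫ g, ⟪h, g⟫ ^ 2 ∂(stdGaussian E) = ‖h‖ ^ 2 := by
  have h2 : ∫ x, x ^ 2 ∂((stdGaussian E).map (fun g => ⟪h, g⟫)) = ‖h‖ ^ 2 := by
    rw [map_inner_stdGaussian]
    have h0 := variance_eq_integral (X := id) (μ := gaussianReal 0 (‖h‖₊ ^ 2)) (by fun_prop)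
    rw [variance_id_gaussianReal] at h0
    simp only [id, integral_id_gaussianReal, sub_zero] at h0
    rw [← h0]
    simp
  rw [← h2, integral_map (by fun_prop) (by fun_prop)]

lemma integral_abs_inner_le (h : E) : ∫ g, |⟪h, g⟫| ∂(stdGaussian E) ≤ ‖h‖ := by
  by_cases h0 : h = 0
  · simp [h0]
  have hn : 0 < ‖h‖ := norm_pos_iff.2 h0
  have hi : Integrable (fun g => (⟪h, g⟫ ^ 2 * ‖h‖⁻¹ + ‖h‖) / 2) (stdGaussian E) :=
    (((integrable_inner_sq h).mul_const _).add (integrable_const _)).div_const 2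
  calc ∫ g, |⟪h, g⟫| ∂(stdGaussian E)
      ≤ ∫ g, (⟪h, g⟫ ^ 2 * ‖h‖⁻¹ + ‖h‖) / 2 ∂(stdGaussian E) := by
        refine integral_mono (integrable_inner_stdGaussian h).abs hi fun g => ?_
        have : (|⟪h, g⟫| - ‖h‖) ^ 2 * ‖h‖⁻¹ = ⟪h, g⟫ ^ 2 * ‖h‖⁻¹ + ‖h‖ - 2 * |⟪h, g⟫| := by
          rw [sub_sq, sq_abs]
          field_simp
          ring
        have : 0 ≤ (|⟪h, g⟫| - ‖h‖) ^ 2 * ‖h‖⁻¹ := by positivity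
        simp only
        linarith
    _ = ‖h‖ := by
        rw [integral_div, integral_add ((integrable_inner_sq h).mul_const _) (integrable_const _),
          integral_mul_const, integral_inner_sq]
        simp
        field_simp
        ring

variable {U : Type*} [Fintype U] [Nonempty U]

lemma integral_abs_gibbs_inner_le (w : U → ℝ) (V : U → E) {B : ℝ} (hB : ∀ u, ‖V u‖ ≤ B) :
    Integrable (fun p : E × E => ∑ u, gibbs (field w V p.1) u * |⟪V u, p.2⟫|)
      ((stdGaussian E).prod (stdGaussian E)) ∧
    ∫ p : E × E, ∑ u, gibbs (field w V p.1) u * |⟪V u, p.2⟫|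
      ∂((stdGaussian E).prod (stdGaussian E)) ≤ B := by
  have hi : Integrable (fun p : E × E => ∑ u, gibbs (field w V p.1) u * |⟪V u, p.2⟫|)
      ((stdGaussian E).prod (stdGaussian E)) :=
    integrable_finsetSum _ fun u _ =>
      (integrable_gibbs w V u).mul_prod (integrable_inner_stdGaussian (V u)).abs
  refine ⟨hi, ?_⟩
  rw [integral_prod _ hi]
  calc _ ≤ ∫ _ : E, B ∂(stdGaussian E) := by
        refine integral_mono hi.integral_prod_left (integrable_const _) fun x => ?_
        simp only
        rw [integral_finsetSum _ fun u _ =>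
          (integrable_inner_stdGaussian (V u)).abs.const_mul _]
        simp_rw [integral_const_mul]
        calc _ ≤ ∑ u, gibbs (field w V x) u * B := by
              refine Finset.sum_le_sum fun u _ => mul_le_mul_of_nonneg_left
                ((integral_abs_inner_le _).trans (hB u)) (gibbs_pos _ _).le
          _ = B := by rw [← Finset.sum_mul, sum_gibbs, one_mul]
    _ = B := by simp

lemma integral_abs_LSE_sub_le (w : U → ℝ) (V : U → E) {B : ℝ} (hB : ∀ u, ‖V u‖ ≤ B) :
    ∫ p : E × E, |LSE (field w V p.2) - LSE (field w V p.1)|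
      ∂((stdGaussian E).prod (stdGaussian E)) ≤ Real.pi / 2 * B := by
  have hB0 : 0 ≤ B := by
    obtain ⟨u⟩ := ‹Nonempty U›
    exact (norm_nonneg _).trans (hB u)
  set μ := (stdGaussian E).prod (stdGaussian E) with hμ
  obtain ⟨rot, hrot⟩ : ∃ rot : ℝ → E × E → E × E, rot = fun θ p =>
    ContinuousLinearMap.rotation θ p := ⟨_, rfl⟩
  have hrotc : Continuous (fun q : ℝ × (E × E) => rot q.1 q.2) := by
    simp only [hrot, ContinuousLinearMap.rotation_apply]
    fun_prop
  obtain ⟨D, hD⟩ : ∃ D : E × E → ℝ, D = fun p => ∑ u, gibbs (field w V p.1) u * ⟪V u, p.2⟫ :=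
    ⟨_, rfl⟩
  have hgc := continuous_gibbs_field w V
  have hDc : Continuous D := by
    have := fun u => (hgc u).comp (continuous_fst (X := E) (Y := E))
    simp only [Function.comp_def] at this
    rw [hD]
    fun_prop
  have hDb : ∀ p, |D p| ≤ ∑ u, gibbs (field w V p.1) u * |⟪V u, p.2⟫| := fun p => by
    rw [hD]
    refine (Finset.abs_sum_le_sum_abs _ _).trans (Finset.sum_le_sum fun u _ => ?_)
    rw [abs_mul, abs_of_pos (gibbs_pos _ _)]
  have hDb2 : ∀ p, |D p| ≤ B * ‖p.2‖ := fun p => by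
    rw [hD]
    exact abs_gibbs_sum_le _ _ _ fun u => (abs_real_inner_le_norm _ _).trans
      (mul_le_mul_of_nonneg_right (hB u) (norm_nonneg _))
  have hD1 : ∫ p, |D p| ∂μ ≤ B := by
    obtain ⟨h1, h2⟩ := integral_abs_gibbs_inner_le w V hB
    exact (integral_mono_of_nonneg (ae_of_all _ fun _ => abs_nonneg _) h1
      (ae_of_all _ hDb)).trans h2
  have hDrot : ∀ θ, ∫ p, |D (rot θ p)| ∂μ ≤ B := by
    intro θ
    refine le_trans (le_of_eq ?_) hD1
    have h1 : μ.map (ContinuousLinearMap.rotation θ) = μ :=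
      IsGaussian.map_rotation_eq_self (by simp) θ
    conv_rhs => rw [← h1]
    rw [integral_map (by fun_prop) (by fun_prop), hrot]
  have hder : ∀ p : E × E, ∀ θ : ℝ, HasDerivAt (fun s => LSE (field w V (rot s p).1))
      (D (rot θ p)) θ := by
    intro p θ
    rw [hD]
    refine hasDerivAt_LSE (x := fun s => field w V (rot s p).1) fun u => ?_
    unfold field
    have h1 : HasDerivAt (fun s => (rot s p).1) (rot θ p).2 θ := by
      simp only [hrot, ContinuousLinearMap.rotation_apply]
      exact ((Real.hasDerivAt_cos θ).smul_const p.1).add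
        ((Real.hasDerivAt_sin θ).smul_const p.2)
    have := ((hasDerivAt_const θ (V u)).inner ℝ h1).const_add (w u)
    simpa using this
  have hbound : ∀ p : E × E, |LSE (field w V p.2) - LSE (field w V p.1)|
      ≤ ∫ θ in (0 : ℝ)..(Real.pi / 2), |D (rot θ p)| := by
    intro p
    have hc : Continuous fun θ => D (rot θ p) :=
      hDc.comp (hrotc.comp (by fun_prop : Continuous fun θ : ℝ => (θ, p)))
    have h1 := intervalIntegral.integral_eq_sub_of_hasDerivAt (a := 0) (b := Real.pi / 2)
      (f := fun θ => LSE (field w V (rot θ p).1)) (f' := fun θ => D (rot θ p)) (fun θ _ => hder p θ) (hc.intervalIntegrable _ _)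
    have e0 : (rot 0 p).1 = p.1 := by simp [hrot, ContinuousLinearMap.rotation_apply]
    have e1 : (rot (Real.pi / 2) p).1 = p.2 := by
      simp [hrot, ContinuousLinearMap.rotation_apply]
    rw [e0, e1] at h1
    rw [← h1]
    exact intervalIntegral.abs_integral_le_integral_abs (by positivity : 0 ≤ Real.pi / 2)
  have hi2 : Integrable (Function.uncurry fun (θ : ℝ) (p : E × E) => |D (rot θ p)|)
      ((volume.restrict (Set.Ioc 0 (Real.pi / 2))).prod μ) := by
    have hn : Integrable (fun p : E × E => B * (‖p.1‖ + ‖p.2‖)) μ :=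
      ((integrable_norm_stdGaussian.comp_fst _).add
        (integrable_norm_stdGaussian.comp_snd _)).const_mul B
    refine (hn.comp_snd (volume.restrict (Set.Ioc 0 (Real.pi / 2)))).mono'
      (hDc.comp hrotc).abs.aestronglyMeasurable (ae_of_all _ fun q => ?_)
    simp only [Function.uncurry, Real.norm_eq_abs, abs_abs]
    refine (hDb2 _).trans (mul_le_mul_of_nonneg_left ?_ hB0)
    simp only [hrot, ContinuousLinearMap.rotation_apply]
    refine (norm_add_le _ _).trans (add_le_add ?_ ?_)
    · rw [norm_smul, norm_neg, Real.norm_eq_abs]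
      exact mul_le_of_le_one_left (norm_nonneg _) (Real.abs_sin_le_one _)
    · rw [norm_smul, Real.norm_eq_abs]
      exact mul_le_of_le_one_left (norm_nonneg _) (Real.abs_cos_le_one _)
  calc _ ≤ ∫ p, (∫ θ in (0 : ℝ)..(Real.pi / 2), |D (rot θ p)|) ∂μ := by
        refine integral_mono_of_nonneg (ae_of_all _ fun _ => abs_nonneg _) ?_
          (ae_of_all _ hbound)
        simp only [intervalIntegral.integral_of_le (by positivity : (0 : ℝ) ≤ Real.pi / 2)]
        exact hi2.integral_prod_right
    _ = ∫ θ in (0 : ℝ)..(Real.pi / 2), ∫ p, |D (rot θ p)| ∂μ := by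
        simp only [intervalIntegral.integral_of_le (by positivity : (0 : ℝ) ≤ Real.pi / 2)]
        exact (integral_integral_swap hi2).symm
    _ ≤ ∫ θ in (0 : ℝ)..(Real.pi / 2), B := by
        refine intervalIntegral.integral_mono_on (by positivity) ?_ (by simp) fun θ _ => hDrot θ
        rw [intervalIntegrable_iff_integrableOn_Ioc_of_le (by positivity)]
        exact hi2.integral_prod_left
    _ = _ := by simp

/-- Gaussian concentration of the free energy in mean absolute deviation. -/
lemma integral_abs_LSE_sub_freeE_le (w : U → ℝ) (V : U → E) {B : ℝ} (hB : ∀ u, ‖V u‖ ≤ B) :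
    ∫ g, |LSE (field w V g) - freeE w V| ∂(stdGaussian E) ≤ 2 * B := by
  have hB0 : 0 ≤ B := by
    obtain ⟨u⟩ := ‹Nonempty U›
    exact (norm_nonneg _).trans (hB u)
  have hF := integrable_LSE_field w V
  have hi : Integrable (fun p : E × E => |LSE (field w V p.2) - LSE (field w V p.1)|)
      ((stdGaussian E).prod (stdGaussian E)) :=
    ((hF.comp_snd _).sub (hF.comp_fst _)).abs
  have h1 := integral_abs_LSE_sub_le w V hB
  rw [integral_prod _ hi] at h1
  refine le_trans ?_ (h1.trans (by nlinarith [Real.pi_le_four]))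
  refine integral_mono (hF.sub (integrable_const _)).abs hi.integral_prod_left fun g => ?_
  have h2 : LSE (field w V g) - freeE w V
      = -∫ g', (LSE (field w V g') - LSE (field w V g)) ∂(stdGaussian E) := by
    rw [integral_sub hF (integrable_const _)]
    simp [freeE]
  simp only
  rw [h2, abs_neg]
  exact abs_integral_le_integral_abs

end Concentration

section Positivity

variable {U : Type*} [Fintype U] [Nonempty U]

lemma sum_gibbs_mul_le_LSE_sub (x y : U → ℝ) :
    ∑ u, gibbs x u * y u ≤ LSE (fun u => x u + y u) - LSE x := by
  rw [← Real.exp_le_exp, Real.exp_sub, exp_LSE, exp_LSE]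
  have h := convexOn_exp.map_sum_le (t := Finset.univ) (w := gibbs x) (p := y)
    (fun u _ => (gibbs_pos x u).le) (sum_gibbs x) (fun _ _ => Set.mem_univ _)
  simp only [smul_eq_mul] at h
  refine h.trans (le_of_eq ?_)
  rw [Finset.sum_div]
  refine Finset.sum_congr rfl fun u _ => ?_
  rw [gibbs, Real.exp_add]
  ring

lemma LSE_add_abs_le (x y : U → ℝ) :
    LSE (fun u => x u + |y u|)
      ≤ Real.log 2 + max (LSE fun u => x u + y u) (LSE fun u => x u - y u) := by
  have h2 : Real.exp (Real.log 2) = 2 := Real.exp_log (by norm_num)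
  rw [← Real.exp_le_exp, exp_LSE, Real.exp_add, h2]
  have h1 : ∑ u, Real.exp (x u + |y u|)
      ≤ Real.exp (LSE fun u => x u + y u) + Real.exp (LSE fun u => x u - y u) := by
    rw [exp_LSE, exp_LSE, ← Finset.sum_add_distrib]
    refine Finset.sum_le_sum fun u _ => ?_
    rcases abs_cases (y u) with h | h <;> rw [h.1]
    · linarith [Real.exp_pos (x u - y u)]
    · rw [← sub_eq_add_neg]
      linarith [Real.exp_pos (x u + y u)]
  have h3 := Real.exp_le_exp.2 (le_max_left (LSE fun u => x u + y u) (LSE fun u => x u - y u))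
  have h4 := Real.exp_le_exp.2 (le_max_right (LSE fun u => x u + y u) (LSE fun u => x u - y u))
  linarith

lemma three_replica_le {p : U → ℝ} (hp : ∀ u, 0 ≤ p u) (hs : ∑ u, p u = 1) {W : U → U → ℝ}
    (hW : ∀ u v, W u v = W v u) {η : ℝ}
    (hη : ∀ u v t, 2 * (W u v * W v t + W v t * W u t + W u t * W u v)
      - W u v ^ 2 - W v t ^ 2 - W u t ^ 2 ≤ 4 * η) :
    2 * ∑ u, p u * (∑ v, p v * W u v) ^ 2 - ∑ u, ∑ v, p u * p v * W u v ^ 2 ≤ 4 / 3 * η := by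
  set T := ∑ u, p u * (∑ v, p v * W u v) ^ 2 with hT
  set Q := ∑ u, ∑ v, p u * p v * W u v ^ 2 with hQ
  have t1 : ∑ u, ∑ v, ∑ t, p u * p v * p t * (W u t * W u v) = T := by
    refine Finset.sum_congr rfl fun u _ => ?_
    rw [sq, Finset.sum_mul_sum, Finset.mul_sum]
    refine Finset.sum_congr rfl fun v _ => ?_
    rw [Finset.mul_sum]
    exact Finset.sum_congr rfl fun t _ => by ring
  have t2 : ∑ u, ∑ v, ∑ t, p u * p v * p t * (W u v * W v t) = T := by
    rw [← t1, Finset.sum_comm]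
    refine Finset.sum_congr rfl fun v _ => Finset.sum_congr rfl fun u _ =>
      Finset.sum_congr rfl fun t _ => ?_
    rw [hW u v]
    ring
  have t3 : ∑ u, ∑ v, ∑ t, p u * p v * p t * (W v t * W u t) = T := by
    rw [← t2]
    refine Finset.sum_congr rfl fun u _ => ?_
    rw [Finset.sum_comm]
    refine Finset.sum_congr rfl fun v _ => Finset.sum_congr rfl fun t _ => ?_
    rw [hW t v]
    ring
  have q1 : ∑ u, ∑ v, ∑ t, p u * p v * p t * W u v ^ 2 = Q := by
    refine Finset.sum_congr rfl fun u _ => Finset.sum_congr rfl fun v _ => ?_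
    rw [← Finset.sum_mul, ← Finset.mul_sum, hs, mul_one]
  have q2 : ∑ u, ∑ v, ∑ t, p u * p v * p t * W u t ^ 2 = Q := by
    rw [← q1]
    refine Finset.sum_congr rfl fun u _ => ?_
    rw [Finset.sum_comm]
    refine Finset.sum_congr rfl fun v _ => Finset.sum_congr rfl fun t _ => ?_
    ring
  have q3 : ∑ u, ∑ v, ∑ t, p u * p v * p t * W v t ^ 2 = Q := by
    rw [← q2, Finset.sum_comm]
    refine Finset.sum_congr rfl fun v _ => Finset.sum_congr rfl fun u _ =>
      Finset.sum_congr rfl fun t _ => ?_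
    ring
  have o1 : ∑ u, ∑ v, ∑ t, p u * p v * p t * (4 * η) = 4 * η := by
    simp_rw [← Finset.sum_mul, ← Finset.mul_sum, hs, mul_one, ← Finset.mul_sum, hs, mul_one, hs]
    ring
  have key : ∑ u, ∑ v, ∑ t, p u * p v * p t * (2 * (W u v * W v t + W v t * W u t + W u t * W u v)
      - W u v ^ 2 - W v t ^ 2 - W u t ^ 2) ≤ ∑ u, ∑ v, ∑ t, p u * p v * p t * (4 * η) :=
    Finset.sum_le_sum fun u _ => Finset.sum_le_sum fun v _ => Finset.sum_le_sum fun t _ =>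
      mul_le_mul_of_nonneg_left (hη u v t) (mul_nonneg (mul_nonneg (hp u) (hp v)) (hp t))
  have e : ∀ u v t, p u * p v * p t * (2 * (W u v * W v t + W v t * W u t + W u t * W u v)
      - W u v ^ 2 - W v t ^ 2 - W u t ^ 2)
      = 2 * (p u * p v * p t * (W u v * W v t)) + 2 * (p u * p v * p t * (W v t * W u t))
        + 2 * (p u * p v * p t * (W u t * W u v)) - p u * p v * p t * W u v ^ 2
        - p u * p v * p t * W v t ^ 2 - p u * p v * p t * W u t ^ 2 := fun u v t => by ring
  simp_rw [e, Finset.sum_sub_distrib, Finset.sum_add_distrib, ← Finset.mul_sum, t1, t2, t3, q1, q2,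
    q3, o1] at key
  linarith

variable {E : Type*} [NormedAddCommGroup E] [InnerProductSpace ℝ E] [FiniteDimensional ℝ E]
  [MeasurableSpace E] [BorelSpace E]

/-- The perturbation features. -/
def pert (a : ℝ) (e m : U → E) (z : ℝ) (u : U) : E := a • e u + z • m u

lemma field_pert (w : U → ℝ) (a : ℝ) (e m : U → E) (z δ : ℝ) (g : E) (u : U) :
    field w (pert a e m (z + δ)) g u = field w (pert a e m z) g u + δ * ⟪m u, g⟫ := by
  simp only [field, pert, inner_add_left, real_inner_smul_left]
  ring

lemma integrable_gibbs_abs (w : U → ℝ) (V m : U → E) (c : ℝ) :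
    Integrable (fun g => ∑ u, gibbs (field w V g) u * |⟪m u, g⟫ - c|) (stdGaussian E) :=
  integrable_finsetSum _ fun u _ => integrable_gibbs_mul w V u
    ((integrable_inner_stdGaussian (m u)).sub (integrable_const c)).abs

/-- Mean absolute deviation of the conjugate variable, bounded by the fluctuations of the free
energy and its second difference. -/
lemma integral_gibbs_abs_le (w : U → ℝ) {a : ℝ} (ha : 0 ≤ a) (e m : U → E) (he : ∀ u, ‖e u‖ = 1)
    (hm : ∀ u, ‖m u‖ = 1) {z δ : ℝ} (hδ : 0 < δ) (hz : 0 ≤ z - δ) :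
    δ * ∫ g, ∑ u, gibbs (field w (pert a e m z) g) u *
        |⟪m u, g⟫ - (freeE w (pert a e m (z + δ)) - freeE w (pert a e m z)) / δ| ∂(stdGaussian E)
      ≤ Real.log 2 + 8 * (a + (z + δ))
        + (freeE w (pert a e m (z + δ)) - freeE w (pert a e m z)
          - (freeE w (pert a e m z) - freeE w (pert a e m (z - δ)))) := by
  set φ : ℝ → E → ℝ := fun z g => LSE (field w (pert a e m z) g) with hφ
  set ψ : ℝ → ℝ := fun z => freeE w (pert a e m z) with hψ
  have hφi : ∀ z, Integrable (φ z) (stdGaussian E) := fun z => integrable_LSE_field w _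
  have hψφ : ∀ z, ∫ g, φ z g ∂(stdGaussian E) = ψ z := fun z => rfl
  have hconv : ψ z - ψ (z - δ) ≤ ψ (z + δ) - ψ z := by
    have : ∀ g, φ z g - φ (z - δ) g ≤ φ (z + δ) g - φ z g := by
      intro g
      have h1 := sum_gibbs_mul_le_LSE_sub (field w (pert a e m z) g) (fun u => δ * ⟪m u, g⟫)
      have h2 := sum_gibbs_mul_le_LSE_sub (field w (pert a e m z) g) (fun u => -δ * ⟪m u, g⟫)
      simp only [← field_pert, ← sub_eq_add_neg] at h1 h2
      have h3 : ∑ u, gibbs (field w (pert a e m z) g) u * (-δ * ⟪m u, g⟫)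
          = -∑ u, gibbs (field w (pert a e m z) g) u * (δ * ⟪m u, g⟫) := by
        rw [← Finset.sum_neg_distrib]
        exact Finset.sum_congr rfl fun u _ => by ring
      rw [h3] at h2
      simp only [hφ]
      linarith
    have h1 := integral_mono ((hφi z).sub (hφi (z - δ))) ((hφi (z + δ)).sub (hφi z)) this
    simp only [Pi.sub_apply] at h1
    rwa [integral_sub (hφi _) (hφi _), integral_sub (hφi _) (hφi _)] at h1
  have hfl : ∀ z', 0 ≤ z' → z' ≤ z + δ → ∫ g, |φ z' g - ψ z'| ∂(stdGaussian E)
      ≤ 2 * (a + (z + δ)) := by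
    intro z' h0 h1
    refine integral_abs_LSE_sub_freeE_le w _ fun u => ?_
    refine (norm_add_le _ _).trans ?_
    rw [norm_smul, norm_smul, he, hm, Real.norm_of_nonneg ha, Real.norm_of_nonneg h0]
    linarith
  set c := (ψ (z + δ) - ψ z) / δ with hc
  have hcδ : δ * c = ψ (z + δ) - ψ z := by rw [hc]; field_simp
  have hai : ∀ z', Integrable (fun g => |φ z' g - ψ z'|) (stdGaussian E) := fun z' =>
    ((hφi z').sub (integrable_const _)).abs
  have hpt : ∀ g, δ * ∑ u, gibbs (field w (pert a e m z) g) u * |⟪m u, g⟫ - c|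
      ≤ Real.log 2 + (|φ (z + δ) g - ψ (z + δ)| + 2 * |φ z g - ψ z| + |φ (z - δ) g - ψ (z - δ)|)
        + (ψ (z + δ) - ψ z - (ψ z - ψ (z - δ))) := by
    intro g
    have h1 := sum_gibbs_mul_le_LSE_sub (field w (pert a e m z) g)
      (fun u => |δ * (⟪m u, g⟫ - c)|)
    have h2 := LSE_add_abs_le (field w (pert a e m z) g) (fun u => δ * (⟪m u, g⟫ - c))
    have e1 : LSE (fun u => field w (pert a e m z) g u + δ * (⟪m u, g⟫ - c))
        = φ (z + δ) g - δ * c := by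
      rw [hφ, sub_eq_add_neg, ← LSE_add_const]
      congr 1
      ext u
      rw [field_pert]
      ring
    have e2 : LSE (fun u => field w (pert a e m z) g u - δ * (⟪m u, g⟫ - c))
        = φ (z - δ) g + δ * c := by
      rw [hφ, ← LSE_add_const]
      congr 1
      ext u
      rw [sub_eq_add_neg z, field_pert]
      ring
    rw [e1, e2] at h2
    have e3 : δ * ∑ u, gibbs (field w (pert a e m z) g) u * |⟪m u, g⟫ - c|
        = ∑ u, gibbs (field w (pert a e m z) g) u * |δ * (⟪m u, g⟫ - c)| := by
      rw [Finset.mul_sum]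
      refine Finset.sum_congr rfl fun u _ => ?_
      rw [abs_mul, abs_of_pos hδ]
      ring
    rw [e3]
    have h3 : max (φ (z + δ) g - δ * c) (φ (z - δ) g + δ * c)
        ≤ φ z g + (|φ (z + δ) g - ψ (z + δ)| + 2 * |φ z g - ψ z| + |φ (z - δ) g - ψ (z - δ)|)
          + (ψ (z + δ) - ψ z - (ψ z - ψ (z - δ))) := by
      have b1 := le_abs_self (φ (z + δ) g - ψ (z + δ))
      have b2 := neg_abs_le (φ z g - ψ z)
      have b3 := le_abs_self (φ (z - δ) g - ψ (z - δ))
      have b4 := abs_nonneg (φ (z + δ) g - ψ (z + δ))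
      have b5 := abs_nonneg (φ z g - ψ z)
      have b6 := abs_nonneg (φ (z - δ) g - ψ (z - δ))
      rw [hcδ]
      refine max_le ?_ ?_ <;> linarith
    have h4 : LSE (field w (pert a e m z) g) = φ z g := rfl
    rw [h4] at h1
    linarith
  rw [← integral_const_mul]
  have hi2 := hai (z + δ)
  have hi3 := (hai z).const_mul 2
  have hi4 := hai (z - δ)
  refine (integral_mono ((integrable_gibbs_abs w _ m c).const_mul δ)
    (((integrable_const (Real.log 2)).add ((hi2.add hi3).add hi4)).add (integrable_const _))
    hpt).trans ?_
  rw [integral_add' ((integrable_const _).add ((hi2.add hi3).add hi4)) (integrable_const _),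
    integral_add' (integrable_const _) ((hi2.add hi3).add hi4), integral_add' (hi2.add hi3) hi4,
    integral_add' hi2 hi3, integral_const_mul]
  simp only [integral_const, probReal_univ, one_smul]
  have f1 := hfl (z + δ) (by linarith) le_rfl
  have f2 := hfl z (by linarith) (by linarith)
  have f3 := hfl (z - δ) hz (by linarith)
  linarith

end Positivity

section PositivityAverage

variable {U : Type*} [Fintype U] [Nonempty U]
variable {E : Type*} [NormedAddCommGroup E] [InnerProductSpace ℝ E] [FiniteDimensional ℝ E]
  [MeasurableSpace E] [BorelSpace E]

/-- Features `e`, `m` of points and of their antipodes, with kernels `p` and `W`. -/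
structure PertSystem (e m : U → E) (p W : U → U → ℝ) : Prop where
  norm_e : ∀ u, ‖e u‖ = 1
  inner_m : ∀ u v, ⟪m u, m v⟫ = p u v
  inner_em : ∀ u v, ⟪e u, m v⟫ = W u v
  symm : ∀ u v, W u v = W v u
  W_nonneg : ∀ u v, 0 ≤ W u v
  W_le : ∀ u v, W u v ≤ 1
  p_nonneg : ∀ u v, 0 ≤ p u v
  p_le : ∀ u v, p u v ≤ 1
  p_self : ∀ u, p u u = 1
  W_self : ∀ u, W u u = 0

lemma PertSystem.norm_m {e m : U → E} {p W : U → U → ℝ} (h : PertSystem e m p W) (u : U) :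
    ‖m u‖ = 1 := by
  have h1 : ‖m u‖ ^ 2 = 1 := by rw [← real_inner_self_eq_norm_sq, h.inner_m, h.p_self]
  nlinarith [norm_nonneg (m u)]

lemma PertSystem.inner_pert {e m : U → E} {p W : U → U → ℝ} (h : PertSystem e m p W) (a z : ℝ)
    (t u : U) : ⟪pert a e m z t, m u⟫ = a * W t u + z * p t u := by
  rw [pert, inner_add_left, real_inner_smul_left, real_inner_smul_left, h.inner_m, h.inner_em]

lemma sum_gibbs_mem {x f : U → ℝ} {lo hi : ℝ} (h0 : ∀ u, lo ≤ f u) (h1 : ∀ u, f u ≤ hi) :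
    lo ≤ ∑ u, gibbs x u * f u ∧ ∑ u, gibbs x u * f u ≤ hi := by
  constructor
  · calc lo = ∑ u, gibbs x u * lo := by rw [← Finset.sum_mul, sum_gibbs, one_mul]
      _ ≤ _ := Finset.sum_le_sum fun u _ => mul_le_mul_of_nonneg_left (h0 u) (gibbs_pos _ _).le
  · calc _ ≤ ∑ u, gibbs x u * hi :=
        Finset.sum_le_sum fun u _ => mul_le_mul_of_nonneg_left (h1 u) (gibbs_pos _ _).le
      _ = hi := by rw [← Finset.sum_mul, sum_gibbs, one_mul]

lemma avg2_mem (w : U → ℝ) (z : U → E) {f : U → U → ℝ} {lo hi : ℝ} (h0 : ∀ u v, lo ≤ f u v)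
    (h1 : ∀ u v, f u v ≤ hi) : lo ≤ avg2 w z f ∧ avg2 w z f ≤ hi := by
  have hc : ∀ b : ℝ, avg2 w z (fun _ _ => b) = b := by
    intro b
    unfold avg2
    simp_rw [← Finset.sum_mul, ← Finset.mul_sum, sum_gibbs, mul_one, sum_gibbs]
    simp
  constructor
  · rw [← hc lo]
    exact avg2_mono w z h0
  · rw [← hc hi]
    exact avg2_mono w z h1

lemma integrable_gibbs_sq_avg (w : U → ℝ) (V : U → E) {W : U → U → ℝ} :
    Integrable (fun g => ∑ u, gibbs (field w V g) u * (∑ v, gibbs (field w V g) v * W u v) ^ 2)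
      (stdGaussian E) := by
  refine integrable_finsetSum _ fun u _ => integrable_gibbs_mul w V u ?_
  set B := ∑ v, |W u v| with hB
  have hb : ∀ v, |W u v| ≤ B := fun v => Finset.single_le_sum (f := fun v => |W u v|)
    (fun v _ => abs_nonneg _) (Finset.mem_univ v)
  have := continuous_gibbs_field w V
  refine Integrable.of_bound (by fun_prop : Continuous _).aestronglyMeasurable (B ^ 2)
    (ae_of_all _ fun g => ?_)
  rw [Real.norm_eq_abs, abs_pow]
  exact pow_le_pow_left₀ (abs_nonneg _) (abs_gibbs_sum_le _ _ _ hb) 2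

lemma PertSystem.integral_gibbs_inner_m {e m : U → E} {p W : U → U → ℝ}
    (h : PertSystem e m p W) (w : U → ℝ) (a z : ℝ) :
    ∫ g, ∑ u, gibbs (field w (pert a e m z) g) u * ⟪m u, g⟫ ∂(stdGaussian E)
      = z - a * avg2 w (pert a e m z) W - z * avg2 w (pert a e m z) p := by
  rw [gibbs_stein_avg]
  have e1 : avg1 w (pert a e m z) (fun u => ⟪pert a e m z u, m u⟫) = z := by
    simp only [h.inner_pert, h.W_self, h.p_self, mul_zero, zero_add, mul_one]
    exact avg1_const _ _ _
  have e2 : avg2 w (pert a e m z) (fun u v => ⟪m u, pert a e m z v⟫)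
      = a * avg2 w (pert a e m z) W + z * avg2 w (pert a e m z) p := by
    rw [← avg2_const_mul, ← avg2_const_mul, ← avg2_add]
    congr 1
    ext u v
    rw [real_inner_comm, h.inner_pert, h.symm v u, ← h.inner_m v u, real_inner_comm, h.inner_m]
  rw [e1, e2]
  ring

/-- Consequence of Gaussian integration by parts (Ghirlanda–Guerra type inequality). -/
lemma PertSystem.overlap_le {e m : U → E} {p W : U → U → ℝ} (h : PertSystem e m p W) (w : U → ℝ)
    {a z : ℝ} (hz : 0 ≤ z) (c : ℝ) :
    a * (avg2 w (pert a e m z) W ^ 2 + avg2 w (pert a e m z) (fun u v => W u v ^ 2)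
      - 2 * ∫ g, ∑ u, gibbs (field w (pert a e m z) g) u *
          (∑ v, gibbs (field w (pert a e m z) g) v * W u v) ^ 2 ∂(stdGaussian E))
    ≤ 2 * ∫ g, ∑ u, gibbs (field w (pert a e m z) g) u * |⟪m u, g⟫ - c| ∂(stdGaussian E)
      + 3 * z := by
  set V := pert a e m z with hV
  set D := ∫ g, ∑ u, gibbs (field w V g) u * |⟪m u, g⟫ - c| ∂(stdGaussian E) with hD
  set T := ∫ g, ∑ u, gibbs (field w V g) u * (∑ v, gibbs (field w V g) v * W u v) ^ 2
    ∂(stdGaussian E) with hT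
  have hEW := avg2_mem w V h.W_nonneg h.W_le
  have hDi := integrable_gibbs_abs w V m c
  have hI0 : ∫ g, ∑ u, gibbs (field w V g) u * ⟪m u, g⟫ ∂(stdGaussian E)
      ≤ z - a * avg2 w V W := by
    rw [hV, h.integral_gibbs_inner_m]
    have := (avg2_mem w V h.p_nonneg h.p_le).1
    nlinarith
  have hI0i : Integrable (fun g => ∑ u, gibbs (field w V g) u * ⟪m u, g⟫) (stdGaussian E) :=
    integrable_finsetSum _ fun u _ => integrable_gibbs_mul w V u (integrable_inner_stdGaussian _)
  have hc : c ≤ z - a * avg2 w V W + D := by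
    have h1 : ∀ g, c ≤ ∑ u, gibbs (field w V g) u * ⟪m u, g⟫
        + ∑ u, gibbs (field w V g) u * |⟪m u, g⟫ - c| := by
      intro g
      rw [← Finset.sum_add_distrib]
      calc c = ∑ u, gibbs (field w V g) u * c := by rw [← Finset.sum_mul, sum_gibbs, one_mul]
        _ ≤ _ := by
          refine Finset.sum_le_sum fun u _ => ?_
          rw [← mul_add]
          refine mul_le_mul_of_nonneg_left ?_ (gibbs_pos _ _).le
          linarith [neg_abs_le (⟪m u, g⟫ - c)]
    have h2 := integral_mono (integrable_const c) (hI0i.add hDi) h1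
    rw [integral_add' hI0i hDi] at h2
    simp only [integral_const, probReal_univ, one_smul] at h2
    linarith
  have hI1i : ∀ u v, Integrable (fun g => ⟪m u, g⟫ * (gibbs (field w V g) u
      * gibbs (field w V g) v)) (stdGaussian E) := by
    intro u v
    have := integrable_gibbs_mul w V u (integrable_gibbs_mul w V v
      (integrable_inner_stdGaussian (m u)))
    exact this.congr (ae_of_all _ fun g => by simp only; ring)
  set I1 := ∫ g, ∑ u, ∑ v, W u v * (⟪m u, g⟫ * (gibbs (field w V g) u * gibbs (field w V g) v))
    ∂(stdGaussian E) with hI1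
  have hI1i' : Integrable (fun g => ∑ u, ∑ v, W u v * (⟪m u, g⟫ * (gibbs (field w V g) u
      * gibbs (field w V g) v))) (stdGaussian E) :=
    integrable_finsetSum _ fun u _ => integrable_finsetSum _ fun v _ => (hI1i u v).const_mul _
  have hup : I1 ≤ c * avg2 w V W + D := by
    rw [avg2, ← integral_const_mul, ← integral_add ((integrable_avg2 w V W).const_mul c) hDi]
    refine integral_mono hI1i' (((integrable_avg2 w V W).const_mul c).add hDi) fun g => ?_
    simp only []
    rw [Finset.mul_sum, ← Finset.sum_add_distrib]
    refine Finset.sum_le_sum fun u _ => ?_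
    have h1 := sum_gibbs_mem (x := field w V g) (h.W_nonneg u) (h.W_le u)
    have e1 : ∑ v, W u v * (⟪m u, g⟫ * (gibbs (field w V g) u * gibbs (field w V g) v))
        = gibbs (field w V g) u * ⟪m u, g⟫ * ∑ v, gibbs (field w V g) v * W u v := by
      rw [Finset.mul_sum]
      exact Finset.sum_congr rfl fun v _ => by ring
    have e2 : c * ∑ v, gibbs (field w V g) u * gibbs (field w V g) v * W u v
        = gibbs (field w V g) u * c * ∑ v, gibbs (field w V g) v * W u v := by
      rw [Finset.mul_sum, Finset.mul_sum]
      exact Finset.sum_congr rfl fun v _ => by ring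
    rw [e1, e2]
    have h2 : (⟪m u, g⟫ - c) * ∑ v, gibbs (field w V g) v * W u v ≤ |⟪m u, g⟫ - c| := by
      calc _ ≤ |⟪m u, g⟫ - c| * ∑ v, gibbs (field w V g) v * W u v :=
            mul_le_mul_of_nonneg_right (le_abs_self _) h1.1
        _ ≤ _ := mul_le_of_le_one_right (abs_nonneg _) h1.2
    have h3 := mul_le_mul_of_nonneg_left h2 (gibbs_pos (field w V g) u).le
    linarith
  have hlow : a * (avg2 w V (fun u v => W u v ^ 2) - 2 * T) - 2 * z ≤ I1 := by
    have hi : ∀ u v, Integrable (fun g => gibbs (field w V g) u * gibbs (field w V g) v *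
      (⟪V u, m u⟫ + ⟪V v, m u⟫ - 2 * ∑ u', gibbs (field w V g) u' * ⟪V u', m u⟫))
      (stdGaussian E) := by
      intro u v
      simp_rw [mul_assoc]
      refine integrable_gibbs_mul w V u (integrable_gibbs_mul w V v
        ((integrable_const _).sub (Integrable.const_mul ?_ 2)))
      exact integrable_avg1 w V fun u' => ⟪V u', m u⟫
    have hst : I1 = ∫ g, ∑ u, ∑ v, W u v * (gibbs (field w V g) u * gibbs (field w V g) v *
        (⟪V u, m u⟫ + ⟪V v, m u⟫ - 2 * ∑ u', gibbs (field w V g) u' * ⟪V u', m u⟫))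
        ∂(stdGaussian E) := by
      rw [hI1, integral_finsetSum _ fun u _ => integrable_finsetSum _ fun v _ =>
        (hI1i u v).const_mul _, integral_finsetSum _ fun u _ => integrable_finsetSum _ fun v _ =>
        (hi u v).const_mul _]
      refine Finset.sum_congr rfl fun u _ => ?_
      rw [integral_finsetSum _ fun v _ => (hI1i u v).const_mul _,
        integral_finsetSum _ fun v _ => (hi u v).const_mul _]
      refine Finset.sum_congr rfl fun v _ => ?_
      rw [integral_const_mul, integral_const_mul, gibbs_stein_two]
    have hQi := integrable_avg2 w V (fun u v => W u v ^ 2)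
    have hTi := integrable_gibbs_sq_avg w V (W := W)
    have hL : a * (avg2 w V (fun u v => W u v ^ 2) - 2 * T) - 2 * z
        = ∫ g, (a * (∑ u, ∑ v, gibbs (field w V g) u * gibbs (field w V g) v * W u v ^ 2
          - 2 * ∑ u, gibbs (field w V g) u * (∑ v, gibbs (field w V g) v * W u v) ^ 2) - 2 * z)
          ∂(stdGaussian E) := by
      refine Eq.symm ((integral_sub ((hQi.sub (hTi.const_mul 2)).const_mul a)
        (integrable_const _)).trans ?_)
      rw [integral_const_mul, integral_sub' hQi (hTi.const_mul 2), integral_const_mul]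
      simp [avg2, hT]
    rw [hL]
    rw [hst]
    refine integral_mono (((hQi.sub (hTi.const_mul 2)).const_mul a).sub (integrable_const _))
      (integrable_finsetSum _ fun u _ => integrable_finsetSum _ fun v _ => (hi u v).const_mul _)
      fun g => ?_
    set q := gibbs (field w V g) with hq
    have hq0 : ∀ u, 0 ≤ q u := fun u => (gibbs_pos _ u).le
    have hq1 : ∑ u, q u = 1 := sum_gibbs _
    simp only
    have e1 : ∀ u, ∑ u', q u' * ⟪V u', m u⟫ = a * ∑ t, q t * W u t + z * ∑ t, q t * p t u := by
      intro u
      rw [Finset.mul_sum, Finset.mul_sum, ← Finset.sum_add_distrib]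
      refine Finset.sum_congr rfl fun t _ => ?_
      rw [hV, h.inner_pert, h.symm t u]
      ring
    have e2 : ∑ u, ∑ v, q u * q v * (a * W u v ^ 2 - 2 * a * W u v * ∑ t, q t * W u t - 2 * z)
        = a * (∑ u, ∑ v, q u * q v * W u v ^ 2
          - 2 * ∑ u, q u * (∑ v, q v * W u v) ^ 2) - 2 * z := by
      have s1 : ∀ u, ∑ v, q u * q v * (a * W u v ^ 2 - 2 * a * W u v * ∑ t, q t * W u t - 2 * z)
          = a * ∑ v, q u * q v * W u v ^ 2 - 2 * a * (q u * (∑ v, q v * W u v) ^ 2)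
            - 2 * z * q u * ∑ v, q v := by
        intro u
        obtain ⟨S, hS⟩ : ∃ S, S = ∑ v, q v * W u v := ⟨_, rfl⟩
        have s2 : 2 * a * (q u * S ^ 2) = ∑ v, 2 * a * q u * S * (q v * W u v) := by
          rw [← Finset.mul_sum, ← hS]
          ring
        rw [← hS, s2, Finset.mul_sum, Finset.mul_sum, ← Finset.sum_sub_distrib,
          ← Finset.sum_sub_distrib]
        exact Finset.sum_congr rfl fun v _ => by ring
      simp_rw [s1, hq1, Finset.sum_sub_distrib, mul_one, ← Finset.mul_sum, hq1]
      ring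
    rw [← e2]
    refine Finset.sum_le_sum fun u _ => Finset.sum_le_sum fun v _ => ?_
    rw [e1, hV, h.inner_pert, h.inner_pert, h.W_self, h.p_self, h.symm v u]
    have hS := sum_gibbs_mem (x := field w V g) (fun t => h.p_nonneg t u) (fun t => h.p_le t u)
    rw [← hq] at hS
    have hw0 := h.W_nonneg u v
    have hw1 := h.W_le u v
    have hp0 := h.p_nonneg v u
    have hz2 : -(2 * z) ≤ W u v * (z * (1 + p v u - 2 * ∑ t, q t * p t u)) := by
      have b1 : -(2 * z) ≤ z * (1 + p v u - 2 * ∑ t, q t * p t u) := by nlinarith [hS.2]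
      nlinarith
    have := mul_le_mul_of_nonneg_left hz2 (mul_nonneg (hq0 u) (hq0 v))
    linear_combination this
  have : c * avg2 w V W ≤ (z - a * avg2 w V W + D) * avg2 w V W :=
    mul_le_mul_of_nonneg_right hc hEW.1
  have hD0 : 0 ≤ D := integral_nonneg fun g => Finset.sum_nonneg fun u _ =>
    mul_nonneg (gibbs_pos _ _).le (abs_nonneg _)
  have : (z + D) * avg2 w V W ≤ z + D := mul_le_of_le_one_right (by linarith) hEW.2
  nlinarith

lemma PertSystem.freeE_diff_le {e m : U → E} {p W : U → U → ℝ} (h : PertSystem e m p W)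
    (w : U → ℝ) {a z δ : ℝ} (ha : 0 ≤ a) (hz : 0 ≤ z) (hδ : 0 ≤ δ) :
    freeE w (pert a e m (z + δ)) - freeE w (pert a e m z) ≤ δ * (z + δ) ∧
      -(δ * a) ≤ freeE w (pert a e m (0 + δ)) - freeE w (pert a e m 0) := by
  have hJ : ∀ z' δ' : ℝ, δ' * (z' - a * avg2 w (pert a e m z') W - z' * avg2 w (pert a e m z') p)
      ≤ freeE w (pert a e m (z' + δ')) - freeE w (pert a e m z') := by
    intro z' δ'
    rw [← h.integral_gibbs_inner_m, ← integral_const_mul, freeE, freeE,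
      ← integral_sub (integrable_LSE_field _ _) (integrable_LSE_field _ _)]
    refine integral_mono (Integrable.const_mul (integrable_finsetSum _ fun u _ =>
      integrable_gibbs_mul w _ u (integrable_inner_stdGaussian _)) _)
      ((integrable_LSE_field _ _).sub (integrable_LSE_field _ _)) fun g => ?_
    have h1 := sum_gibbs_mul_le_LSE_sub (field w (pert a e m z') g) (fun u => δ' * ⟪m u, g⟫)
    simp only [← field_pert] at h1
    refine le_trans (le_of_eq ?_) h1
    rw [Finset.mul_sum]
    exact Finset.sum_congr rfl fun u _ => by ring
  constructor
  · have h1 := hJ (z + δ) (-δ)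
    rw [add_neg_cancel_right] at h1
    have h2 := (avg2_mem w (pert a e m (z + δ)) h.W_nonneg h.W_le).1
    have h3 := (avg2_mem w (pert a e m (z + δ)) h.p_nonneg h.p_le).1
    nlinarith [mul_nonneg ha h2, mul_nonneg (add_nonneg hz hδ) h3,
      mul_nonneg hδ (add_nonneg (mul_nonneg ha h2) (mul_nonneg (add_nonneg hz hδ) h3))]
  · have h1 := hJ 0 δ
    have h2 := (avg2_mem w (pert a e m 0) h.W_nonneg h.W_le).2
    nlinarith [mul_nonneg hδ ha]

/-- Antipodal overlaps are rare on average over the perturbation strengths. -/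
lemma PertSystem.sum_avg2_le {e m : U → E} {p W : U → U → ℝ} (h : PertSystem e m p W)
    (w : U → ℝ) (k : ℕ)
    (hη : ∀ u v t, 2 * (W u v * W v t + W v t * W u t + W u t * W u v)
      - W u v ^ 2 - W v t ^ 2 - W u t ^ 2 ≤ 4 * (9 / 16) ^ k) :
    ∑ i ∈ Finset.range (2 ^ k), avg2 w (pert (8 ^ k) e m ((i + 1 : ℕ) * 2 ^ k)) W
      ≤ 2 ^ k * (8 * (3 / 4) ^ k) := by
  obtain ⟨x, hx⟩ : ∃ x : ℝ, x = 2 ^ k := ⟨_, rfl⟩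
  have hx1 : 1 ≤ x := hx ▸ one_le_pow₀ (by norm_num)
  have h8 : (8 : ℝ) ^ k = x ^ 3 := by rw [hx, ← pow_mul, mul_comm, pow_mul]; norm_num
  have hx3 : 0 ≤ x ^ 3 := by positivity
  have hx23 : x ^ 2 ≤ x ^ 3 := pow_le_pow_right₀ hx1 (by norm_num)
  have hcard : ((2 ^ k : ℕ) : ℝ) = x := by rw [hx]; push_cast; rfl
  obtain ⟨n, hn⟩ : ∃ n : ℕ, n = 2 ^ k := ⟨_, rfl⟩
  rw [← hn] at hcard
  rw [← hn, h8, ← hx]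
  obtain ⟨ψ, hψ⟩ : ∃ ψ : ℕ → ℝ, ψ = fun i : ℕ => freeE w (pert (x ^ 3) e m (i * x)) := ⟨_, rfl⟩
  obtain ⟨D, hD⟩ : ∃ D : ℕ → ℝ, D = fun i : ℕ => ∫ g, ∑ u,
    gibbs (field w (pert (x ^ 3) e m ((i + 1 : ℕ) * x)) g) u *
        |⟪m u, g⟫ - (ψ (i + 2) - ψ (i + 1)) / x| ∂(stdGaussian E) := ⟨_, rfl⟩
  obtain ⟨A, hA⟩ : ∃ A : ℕ → ℝ, A = fun i : ℕ => avg2 w (pert (x ^ 3) e m ((i + 1 : ℕ) * x)) W :=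
    ⟨_, rfl⟩
  have hilt : ∀ i ∈ Finset.range n, ((i + 1 : ℕ) : ℝ) ≤ x := by
    intro i hi
    rw [← hcard]
    exact_mod_cast Finset.mem_range.1 hi
  have hD1 : ∀ i ∈ Finset.range n, x * D i ≤ 1 + 24 * x ^ 3
      + ((ψ (i + 2) - ψ (i + 1)) - (ψ (i + 1) - ψ i)) := by
    intro i hi
    have hi' := hilt i hi
    have h1 := integral_gibbs_abs_le w hx3 e m h.norm_e h.norm_m (z := (i + 1 : ℕ) * x) (δ := x)
      (by linarith) (by push_cast; nlinarith [(Nat.cast_nonneg i : (0 : ℝ) ≤ i)])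
    have e1 : ((i + 1 : ℕ) : ℝ) * x + x = ((i + 2 : ℕ) : ℝ) * x := by push_cast; ring
    have e2 : ((i + 1 : ℕ) : ℝ) * x - x = (i : ℝ) * x := by push_cast; ring
    rw [e1, e2] at h1
    have h2 : ((i + 2 : ℕ) : ℝ) * x ≤ 2 * x ^ 3 := by
      push_cast at hi' ⊢
      nlinarith
    have h3 := Real.log_two_lt_d9
    simp only [hD, hψ]
    linarith
  have hDsum : ∑ i ∈ Finset.range n, D i ≤ 28 * x ^ 3 := by
    have h1 := Finset.sum_le_sum hD1
    rw [Finset.sum_add_distrib, Finset.sum_range_sub (fun i => ψ (i + 1) - ψ i),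
      ← Finset.mul_sum] at h1
    simp only [Finset.sum_const, Finset.card_range, nsmul_eq_mul, hcard] at h1
    have h2 := (h.freeE_diff_le w hx3 (z := n * x) (δ := x) (by positivity) (by linarith)).1
    have h3 := (h.freeE_diff_le w hx3 (z := n * x) (δ := x) (by positivity) (by linarith)).2
    have e1 : (n : ℝ) * x + x = ((n + 1 : ℕ) : ℝ) * x := by push_cast; ring
    have e2 : (0 : ℝ) + x = ((0 + 1 : ℕ) : ℝ) * x := by push_cast; ring
    have e3 : (0 : ℝ) = ((0 : ℕ) : ℝ) * x := by simp
    have h2' : ψ (n + 1) - ψ n ≤ x * (n * x + x) := by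
      simp only [hψ]
      rwa [← e1]
    have h3' : -(x * x ^ 3) ≤ ψ (0 + 1) - ψ 0 := by
      simp only [hψ]
      rw [← e2, ← e3]
      exact h3
    rw [hcard] at h2'
    have h4 : x * ∑ i ∈ Finset.range n, D i ≤ x * (28 * x ^ 3) := by
      nlinarith
    exact le_of_mul_le_mul_left h4 (by linarith)
  have hAi : ∀ i ∈ Finset.range n, x ^ 3 * (A i ^ 2 - 4 / 3 * (9 / 16) ^ k)
      ≤ 2 * D i + 3 * x ^ 2 := by
    intro i hi
    have hi' := hilt i hi
    have h1 := h.overlap_le w (a := x ^ 3) (z := (i + 1 : ℕ) * x) (by positivity)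
      ((ψ (i + 2) - ψ (i + 1)) / x)
    have h2 : 2 * (∫ g, ∑ u, gibbs (field w (pert (x ^ 3) e m ((i + 1 : ℕ) * x)) g) u *
          (∑ v, gibbs (field w (pert (x ^ 3) e m ((i + 1 : ℕ) * x)) g) v * W u v) ^ 2
            ∂(stdGaussian E)) - avg2 w (pert (x ^ 3) e m ((i + 1 : ℕ) * x)) (fun u v => W u v ^ 2)
          ≤ 4 / 3 * (9 / 16) ^ k := by
      have hTi := integrable_gibbs_sq_avg w (pert (x ^ 3) e m ((i + 1 : ℕ) * x)) (W := W)
      have hQi := integrable_avg2 w (pert (x ^ 3) e m ((i + 1 : ℕ) * x)) (fun u v => W u v ^ 2)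
      rw [avg2, ← integral_const_mul, ← integral_sub (hTi.const_mul 2) hQi]
      refine (integral_mono ((hTi.const_mul 2).sub hQi) (integrable_const _) fun g =>
        three_replica_le (fun u => (gibbs_pos _ u).le) (sum_gibbs _) h.symm hη).trans ?_
      simp
    have h3 : ((i + 1 : ℕ) : ℝ) * x ≤ x ^ 2 := by nlinarith
    have h4 := mul_le_mul_of_nonneg_left h2 hx3
    simp only [hA, hD]
    linarith
  have hAsum : ∑ i ∈ Finset.range n, A i ^ 2 ≤ 61 * (x * (9 / 16) ^ k) := by
    have h1 := Finset.sum_le_sum hAi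
    rw [Finset.sum_add_distrib, ← Finset.mul_sum, ← Finset.mul_sum, Finset.sum_sub_distrib] at h1
    simp only [Finset.sum_const, Finset.card_range, nsmul_eq_mul, hcard] at h1
    have h2 : 1 ≤ x * (9 / 16) ^ k := by
      rw [hx, ← mul_pow]
      exact one_le_pow₀ (by norm_num)
    have h3 : x ^ 3 * ∑ i ∈ Finset.range n, A i ^ 2
        ≤ x ^ 3 * (59 + 4 / 3 * (x * (9 / 16) ^ k)) := by nlinarith
    have h4 := le_of_mul_le_mul_left h3 (by positivity)
    linarith
  have hcs := sq_sum_le_card_mul_sum_sq (s := Finset.range n) (f := A)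
  rw [Finset.card_range, hcard] at hcs
  have e : (9 / 16 : ℝ) ^ k = ((3 / 4) ^ k) ^ 2 := by rw [← pow_mul, mul_comm, pow_mul]; norm_num
  have hfin : (∑ i ∈ Finset.range n, A i) ^ 2 ≤ (x * (8 * (3 / 4) ^ k)) ^ 2 := by
    calc _ ≤ x * (61 * (x * (9 / 16) ^ k)) :=
          hcs.trans (mul_le_mul_of_nonneg_left hAsum (by linarith))
      _ ≤ _ := by
          rw [e]
          nlinarith [mul_nonneg (sq_nonneg x) (sq_nonneg (((3 : ℝ) / 4) ^ k))]
  have := abs_le_of_sq_le_sq hfin (by positivity)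
  rw [hA] at this
  exact (le_abs_self _).trans this

end PositivityAverage

section TensorPower

/-- The `k`-th tensor power of a vector, in coordinates. -/
def tpow {I : Type*} [Fintype I] (k : ℕ) (s : I → ℝ) : EuclideanSpace ℝ (Fin k → I) :=
  WithLp.toLp 2 fun j => ∏ i, s (j i)

lemma inner_tpow {I : Type*} [Fintype I] (k : ℕ) (s t : I → ℝ) :
    ⟪tpow k s, tpow k t⟫ = (∑ i, s i * t i) ^ k := by
  classical
  have h : (∑ i, s i * t i) ^ k = ∏ _l : Fin k, ∑ i, s i * t i := by simp
  rw [h, Finset.prod_univ_sum, Fintype.piFinset_univ]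
  simp only [tpow, PiLp.inner_apply, RCLike.inner_apply, conj_trivial, Finset.prod_mul_distrib]
  exact Finset.sum_congr rfl fun j _ => by ring

variable {N : ℕ}

/-- The overlap of two configurations. -/
def ovl (σ τ : Fin N → ℝ) : ℝ := dotp σ τ / N

lemma ovl_comm (σ τ : Fin N → ℝ) : ovl σ τ = ovl τ σ := by
  unfold ovl dotp
  congr 1
  exact Finset.sum_congr rfl fun i _ => by ring

lemma ovl_self (hN : 1 ≤ N) {σ : Fin N → ℝ} (hσ : σ ∈ sphereSet N) : ovl σ σ = 1 := by
  have h : ∑ i, (σ i) ^ 2 = (N : ℝ) := hσ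
  have hN' : (N : ℝ) ≠ 0 := by positivity
  unfold ovl dotp
  simp_rw [← pow_two]
  rw [h, div_self hN']

lemma abs_ovl_le (hN : 1 ≤ N) {σ τ : Fin N → ℝ} (hσ : σ ∈ sphereSet N) (hτ : τ ∈ sphereSet N) :
    |ovl σ τ| ≤ 1 := by
  have h : ∑ i, (σ i) ^ 2 = (N : ℝ) := hσ
  have h' : ∑ i, (τ i) ^ 2 = (N : ℝ) := hτ
  have hN' : (0 : ℝ) < N := by positivity
  have := Finset.sum_mul_sq_le_sq_mul_sq Finset.univ σ τ
  rw [h, h'] at this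
  unfold ovl dotp
  rw [abs_div, abs_of_pos hN', div_le_one hN']
  exact abs_le_of_sq_le_sq (by nlinarith) hN'.le

lemma ovl_triple (hN : 1 ≤ N) {σ τ ρ : Fin N → ℝ} (hσ : σ ∈ sphereSet N) (hτ : τ ∈ sphereSet N)
    (hρ : ρ ∈ sphereSet N) : -(3 / 2) ≤ ovl σ τ + ovl τ ρ + ovl σ ρ := by
  have h1 : ∑ i, (σ i) ^ 2 = (N : ℝ) := hσ
  have h2 : ∑ i, (τ i) ^ 2 = (N : ℝ) := hτ
  have h3 : ∑ i, (ρ i) ^ 2 = (N : ℝ) := hρ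
  have hN' : (0 : ℝ) < N := by positivity
  have h : 0 ≤ ∑ i, (σ i + τ i + ρ i) ^ 2 := Finset.sum_nonneg fun i _ => sq_nonneg _
  have e : ∑ i, (σ i + τ i + ρ i) ^ 2 = ∑ i, σ i ^ 2 + ∑ i, τ i ^ 2 + ∑ i, ρ i ^ 2
      + 2 * (dotp σ τ + dotp τ ρ + dotp σ ρ) := by
    unfold dotp
    simp only [← Finset.sum_add_distrib, Finset.mul_sum]
    exact Finset.sum_congr rfl fun i _ => by ring
  unfold ovl
  rw [← add_div, ← add_div, le_div_iff₀ hN']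
  rw [e, h1, h2, h3] at h
  linarith

/-- Embedding of a configuration as a unit vector in one more dimension. -/
def halfLift (σ : Fin N → ℝ) : Option (Fin N) → ℝ
  | none => 1 / √2
  | some i => σ i / √(2 * N)

lemma sum_halfLift (σ τ : Fin N → ℝ) :
    ∑ i, halfLift σ i * halfLift τ i = (1 + ovl σ τ) / 2 := by
  rw [Fintype.sum_option]
  have h : ∀ i, halfLift σ (some i) * halfLift τ (some i) = σ i * τ i / (2 * N) := by
    intro i
    simp only [halfLift]
    rw [div_mul_div_comm, Real.mul_self_sqrt (by positivity)]
  simp_rw [h, halfLift]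
  rw [← Finset.sum_div, div_mul_div_comm, Real.mul_self_sqrt (by norm_num)]
  unfold ovl dotp
  rw [mul_comm (2 : ℝ), ← div_div]
  ring

lemma ovl_neg_right (σ τ : Fin N → ℝ) : ovl σ (-τ) = -ovl σ τ := by
  simp [ovl, dotp, Finset.sum_neg_distrib, neg_div]

lemma three_pow_le {a b c : ℝ} (ha : 0 ≤ a) (hb : 0 ≤ b) (hc : 0 ≤ c) (h : a + b + c ≤ 9 / 4)
    (k : ℕ) :
    2 * (a ^ k * b ^ k + b ^ k * c ^ k + c ^ k * a ^ k) - (a ^ k) ^ 2 - (b ^ k) ^ 2 - (c ^ k) ^ 2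
      ≤ 4 * (9 / 16) ^ k := by
  have key : ∀ x y z : ℝ, 0 ≤ x → 0 ≤ y → 0 ≤ z → x + y + z ≤ 9 / 4 → y ≤ x → z ≤ x →
      y * z ≤ 9 / 16 := by
    intro x y z hx hy hz h h1 h2
    by_contra! hcon
    nlinarith [sq_nonneg (y - z), sq_nonneg (y + z - 3 / 2)]
  have main : ∀ x y z : ℝ, 0 ≤ x → 0 ≤ y → 0 ≤ z → x + y + z ≤ 9 / 4 → y ≤ x → z ≤ x →
      2 * (x ^ k * y ^ k + y ^ k * z ^ k + z ^ k * x ^ k) - (x ^ k) ^ 2 - (y ^ k) ^ 2 - (z ^ k) ^ 2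
      ≤ 4 * (9 / 16) ^ k := by
    intro x y z hx hy hz h h1 h2
    have h3 := pow_le_pow_left₀ (mul_nonneg hy hz) (key x y z hx hy hz h h1 h2) k
    rw [mul_pow] at h3
    nlinarith [sq_nonneg (x ^ k - y ^ k - z ^ k)]
  rcases le_total a b with hab | hab
  · rcases le_total b c with hbc | hbc
    · have := main c a b hc ha hb (by linarith) (hab.trans hbc) hbc
      linarith
    · have := main b a c hb ha hc (by linarith) hab hbc
      linarith
  · rcases le_total a c with hac | hac
    · have := main c a b hc ha hb (by linarith) hac (hab.trans hac)
      linarith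
    · have := main a b c ha hb hc (by linarith) hab hac
      linarith

variable {U : Type*} [Fintype U] [Nonempty U]

/-- First perturbation feature. -/
def featE (k : ℕ) (σ : U → Fin N → ℝ) (u : U) : EuclideanSpace ℝ (Fin k → Option (Fin N)) :=
  tpow k (halfLift (σ u))

/-- Second perturbation feature. -/
def featM (k : ℕ) (σ : U → Fin N → ℝ) (u : U) : EuclideanSpace ℝ (Fin k → Option (Fin N)) :=
  tpow k (halfLift (-σ u))

lemma pertSystem_feat (hN : 1 ≤ N) {k : ℕ} (hk : 1 ≤ k) {σ : U → Fin N → ℝ}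
    (hσ : ∀ u, σ u ∈ sphereSet N) :
    PertSystem (featE k σ) (featM k σ) (fun u v => ((1 + ovl (σ u) (σ v)) / 2) ^ k)
      (fun u v => ((1 - ovl (σ u) (σ v)) / 2) ^ k) := by
  have hb : ∀ u v, 0 ≤ (1 + ovl (σ u) (σ v)) / 2 ∧ (1 + ovl (σ u) (σ v)) / 2 ≤ 1 ∧
      0 ≤ (1 - ovl (σ u) (σ v)) / 2 ∧ (1 - ovl (σ u) (σ v)) / 2 ≤ 1 := by
    intro u v
    have := abs_le.1 (abs_ovl_le hN (hσ u) (hσ v))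
    refine ⟨?_, ?_, ?_, ?_⟩ <;> linarith [this.1, this.2]
  constructor
  · intro u
    have : ‖featE k σ u‖ ^ 2 = 1 := by
      rw [← real_inner_self_eq_norm_sq, featE, inner_tpow, sum_halfLift, ovl_self hN (hσ u)]
      norm_num
    nlinarith [norm_nonneg (featE k σ u)]
  · intro u v
    rw [featM, featM, inner_tpow, sum_halfLift, ovl_neg_right, ovl_comm, ovl_neg_right, neg_neg,
      ovl_comm]
  · intro u v
    rw [featE, featM, inner_tpow, sum_halfLift, ovl_neg_right, ← sub_eq_add_neg]
  · intro u v
    rw [ovl_comm]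
  · exact fun u v => pow_nonneg (hb u v).2.2.1 k
  · exact fun u v => pow_le_one₀ (hb u v).2.2.1 (hb u v).2.2.2
  · exact fun u v => pow_nonneg (hb u v).1 k
  · exact fun u v => pow_le_one₀ (hb u v).1 (hb u v).2.1
  · intro u
    rw [ovl_self hN (hσ u)]
    norm_num
  · intro u
    rw [ovl_self hN (hσ u)]
    simp [Nat.one_le_iff_ne_zero.1 hk]

end TensorPower

section Interpolation

variable {U : Type*} [Fintype U] [Nonempty U]
variable {E F G : Type*} [NormedAddCommGroup E] [InnerProductSpace ℝ E] [FiniteDimensional ℝ E]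
  [MeasurableSpace E] [BorelSpace E]
  [NormedAddCommGroup F] [InnerProductSpace ℝ F] [FiniteDimensional ℝ F]
  [MeasurableSpace F] [BorelSpace F]
  [NormedAddCommGroup G] [InnerProductSpace ℝ G] [FiniteDimensional ℝ G]
  [MeasurableSpace G] [BorelSpace G]

lemma freeE_eq_of_gram (w : U → ℝ) {z : U → E} {z' : U → F}
    (h : ∀ u v, ⟪z u, z v⟫ = ⟪z' u, z' v⟫) : freeE w z = freeE w z' := by
  have h1 := isGaussFamily_inner z
  have h2 := isGaussFamily_inner z'
  simp only [h] at h1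
  have hm : Measurable (fun y : U → ℝ => LSE (fun u => w u + y u)) :=
    (continuous_LSE.comp (by fun_prop)).measurable
  exact h1.integral_eq h2 hm

lemma avg2_toLp (z : U → E) (v : U → F) (f : U → U → ℝ) :
    avg2 0 (fun u => (WithLp.toLp 2 (z u, v u) : WithLp 2 (E × F))) f
      = ∫ g, avg2 (fun u => ⟪z u, g⟫) v f ∂(stdGaussian E) := by
  have hmp := measurePreserving_toLp_prod (E := E) (F := F)
  have hi := integrable_avg2 0 (fun u => (WithLp.toLp 2 (z u, v u) : WithLp 2 (E × F))) f
  have hf : ∀ g : E × F, field 0 (fun u => (WithLp.toLp 2 (z u, v u) : WithLp 2 (E × F)))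
      (WithLp.toLp 2 g) = field (fun u => ⟪z u, g.1⟫) v g.2 := by
    intro g
    funext u
    simp [field, WithLp.prod_inner_apply]
  have hi2 := (hmp.integrable_comp hi.aestronglyMeasurable).2 hi
  unfold avg2
  rw [← hmp.map_eq, integral_map hmp.measurable.aemeasurable
    (by rw [hmp.map_eq]; exact hi.aestronglyMeasurable)]
  simp only [Function.comp_def, hf] at hi2
  simp only [hf]
  rw [integral_prod _ hi2]

lemma integrable_avg2_cond (z : U → E) (v : U → F) (f : U → U → ℝ) :
    Integrable (fun g => avg2 (fun u => ⟪z u, g⟫) v f) (stdGaussian E) := by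
  have hmp := measurePreserving_toLp_prod (E := E) (F := F)
  have hi := integrable_avg2 0 (fun u => (WithLp.toLp 2 (z u, v u) : WithLp 2 (E × F))) f
  have hf : ∀ g : E × F, field 0 (fun u => (WithLp.toLp 2 (z u, v u) : WithLp 2 (E × F)))
      (WithLp.toLp 2 g) = field (fun u => ⟪z u, g.1⟫) v g.2 := by
    intro g
    funext u
    simp [field, WithLp.prod_inner_apply]
  have hi2 := (hmp.integrable_comp hi.aestronglyMeasurable).2 hi
  simp only [Function.comp_def, hf] at hi2
  exact hi2.integral_prod_left

/-- Comparison of free energies of two Gaussian fields whose covariances are ordered up to an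
error controlled by the kernel of a perturbation system. -/
lemma freeE_le_of_pertSystem {x : U → E} {y : U → G} {e m : U → F} {p W : U → U → ℝ}
    (h : PertSystem e m p W) (k : ℕ)
    (hη : ∀ u v t, 2 * (W u v * W v t + W v t * W u t + W u t * W u v)
      - W u v ^ 2 - W v t ^ 2 - W u t ^ 2 ≤ 4 * (9 / 16) ^ k)
    (hdiag : ∀ u, ‖x u‖ ^ 2 = ‖y u‖ ^ 2) {C : ℝ} (hC : 0 ≤ C)
    (hoff : ∀ u v, -(C * (5 / 4) ^ k * W u v) ≤ ⟪x u, x v⟫ - ⟪y u, y v⟫) :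
    freeE 0 x ≤ freeE 0 y + 4 * 64 ^ k + 8 * C * (15 / 16) ^ k := by
  obtain ⟨X, hX⟩ : ∃ X : U → WithLp 2 (WithLp 2 (E × G) × F),
    X = fun u => WithLp.toLp 2 (WithLp.toLp 2 (x u, 0), 0) := ⟨_, rfl⟩
  obtain ⟨Y, hY⟩ : ∃ Y : U → WithLp 2 (WithLp 2 (E × G) × F),
    Y = fun u => WithLp.toLp 2 (WithLp.toLp 2 (0, y u), 0) := ⟨_, rfl⟩
  obtain ⟨v, hv⟩ : ∃ v : ℕ → U → F,
    v = fun i => pert (8 ^ k) e m ((i + 1 : ℕ) * 2 ^ k) := ⟨_, rfl⟩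
  obtain ⟨V, hV⟩ : ∃ V : ℕ → U → WithLp 2 (WithLp 2 (E × G) × F),
    V = fun i u => WithLp.toLp 2 (0, v i u) := ⟨_, rfl⟩
  have hXX : ∀ a b, ⟪X a, X b⟫ = ⟪x a, x b⟫ := by
    intro a b; simp [hX, WithLp.prod_inner_apply]
  have hYY : ∀ a b, ⟪Y a, Y b⟫ = ⟪y a, y b⟫ := by
    intro a b; simp [hY, WithLp.prod_inner_apply]
  have hXY : ∀ a b, ⟪X a, Y b⟫ = 0 := by
    intro a b; simp [hX, hY, WithLp.prod_inner_apply]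
  have hXV : ∀ i a b, ⟪X a, V i b⟫ = 0 := by
    intro i a b; simp [hX, hV, WithLp.prod_inner_apply]
  have hYV : ∀ i a b, ⟪Y a, V i b⟫ = 0 := by
    intro i a b; simp [hY, hV, WithLp.prod_inner_apply]
  have hVn : ∀ i ∈ Finset.range (2 ^ k), ∀ u, ‖V i u‖ ^ 2 ≤ 4 * 64 ^ k := by
    intro i hi u
    have h1 : ‖V i u‖ ^ 2 = ‖v i u‖ ^ 2 := by
      rw [← real_inner_self_eq_norm_sq, ← real_inner_self_eq_norm_sq]
      simp [hV]
    have h2 : ‖v i u‖ ≤ 2 * 8 ^ k := by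
      rw [hv]
      have hi' : ((i + 1 : ℕ) : ℝ) ≤ 2 ^ k := by exact_mod_cast Finset.mem_range.1 hi
      have h3 : ((i + 1 : ℕ) : ℝ) * 2 ^ k ≤ 8 ^ k := by
        calc ((i + 1 : ℕ) : ℝ) * 2 ^ k ≤ 2 ^ k * 2 ^ k := by gcongr
          _ = 4 ^ k := by rw [← mul_pow]; norm_num
          _ ≤ 8 ^ k := by gcongr; norm_num
      calc ‖pert (8 ^ k) e m ((i + 1 : ℕ) * 2 ^ k) u‖
          ≤ ‖(8 : ℝ) ^ k • e u‖ + ‖(((i + 1 : ℕ) : ℝ) * 2 ^ k) • m u‖ := norm_add_le _ _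
        _ = 8 ^ k + ((i + 1 : ℕ) : ℝ) * 2 ^ k := by
          rw [norm_smul, norm_smul, h.norm_e, h.norm_m, Real.norm_of_nonneg (by positivity),
            Real.norm_of_nonneg (by positivity), mul_one, mul_one]
        _ ≤ _ := by linarith
    rw [h1]
    have e : (64 : ℝ) ^ k = (8 ^ k) ^ 2 := by rw [← pow_mul, mul_comm, pow_mul]; norm_num
    rw [e]
    nlinarith [norm_nonneg (v i u)]
  have hder := fun (i : ℕ) (t : ℝ) =>
    hasDerivAt_freeE_rotCurve 0 Y X (V i) hXY (hXV i) (hYV i) t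
  have hbound : ∀ t ∈ Set.Icc (0 : ℝ) (Real.pi / 2), ∑ i ∈ Finset.range (2 ^ k),
      (Real.sin t * Real.cos t * (avg1 0 (rotCurve Y X (V i) t) (fun a => ‖X a‖ ^ 2 - ‖Y a‖ ^ 2)
        - avg2 0 (rotCurve Y X (V i) t) (fun a b => ⟪X a, X b⟫ - ⟪Y a, Y b⟫)))
      ≤ 1 / 2 * (C * (5 / 4) ^ k) * (2 ^ k * (8 * (3 / 4) ^ k)) := by
    intro t ht
    have hsc := sin_mul_cos_mem ht
    obtain ⟨z, hz⟩ : ∃ z : U → WithLp 2 (E × G),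
      z = fun u => WithLp.toLp 2 (Real.sin t • x u, Real.cos t • y u) := ⟨_, rfl⟩
    have hrot : ∀ i, rotCurve Y X (V i) t
        = fun u => (WithLp.toLp 2 (z u, v i u) : WithLp 2 (WithLp 2 (E × G) × F)) := by
      intro i
      funext u
      simp only [rotCurve, hX, hY, hV, hz]
      apply (WithLp.equiv 2 _).injective
      simp [← WithLp.toLp_smul, ← WithLp.toLp_add]
    have hterm : ∀ i, Real.sin t * Real.cos t *
        (avg1 0 (rotCurve Y X (V i) t) (fun a => ‖X a‖ ^ 2 - ‖Y a‖ ^ 2)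
        - avg2 0 (rotCurve Y X (V i) t) (fun a b => ⟪X a, X b⟫ - ⟪Y a, Y b⟫))
        ≤ 1 / 2 * (C * (5 / 4) ^ k) * ∫ g, avg2 (fun u => ⟪z u, g⟫) (v i) W
          ∂(stdGaussian (WithLp 2 (E × G))) := by
      intro i
      rw [← avg2_toLp, ← hrot]
      have e1 : (fun a => ‖X a‖ ^ 2 - ‖Y a‖ ^ 2) = fun _ => (0 : ℝ) := by
        funext a
        rw [← real_inner_self_eq_norm_sq, ← real_inner_self_eq_norm_sq, hXX, hYY,
          real_inner_self_eq_norm_sq, real_inner_self_eq_norm_sq, hdiag, sub_self]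
      rw [e1, avg1_const]
      have e2 := avg2_mono 0 (rotCurve Y X (V i) t)
        (f := fun a b => (-(C * (5 / 4) ^ k)) * W a b)
        (f' := fun a b => ⟪X a, X b⟫ - ⟪Y a, Y b⟫) fun a b => by
          rw [hXX, hYY, neg_mul]; exact hoff a b
      rw [avg2_const_mul] at e2
      have e3 := (avg2_mem 0 (rotCurve Y X (V i) t) h.W_nonneg h.W_le).1
      have e4 : 0 ≤ C * (5 / 4) ^ k * avg2 0 (rotCurve Y X (V i) t) W := by positivity
      calc _ ≤ Real.sin t * Real.cos t * (C * (5 / 4) ^ k * avg2 0 (rotCurve Y X (V i) t) W) :=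
            mul_le_mul_of_nonneg_left (by linarith) hsc.1
        _ ≤ 1 / 2 * (C * (5 / 4) ^ k * avg2 0 (rotCurve Y X (V i) t) W) :=
            mul_le_mul_of_nonneg_right hsc.2 e4
        _ = _ := by ring
    refine (Finset.sum_le_sum fun i _ => hterm i).trans ?_
    rw [← Finset.mul_sum]
    refine mul_le_mul_of_nonneg_left ?_ (by positivity)
    rw [← integral_finsetSum _ fun i _ => integrable_avg2_cond z (v i) W]
    calc _ ≤ ∫ _g, (2 ^ k * (8 * (3 / 4) ^ k) : ℝ) ∂(stdGaussian (WithLp 2 (E × G))) := by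
          refine integral_mono (integrable_finsetSum _ fun i _ => integrable_avg2_cond z (v i) W)
            (integrable_const _) fun g => ?_
          simp only [hv]
          exact h.sum_avg2_le _ k hη
      _ = _ := by simp
  have hint := sub_le_of_hasDerivAt_le
    (φ := fun s => ∑ i ∈ Finset.range (2 ^ k), freeE 0 (rotCurve Y X (V i) s))
    (fun t => HasDerivAt.fun_sum fun i _ => hder i t) hbound
  have h0 : ∀ i ∈ Finset.range (2 ^ k), freeE 0 (rotCurve Y X (V i) 0)
      ≤ freeE 0 y + 4 * 64 ^ k := by
    intro i hi
    have e : rotCurve Y X (V i) 0 = fun u => Y u + V i u := by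
      funext u; simp [rotCurve]
    rw [e, ← freeE_eq_of_gram 0 hYY]
    exact (freeE_add_le 0 Y (V i) (hYV i) (hVn i hi)).1
  have h1 : ∀ i ∈ Finset.range (2 ^ k), freeE 0 x ≤ freeE 0 (rotCurve Y X (V i) (Real.pi / 2)) := by
    intro i hi
    have e : rotCurve Y X (V i) (Real.pi / 2) = fun u => X u + V i u := by
      funext u; simp [rotCurve]
    rw [e, ← freeE_eq_of_gram 0 hXX]
    exact (freeE_add_le 0 X (V i) (hXV i) (hVn i hi)).2
  have s0 := Finset.sum_le_sum h0
  have s1 := Finset.sum_le_sum h1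
  simp only [Finset.sum_const, Finset.card_range, nsmul_eq_mul, Nat.cast_pow, Nat.cast_ofNat]
    at s0 s1
  have e5 : (5 / 4 : ℝ) ^ k * (3 / 4) ^ k = (15 / 16) ^ k := by rw [← mul_pow]; norm_num
  have e6 : 1 / 2 * (C * (5 / 4) ^ k) * (2 ^ k * (8 * (3 / 4) ^ k))
      = 2 ^ k * (4 * C * (15 / 16 : ℝ) ^ k) := by rw [← e5]; ring
  simp only [e6] at hint
  have hp : (2 : ℝ) ^ k * (4 * C * (15 / 16 : ℝ) ^ k) * (Real.pi / 2)
      ≤ 2 ^ k * (4 * C * (15 / 16 : ℝ) ^ k) * 2 :=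
    mul_le_mul_of_nonneg_left (by linarith [Real.pi_le_four]) (by positivity)
  have hfin : (2 : ℝ) ^ k * freeE 0 x
      ≤ 2 ^ k * (freeE 0 y + 4 * 64 ^ k + 8 * C * (15 / 16) ^ k) := by linarith
  exact le_of_mul_le_mul_left hfin (by positivity)

end Interpolation

section Tree

/-- Leaves of the tree whose levels are described by a list of pairs: a node at level `(M, q)` has
`M + 1` siblings, and two leaves separating just above that level have the previous overlap. -/
def Leaf : List (ℕ × ℝ) → Type
  | [] => Unit
  | p :: l => Fin (p.1 + 1) × Leaf l

instance instFintypeLeaf : (l : List (ℕ × ℝ)) → Fintype (Leaf l)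
  | [] => inferInstanceAs (Fintype Unit)
  | p :: l => by
    have := instFintypeLeaf l
    exact inferInstanceAs (Fintype (Fin (p.1 + 1) × Leaf l))

instance instNonemptyLeaf : (l : List (ℕ × ℝ)) → Nonempty (Leaf l)
  | [] => inferInstanceAs (Nonempty Unit)
  | p :: l => by
    have := instNonemptyLeaf l
    exact inferInstanceAs (Nonempty (Fin (p.1 + 1) × Leaf l))

/-- The overlap of two leaves. -/
def leafOvl : (q₀ : ℝ) → (l : List (ℕ × ℝ)) → Leaf l → Leaf l → ℝ
  | q₀, [], _, _ => q₀
  | q₀, p :: l, α, α' => if α.1 = α'.1 then leafOvl p.2 l α.2 α'.2 else q₀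

/-- `h` is nondecreasing along the levels of the tree. -/
def TreeMono (h : ℝ → ℝ) : ℝ → List (ℕ × ℝ) → Prop
  | _, [] => True
  | q₀, p :: l => h q₀ ≤ h p.2 ∧ TreeMono h p.2 l

/-- The sample space of the tree-indexed field. -/
def TreeG (E : Type) : List (ℕ × ℝ) → Type
  | [] => Unit
  | p :: l => Fin (p.1 + 1) → E × TreeG E l

instance instMeasurableSpaceTreeG (E : Type) [MeasurableSpace E] :
    (l : List (ℕ × ℝ)) → MeasurableSpace (TreeG E l)
  | [] => inferInstanceAs (MeasurableSpace Unit)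
  | p :: l => by
    have := instMeasurableSpaceTreeG E l
    exact inferInstanceAs (MeasurableSpace (Fin (p.1 + 1) → E × TreeG E l))

variable (E : Type) [NormedAddCommGroup E] [InnerProductSpace ℝ E] [FiniteDimensional ℝ E]
  [MeasurableSpace E] [BorelSpace E]

/-- The law of the independent increments along the edges of the tree. -/
def treeMeasure : (l : List (ℕ × ℝ)) → Measure (TreeG E l)
  | [] => (Measure.dirac () : Measure Unit)
  | p :: l => (Measure.pi fun _ : Fin (p.1 + 1) => (stdGaussian E).prod (treeMeasure l) :
      Measure (Fin (p.1 + 1) → E × TreeG E l))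

instance instIsProbabilityMeasureTree : (l : List (ℕ × ℝ)) → IsProbabilityMeasure (treeMeasure E l)
  | [] => inferInstanceAs (IsProbabilityMeasure (Measure.dirac ()))
  | p :: l => by
    have := instIsProbabilityMeasureTree l
    exact inferInstanceAs (IsProbabilityMeasure
      (Measure.pi fun _ : Fin (p.1 + 1) => (stdGaussian E).prod (treeMeasure E l)))

variable {E}

/-- The tree-indexed Gaussian field. -/
def treeField (h : ℝ → ℝ) : (q₀ : ℝ) → (l : List (ℕ × ℝ)) → TreeG E l → Leaf l → E
  | _, [], _, _ => 0
  | q₀, p :: l, g, α => √(h p.2 - h q₀) • (g α.1).1 + treeField h p.2 l (g α.1).2 α.2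

lemma measurable_treeField (h : ℝ → ℝ) (q₀ : ℝ) (l : List (ℕ × ℝ)) (α : Leaf l) :
    Measurable (fun g : TreeG E l => treeField h q₀ l g α) := by
  induction l generalizing q₀ with
  | nil => exact measurable_const
  | cons p l ih =>
    have h1 : Measurable (fun g : Fin (p.1 + 1) → E × TreeG E l => g α.1) := measurable_pi_apply _
    exact (h1.fst.const_smul _).add ((ih p.2 α.2).comp h1.snd)

lemma integral_treeField_char {h : ℝ → ℝ} {q₀ : ℝ} {l : List (ℕ × ℝ)} (hl : TreeMono h q₀ l)
    (s : Leaf l → E) :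
    ∫ g, Complex.exp ((∑ α, ⟪s α, treeField h q₀ l g α⟫ : ℝ) * Complex.I) ∂(treeMeasure E l)
      = Complex.exp (-(∑ α, ∑ α', ⟪s α, s α'⟫ * (h (leafOvl q₀ l α α') - h q₀) : ℝ) / 2) := by
  induction l generalizing q₀ with
  | nil => simp [treeField, leafOvl]
  | cons p l ih =>
    obtain ⟨hd, hl⟩ := hl
    obtain ⟨d, hd'⟩ : ∃ d, d = h p.2 - h q₀ := ⟨_, rfl⟩
    have hd0 : 0 ≤ d := by linarith
    have hs : ∀ f : Leaf (p :: l) → ℝ, ∑ α, f α = ∑ i : Fin (p.1 + 1), ∑ α : Leaf l, f (i, α) :=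
      fun f => Fintype.sum_prod_type f
    have e1 : ∀ g : Fin (p.1 + 1) → E × TreeG E l,
        Complex.exp ((∑ α, ⟪s α, treeField h q₀ (p :: l) g α⟫ : ℝ) * Complex.I)
        = ∏ i, (Complex.exp (⟪(g i).1, √d • ∑ α : Leaf l, s (i, α)⟫ * Complex.I)
          * Complex.exp ((∑ α : Leaf l, ⟪s (i, α), treeField h p.2 l (g i).2 α⟫ : ℝ)
            * Complex.I)) := by
      intro g
      rw [hs]
      simp_rw [← Complex.exp_add]
      rw [← Complex.exp_sum]
      congr 1
      rw [Complex.ofReal_sum, Finset.sum_mul]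
      refine Finset.sum_congr rfl fun i _ => ?_
      rw [← add_mul, ← Complex.ofReal_add]
      congr 2
      rw [real_inner_smul_right, inner_sum, Finset.mul_sum, ← Finset.sum_add_distrib]
      refine Finset.sum_congr rfl fun α _ => ?_
      simp only [treeField, inner_add_right, real_inner_smul_right, ← hd']
      rw [real_inner_comm]
    have e2 : ∫ g, Complex.exp ((∑ α, ⟪s α, treeField h q₀ (p :: l) g α⟫ : ℝ) * Complex.I)
        ∂(treeMeasure E (p :: l))
        = ∫ g : Fin (p.1 + 1) → E × TreeG E l,
        (∏ i, (Complex.exp (⟪(g i).1, √d • ∑ α : Leaf l, s (i, α)⟫ * Complex.I)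
          * Complex.exp ((∑ α : Leaf l, ⟪s (i, α), treeField h p.2 l (g i).2 α⟫ : ℝ)
            * Complex.I))) ∂(Measure.pi fun _ : Fin (p.1 + 1) =>
              (stdGaussian E).prod (treeMeasure E l)) :=
      integral_congr_ae (ae_of_all _ e1)
    rw [e2, integral_fintype_prod_eq_prod (fun (i : Fin (p.1 + 1)) (x : E × TreeG E l) =>
      (Complex.exp (⟪x.1, √d • ∑ α : Leaf l, s (i, α)⟫ * Complex.I)
          * Complex.exp ((∑ α : Leaf l, ⟪s (i, α), treeField h p.2 l x.2 α⟫ : ℝ)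
            * Complex.I)))]
    have e3 : ∀ i : Fin (p.1 + 1), ∫ x : E × TreeG E l,
        (Complex.exp (⟪x.1, √d • ∑ α : Leaf l, s (i, α)⟫ * Complex.I)
          * Complex.exp ((∑ α : Leaf l, ⟪s (i, α), treeField h p.2 l x.2 α⟫ : ℝ)
            * Complex.I)) ∂((stdGaussian E).prod (treeMeasure E l))
        = Complex.exp (-(∑ α : Leaf l, ∑ α' : Leaf l, ⟪s (i, α), s (i, α')⟫ *
          (h (leafOvl p.2 l α α') - h q₀) : ℝ) / 2) := by
      intro i
      rw [integral_prod_mul (fun x : E => Complex.exp (⟪x, √d • ∑ α : Leaf l, s (i, α)⟫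
        * Complex.I)) (fun x : TreeG E l => Complex.exp ((∑ α : Leaf l,
          ⟪s (i, α), treeField h p.2 l x α⟫ : ℝ) * Complex.I)),
        integral_stdGaussian_charFun, ih hl, ← Complex.exp_add]
      congr 1
      rw [← Complex.ofReal_pow, ← Complex.ofReal_neg, ← Complex.ofReal_neg, ← Complex.ofReal_neg]
      norm_cast
      rw [norm_smul, mul_pow, Real.norm_of_nonneg (Real.sqrt_nonneg _), Real.sq_sqrt hd0,
        ← real_inner_self_eq_norm_sq, sum_inner]
      simp_rw [inner_sum]
      rw [← add_div, Finset.mul_sum, ← neg_add, ← Finset.sum_add_distrib]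
      congr 2
      refine Finset.sum_congr rfl fun α _ => ?_
      rw [Finset.mul_sum, ← Finset.sum_add_distrib]
      refine Finset.sum_congr rfl fun α' _ => ?_
      rw [hd']
      ring
    rw [Finset.prod_congr rfl fun i _ => e3 i, ← Complex.exp_sum, ← Finset.sum_div]
    congr 2
    rw [Finset.sum_neg_distrib, ← Complex.ofReal_sum, hs]
    congr 2
    refine Finset.sum_congr rfl fun i _ => Finset.sum_congr rfl fun α _ => ?_
    rw [hs]
    rw [Finset.sum_eq_single i]
    · simp [leafOvl]
    · intro j _ hj
      simp [leafOvl, Ne.symm hj]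
    · simp

lemma isGaussFamily_treeField {A : Type*} [Fintype A] {h : ℝ → ℝ} {q₀ : ℝ} {l : List (ℕ × ℝ)}
    (hl : TreeMono h q₀ l) (s : A → E) :
    IsGaussFamily (treeMeasure E l) (fun (u : A × Leaf l) g => ⟪s u.1, treeField h q₀ l g u.2⟫)
      (fun u u' => ⟪s u.1, s u'.1⟫ * (h (leafOvl q₀ l u.2 u'.2) - h q₀)) where
  meas u := measurable_const.inner (measurable_treeField h q₀ l u.2)
  char t := by
    have e1 : ∀ g : TreeG E l, ∑ u : A × Leaf l, t u * ⟪s u.1, treeField h q₀ l g u.2⟫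
        = ∑ α, ⟪∑ a, t (a, α) • s a, treeField h q₀ l g α⟫ := by
      intro g
      rw [Fintype.sum_prod_type_right]
      refine Finset.sum_congr rfl fun α _ => ?_
      rw [sum_inner]
      exact Finset.sum_congr rfl fun a _ => by rw [real_inner_smul_left]
    have e2 : ∑ u : A × Leaf l, ∑ u' : A × Leaf l, t u * t u' *
        (⟪s u.1, s u'.1⟫ * (h (leafOvl q₀ l u.2 u'.2) - h q₀))
        = ∑ α, ∑ α', ⟪∑ a, t (a, α) • s a, ∑ a, t (a, α') • s a⟫ *
          (h (leafOvl q₀ l α α') - h q₀) := by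
      rw [Fintype.sum_prod_type_right]
      refine Finset.sum_congr rfl fun α _ => ?_
      simp_rw [Fintype.sum_prod_type_right]
      rw [Finset.sum_comm]
      refine Finset.sum_congr rfl fun α' _ => ?_
      rw [sum_inner, Finset.sum_mul]
      refine Finset.sum_congr rfl fun a _ => ?_
      rw [inner_sum, Finset.sum_mul]
      refine Finset.sum_congr rfl fun b _ => ?_
      rw [real_inner_smul_left, real_inner_smul_right]
      ring
    simp_rw [e1]
    rw [e2]
    exact integral_treeField_char hl _

/-- Internal nodes of the tree. -/
def TNode : List (ℕ × ℝ) → Type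
  | [] => Empty
  | p :: l => Fin (p.1 + 1) × Option (TNode l)

instance instFintypeTNode : (l : List (ℕ × ℝ)) → Fintype (TNode l)
  | [] => inferInstanceAs (Fintype Empty)
  | p :: l => by
    have := instFintypeTNode l
    exact inferInstanceAs (Fintype (Fin (p.1 + 1) × Option (TNode l)))

/-- Feature vectors whose Gram matrix is the tree covariance. -/
def treeFeat (h : ℝ → ℝ) : (q₀ : ℝ) → (l : List (ℕ × ℝ)) → Leaf l → TNode l → ℝ
  | _, [], _, _ => 0
  | q₀, p :: _, α, (i, none) => if α.1 = i then √(h p.2 - h q₀) else 0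
  | _, p :: l, α, (i, some ν) => if α.1 = i then treeFeat h p.2 l α.2 ν else 0

lemma sum_treeFeat {h : ℝ → ℝ} {q₀ : ℝ} {l : List (ℕ × ℝ)} (hl : TreeMono h q₀ l)
    (α α' : Leaf l) :
    ∑ ν, treeFeat h q₀ l α ν * treeFeat h q₀ l α' ν = h (leafOvl q₀ l α α') - h q₀ := by
  induction l generalizing q₀ with
  | nil => simp [treeFeat, leafOvl]
  | cons p l ih =>
    obtain ⟨hd, hl⟩ := hl
    have hs : ∀ f : TNode (p :: l) → ℝ, ∑ ν, f ν
        = ∑ i : Fin (p.1 + 1), (f (i, none) + ∑ ν : TNode l, f (i, some ν)) := by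
      intro f
      refine (Fintype.sum_prod_type f).trans ?_
      exact Finset.sum_congr rfl fun i _ => Fintype.sum_option _
    rw [hs, Finset.sum_eq_single α.1]
    · simp only [treeFeat, leafOvl, if_true]
      by_cases hα : α.1 = α'.1
      · simp only [hα, if_true]
        rw [ih hl, Real.mul_self_sqrt (by linarith)]
        ring
      · simp [hα, Ne.symm hα]
    · intro j _ hj
      simp [treeFeat, Ne.symm hj]
    · simp

end Tree

section GaussianMax

lemma stdGaussian_real : stdGaussian ℝ = gaussianReal 0 1 := by
  have := map_inner_stdGaussian (1 : ℝ)
  simpa using this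

lemma gaussianReal_Iic_le (t : ℝ) (ht : 0 ≤ t) :
    (gaussianReal 0 1).real (Set.Iic t) ≤ 1 - Real.exp (-(t + 1) ^ 2 / 2) / 3 := by
  have h1 : (gaussianReal 0 1).real (Set.Ioc t (t + 1)) =
      ∫ x in Set.Ioc t (t + 1), gaussianPDFReal 0 1 x := by
    rw [Measure.real, gaussianReal_apply_eq_integral _ one_ne_zero, ENNReal.toReal_ofReal]
    exact setIntegral_nonneg measurableSet_Ioc fun x _ => gaussianPDFReal_nonneg _ _ _
  have h2 : Real.exp (-(t + 1) ^ 2 / 2) / 3 ≤ ∫ x in Set.Ioc t (t + 1), gaussianPDFReal 0 1 x := by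
    have hc : ∀ x ∈ Set.Ioc t (t + 1), Real.exp (-(t + 1) ^ 2 / 2) / 3
        ≤ gaussianPDFReal 0 1 x := by
      intro x hx
      rw [gaussianPDFReal]
      have hs : √(2 * Real.pi * (1 : ℝ≥0)) ≤ 3 := by
        rw [Real.sqrt_le_left (by norm_num)]
        push_cast
        nlinarith [Real.pi_le_four]
      have hs0 : 0 < √(2 * Real.pi * (1 : ℝ≥0)) := Real.sqrt_pos.2 (by push_cast; positivity)
      rw [div_eq_inv_mul]
      refine mul_le_mul (inv_anti₀ hs0 hs) (Real.exp_le_exp.2 ?_) (Real.exp_pos _).le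
        (inv_nonneg.2 hs0.le)
      push_cast
      have : x ^ 2 ≤ (t + 1) ^ 2 := pow_le_pow_left₀ (ht.trans hx.1.le) hx.2 2
      linarith
    calc Real.exp (-(t + 1) ^ 2 / 2) / 3
        = ∫ _x in Set.Ioc t (t + 1), Real.exp (-(t + 1) ^ 2 / 2) / 3 := by simp
      _ ≤ _ := setIntegral_mono_on (integrable_const _)
          (integrable_gaussianPDFReal 0 1).integrableOn measurableSet_Ioc hc
  have h3 : (gaussianReal 0 1).real (Set.Iic t) + (gaussianReal 0 1).real (Set.Ioc t (t + 1))
      ≤ 1 := by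
    have hdisj : Disjoint (Set.Iic t) (Set.Ioc t (t + 1)) :=
      Set.disjoint_left.2 fun x hx hx' => not_lt.2 hx hx'.1
    rw [← measureReal_union hdisj measurableSet_Ioc]
    exact measureReal_le_one
  linarith

lemma pow_gaussianReal_Iic_le {n : ℕ} {T : ℝ} (hT : 3 ≤ T) (hn : Real.exp (T ^ 2 / 2) ≤ n) :
    (T - 3) * ((gaussianReal 0 1).real (Set.Iic (T - 3))) ^ n ≤ 3 := by
  have h1 := gaussianReal_Iic_le (T - 3) (by linarith)
  obtain ⟨p, hp⟩ : ∃ p, p = Real.exp (-(T - 3 + 1) ^ 2 / 2) / 3 := ⟨_, rfl⟩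
  rw [← hp] at h1
  have hp0 : 0 < p := by rw [hp]; positivity
  have h2 : (gaussianReal 0 1).real (Set.Iic (T - 3)) ≤ Real.exp (-p) :=
    h1.trans (by linarith [Real.add_one_le_exp (-p)])
  have h3 : ((gaussianReal 0 1).real (Set.Iic (T - 3))) ^ n ≤ Real.exp (-(n * p)) := by
    refine (pow_le_pow_left₀ measureReal_nonneg h2 n).trans (le_of_eq ?_)
    rw [← Real.exp_nat_mul]
    ring_nf
  have h4 : T / 3 ≤ n * p := by
    calc T / 3 ≤ Real.exp (2 * T - 2) / 3 := by
          have := Real.add_one_le_exp (2 * T - 2)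
          linarith
      _ = Real.exp (T ^ 2 / 2) * p := by
          rw [hp, mul_div_assoc', ← Real.exp_add]
          ring_nf
      _ ≤ n * p := by gcongr
  have h5 : n * p ≤ Real.exp (n * p) := by linarith [Real.add_one_le_exp (n * p)]
  calc (T - 3) * ((gaussianReal 0 1).real (Set.Iic (T - 3))) ^ n
      ≤ T * Real.exp (-(n * p)) := by
        apply mul_le_mul _ h3 (by positivity) (by linarith)
        linarith
    _ ≤ 3 * Real.exp (n * p) * Real.exp (-(n * p)) := by
        apply mul_le_mul_of_nonneg_right _ (Real.exp_pos _).le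
        linarith
    _ = 3 := by rw [mul_assoc, ← Real.exp_add]; simp

lemma integrable_LSE_pi {n : ℕ} (s : ℝ) :
    Integrable (fun η : Fin (n + 1) → ℝ => LSE (fun i => s * η i))
      (Measure.pi fun _ : Fin (n + 1) => gaussianReal 0 1) := by
  have hi : ∀ i, Integrable (fun η : Fin (n + 1) → ℝ => |s * η i|)
      (Measure.pi fun _ : Fin (n + 1) => gaussianReal 0 1) := by
    intro i
    have h := (memLp_id_gaussianReal (μ := 0) (v := 1) 1).integrable le_rfl
    exact ((measurePreserving_eval (fun _ : Fin (n + 1) => gaussianReal 0 1) i).integrable_comp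
      h.aestronglyMeasurable).2 h |>.const_mul s |>.abs
  refine Integrable.mono' ((integrable_const (Real.log (Fintype.card (Fin (n + 1))))).add
    (integrable_finsetSum Finset.univ fun i _ => hi i))
    (continuous_LSE.comp (by fun_prop)).aestronglyMeasurable (ae_of_all _ fun η => ?_)
  simpa using abs_LSE_le (fun i => s * η i)

/-- Lower bound for the expected (soft) maximum of independent standard Gaussians. -/
lemma le_integral_LSE_pi (n : ℕ) {s : ℝ} (hs : 0 ≤ s) :
    s * (√(2 * Real.log (n + 1)) - 14) ≤ ∫ η : Fin (n + 1) → ℝ, LSE (fun i => s * η i)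
      ∂(Measure.pi fun _ : Fin (n + 1) => gaussianReal 0 1) := by
  obtain ⟨T, hT⟩ : ∃ T, T = √(2 * Real.log (n + 1)) := ⟨_, rfl⟩
  obtain ⟨t, ht⟩ : ∃ t, t = max (T - 3) 0 := ⟨_, rfl⟩
  obtain ⟨μ, hμ⟩ : ∃ μ, μ = Measure.pi fun _ : Fin (n + 1) => gaussianReal 0 1 := ⟨_, rfl⟩
  have : IsProbabilityMeasure μ := by rw [hμ]; infer_instance
  rw [← hT, ← hμ]
  obtain ⟨S, hS⟩ : ∃ S : Set (Fin (n + 1) → ℝ), S = Set.univ.pi fun _ => Set.Iic t := ⟨_, rfl⟩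
  have hSm : MeasurableSet S := by
    rw [hS]; exact MeasurableSet.univ_pi fun _ => measurableSet_Iic
  have hmp := measurePreserving_eval (fun _ : Fin (n + 1) => gaussianReal 0 1) 0
  rw [← hμ] at hmp
  have ha : Integrable (fun x : ℝ => |x|) (gaussianReal 0 1) :=
    ((memLp_id_gaussianReal (μ := 0) (v := 1) 1).integrable le_rfl).abs
  have hai : Integrable (fun η : Fin (n + 1) → ℝ => |η 0|) μ :=
    (hmp.integrable_comp ha.aestronglyMeasurable).2 ha
  have ha1 : ∫ η : Fin (n + 1) → ℝ, |η 0| ∂μ ≤ 1 := by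
    have e1 : ∫ η : Fin (n + 1) → ℝ, |η 0| ∂μ = ∫ x, |x| ∂(gaussianReal 0 1) := by
      rw [← hmp.map_eq, integral_map hmp.measurable.aemeasurable]
      exact continuous_abs.aestronglyMeasurable
    rw [e1, ← stdGaussian_real]
    have := integral_abs_inner_le (1 : ℝ)
    simpa using this
  have hSr : μ.real S = ((gaussianReal 0 1).real (Set.Iic t)) ^ (n + 1) := by
    rw [hS, hμ, Measure.real, Measure.pi_pi]
    simp [Measure.real]
  have ht3 : t * μ.real S ≤ 3 := by
    rw [hSr]
    rcases le_total 3 T with h | h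
    · have e : t = T - 3 := by rw [ht, max_eq_left (by linarith)]
      rw [e]
      refine pow_gaussianReal_Iic_le h (le_of_eq ?_)
      have hl : 0 ≤ Real.log ((n : ℝ) + 1) := Real.log_nonneg (by linarith [n.cast_nonneg (α := ℝ)])
      rw [hT, Real.sq_sqrt (by positivity), mul_div_cancel_left₀ _ two_ne_zero,
        Real.exp_log (by positivity)]
      push_cast
      rfl
    · have e : t = 0 := by rw [ht, max_eq_right (by linarith)]
      rw [e, zero_mul]
      norm_num
  have hpt : ∀ η : Fin (n + 1) → ℝ,
      s * (t * (1 - S.indicator 1 η) - |η 0|) ≤ LSE (fun i => s * η i) := by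
    intro η
    by_cases hη : η ∈ S
    · rw [Set.indicator_of_mem hη]
      refine le_trans ?_ (le_LSE (fun i => s * η i) 0)
      refine mul_le_mul_of_nonneg_left ?_ hs
      simp only [Pi.one_apply, sub_self, mul_zero, zero_sub]
      exact neg_abs_le _
    · rw [Set.indicator_of_notMem hη]
      rw [hS] at hη
      simp only [Set.mem_pi, Set.mem_univ, forall_const, Set.mem_Iic, not_forall, not_le] at hη
      obtain ⟨i, hi⟩ := hη
      refine le_trans ?_ (le_LSE (fun i => s * η i) i)
      refine mul_le_mul_of_nonneg_left ?_ hs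
      have := abs_nonneg (η 0)
      linarith
  have hind : Integrable (fun η : Fin (n + 1) → ℝ => S.indicator (1 : (Fin (n + 1) → ℝ) → ℝ) η) μ :=
    (integrable_const (1 : ℝ)).indicator hSm
  have hI1 : Integrable (fun η : Fin (n + 1) → ℝ => t * (1 - S.indicator 1 η)) μ :=
    ((integrable_const 1).sub hind).const_mul t
  have hint := integral_mono ((hI1.sub hai).const_mul s)
    (by rw [hμ]; exact integrable_LSE_pi s) hpt
  have e2 : ∫ η : Fin (n + 1) → ℝ, s * (t * (1 - S.indicator 1 η) - |η 0|) ∂μ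
      = s * (t * (1 - μ.real S) - ∫ η : Fin (n + 1) → ℝ, |η 0| ∂μ) := by
    rw [integral_const_mul, integral_sub hI1 hai, integral_const_mul,
      integral_sub (integrable_const _) hind, integral_indicator_one hSm]
    simp
  refine le_trans ?_ hint
  refine le_trans ?_ e2.ge
  refine mul_le_mul_of_nonneg_left ?_ hs
  have : T - 3 ≤ t := by rw [ht]; exact le_max_left _ _
  linarith

end GaussianMax

section TreeLower

variable {E : Type} [NormedAddCommGroup E] [InnerProductSpace ℝ E] [FiniteDimensional ℝ E]
  [MeasurableSpace E] [BorelSpace E]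

lemma integrable_treeField (h : ℝ → ℝ) (q₀ : ℝ) (l : List (ℕ × ℝ)) (α : Leaf l) :
    Integrable (fun g : TreeG E l => treeField h q₀ l g α) (treeMeasure E l) := by
  induction l generalizing q₀ with
  | nil => exact integrable_const 0
  | cons p l ih =>
    have hmp := measurePreserving_eval (fun _ : Fin (p.1 + 1) =>
      (stdGaussian E).prod (treeMeasure E l)) α.1
    have h0 : Integrable (fun g : E => g) (stdGaussian E) :=
      (integrable_norm_iff measurable_id.aestronglyMeasurable).1 integrable_norm_stdGaussian
    have h1 : Integrable (fun x : E × TreeG E l => √(h p.2 - h q₀) • x.1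
        + treeField h p.2 l x.2 α.2) ((stdGaussian E).prod (treeMeasure E l)) :=
      ((h0.comp_fst (treeMeasure E l)).smul (√(h p.2 - h q₀))).add ((ih p.2 α.2).comp_snd _)
    exact (hmp.integrable_comp h1.aestronglyMeasurable).2 h1

lemma integrable_LSE_of_integrable {Ω U : Type*} [MeasurableSpace Ω] [Fintype U] [Nonempty U]
    {μ : Measure Ω} [IsProbabilityMeasure μ] {X : Ω → U → ℝ}
    (hX : ∀ u, Integrable (fun ω => X ω u) μ) : Integrable (fun ω => LSE (X ω)) μ := by
  refine Integrable.mono' ((integrable_const (Real.log (Fintype.card U))).add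
    (integrable_finsetSum Finset.univ fun u _ => (hX u).abs)) ?_
    (ae_of_all _ fun ω => by simpa using abs_LSE_le (X ω))
  exact continuous_LSE.comp_aestronglyMeasurable
    (aemeasurable_pi_lambda _ fun u => (hX u).aemeasurable).aestronglyMeasurable

/-- Sum of a function of consecutive levels of the tree. -/
def treeSum (f : ℕ → ℝ → ℝ → ℝ) : ℝ → List (ℕ × ℝ) → ℝ
  | _, [] => 0
  | q₀, p :: l => f p.1 q₀ p.2 + treeSum f p.2 l

lemma LSE_iterate {I L : Type*} [Fintype I] [Fintype L] [Nonempty I] [Nonempty L] (a : I → ℝ)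
    (f : I → L → ℝ) :
    LSE (fun u : I × L => a u.1 + f u.1 u.2) = LSE (fun i => a i + LSE (f i)) := by
  apply Real.exp_injective
  rw [exp_LSE, exp_LSE, Fintype.sum_prod_type]
  refine Finset.sum_congr rfl fun i _ => ?_
  simp_rw [Real.exp_add]
  rw [exp_LSE, Finset.mul_sum]

lemma le_integral_LSE_tree (h : ℝ → ℝ) (q₀ : ℝ) (l : List (ℕ × ℝ)) :
    treeSum (fun M q q' => √(h q' - h q) * (√(2 * Real.log (M + 1)) - 14)) q₀ l
      ≤ ∫ g, LSE (treeField h q₀ l g) ∂(treeMeasure ℝ l) := by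
  induction l generalizing q₀ with
  | nil =>
    have : ∀ g, LSE (treeField (E := ℝ) h q₀ [] g) = 0 := by
      intro g
      change Real.log (∑ _ : Unit, Real.exp 0) = 0
      simp
    simp only [this, treeSum, integral_zero, le_refl]
  | cons p l ih =>
    obtain ⟨s, hs⟩ : ∃ s, s = √(h p.2 - h q₀) := ⟨_, rfl⟩
    have hs0 : 0 ≤ s := by rw [hs]; positivity
    have hx : Integrable (fun g : TreeG ℝ l => LSE (treeField h p.2 l g)) (treeMeasure ℝ l) :=
      integrable_LSE_of_integrable fun α => integrable_treeField h p.2 l α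
    obtain ⟨c, hc⟩ : ∃ c, c = ∫ g, LSE (treeField h p.2 l g) ∂(treeMeasure ℝ l) := ⟨_, rfl⟩
    have hmp := measurePreserving_arrowProdEquivProdArrow ℝ (TreeG ℝ l) (Fin (p.1 + 1))
      (fun _ => stdGaussian ℝ) (fun _ => treeMeasure ℝ l)
    obtain ⟨μ, hμ⟩ : ∃ μ, μ = Measure.pi fun _ : Fin (p.1 + 1) => gaussianReal 0 1 := ⟨_, rfl⟩
    obtain ⟨ν, hν⟩ : ∃ ν, ν = Measure.pi fun _ : Fin (p.1 + 1) => treeMeasure ℝ l := ⟨_, rfl⟩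
    have hμp : IsProbabilityMeasure μ := by rw [hμ]; infer_instance
    have hνp : IsProbabilityMeasure ν := by rw [hν]; infer_instance
    simp only [stdGaussian_real, ← hμ, ← hν] at hmp
    obtain ⟨Φ, hΦ⟩ : ∃ Φ : (Fin (p.1 + 1) → ℝ) × (Fin (p.1 + 1) → TreeG ℝ l) → ℝ,
      Φ = fun x => LSE (fun i => s * x.1 i + LSE (treeField h p.2 l (x.2 i))) := ⟨_, rfl⟩
    have hfield : ∀ g : Fin (p.1 + 1) → ℝ × TreeG ℝ l, LSE (treeField h q₀ (p :: l) g)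
        = Φ (MeasurableEquiv.arrowProdEquivProdArrow ℝ (TreeG ℝ l) (Fin (p.1 + 1)) g) := by
      intro g
      rw [hΦ]
      refine Eq.trans ?_ (LSE_iterate (fun i => s * (g i).1) (fun i => treeField h p.2 l (g i).2))
      rw [hs]
      rfl
    have hxi : ∀ i, Integrable (fun y : Fin (p.1 + 1) → TreeG ℝ l =>
        LSE (treeField h p.2 l (y i))) ν := by
      intro i
      have := measurePreserving_eval (fun _ : Fin (p.1 + 1) => treeMeasure ℝ l) i
      rw [← hν] at this
      exact (this.integrable_comp hx.aestronglyMeasurable).2 hx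
    have hxc : ∀ i, ∫ y : Fin (p.1 + 1) → TreeG ℝ l, LSE (treeField h p.2 l (y i)) ∂ν = c := by
      intro i
      have := measurePreserving_eval (fun _ : Fin (p.1 + 1) => treeMeasure ℝ l) i
      rw [← hν] at this
      rw [hc, ← this.map_eq, integral_map this.measurable.aemeasurable]
      rw [this.map_eq]
      exact hx.aestronglyMeasurable
    have hgi : ∀ i, Integrable (fun x : Fin (p.1 + 1) → ℝ => gibbs (fun j => s * x j) i) μ := by
      intro i
      have hcont : Continuous (fun x : Fin (p.1 + 1) → ℝ => fun j => s * x j) := by fun_prop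
      refine Integrable.of_bound (C := 1) ((continuous_gibbs i).comp
        hcont).aestronglyMeasurable (ae_of_all _ fun x => ?_)
      rw [Real.norm_of_nonneg (gibbs_pos _ _).le]
      exact gibbs_le_one _ _
    have hL : Integrable (fun x : Fin (p.1 + 1) → ℝ => LSE (fun i => s * x i)) μ := by
      rw [hμ]; exact integrable_LSE_pi s
    have hΦi : Integrable Φ (μ.prod ν) := by
      rw [hΦ]
      refine integrable_LSE_of_integrable fun i => ?_
      have h1 : Integrable (fun x : Fin (p.1 + 1) → ℝ => s * x i) μ := by
        rw [hμ]
        have h := (memLp_id_gaussianReal (μ := 0) (v := 1) 1).integrable le_rfl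
        exact ((measurePreserving_eval (fun _ : Fin (p.1 + 1) => gaussianReal 0 1)
          i).integrable_comp h.aestronglyMeasurable).2 h |>.const_mul s
      exact (h1.comp_fst ν).add ((hxi i).comp_snd μ)
    have hlow : Integrable (fun x : (Fin (p.1 + 1) → ℝ) × (Fin (p.1 + 1) → TreeG ℝ l) =>
        LSE (fun i => s * x.1 i) + ∑ i, gibbs (fun j => s * x.1 j) i *
          LSE (treeField h p.2 l (x.2 i))) (μ.prod ν) :=
      (hL.comp_fst ν).add (integrable_finsetSum _ fun i _ => (hgi i).mul_prod (hxi i))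
    have hmono := integral_mono hlow hΦi fun x => by
      have := sum_gibbs_mul_le_LSE_sub (fun i => s * x.1 i)
        (fun i => LSE (treeField h p.2 l (x.2 i)))
      simp only [hΦ]
      linarith
    have hval : ∫ x : (Fin (p.1 + 1) → ℝ) × (Fin (p.1 + 1) → TreeG ℝ l),
        (LSE (fun i => s * x.1 i) + ∑ i, gibbs (fun j => s * x.1 j) i *
          LSE (treeField h p.2 l (x.2 i))) ∂(μ.prod ν)
        = (∫ x : Fin (p.1 + 1) → ℝ, LSE (fun i => s * x i) ∂μ) + c := by
      rw [integral_add (hL.comp_fst ν) (integrable_finsetSum _ fun i _ => (hgi i).mul_prod (hxi i)),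
        integral_finsetSum _ fun i _ => (hgi i).mul_prod (hxi i)]
      congr 1
      · have := integral_prod_mul (μ := μ) (ν := ν)
          (fun x : Fin (p.1 + 1) → ℝ => LSE (fun i => s * x i)) (fun _ => (1 : ℝ))
        simpa using this
      · have h1 : ∀ i, ∫ x : (Fin (p.1 + 1) → ℝ) × (Fin (p.1 + 1) → TreeG ℝ l),
            gibbs (fun j => s * x.1 j) i * LSE (treeField h p.2 l (x.2 i)) ∂(μ.prod ν)
            = (∫ x : Fin (p.1 + 1) → ℝ, gibbs (fun j => s * x j) i ∂μ) * c := by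
          intro i
          rw [integral_prod_mul (fun x : Fin (p.1 + 1) → ℝ => gibbs (fun j => s * x j) i)
            (fun y : Fin (p.1 + 1) → TreeG ℝ l => LSE (treeField h p.2 l (y i))), hxc]
        rw [Finset.sum_congr rfl fun i _ => h1 i, ← Finset.sum_mul,
          ← integral_finsetSum _ fun i _ => hgi i]
        simp [sum_gibbs]
    have htot : ∫ g, LSE (treeField h q₀ (p :: l) g) ∂(treeMeasure ℝ (p :: l))
        = ∫ x, Φ x ∂(μ.prod ν) := by
      rw [← hmp.map_eq, integral_map hmp.measurable.aemeasurable
        (by rw [hmp.map_eq]; exact hΦi.aestronglyMeasurable)]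
      refine Eq.trans (integral_congr_ae (ae_of_all _ hfield)) ?_
      simp only [treeMeasure, stdGaussian_real]
      rfl
    have hmax := le_integral_LSE_pi p.1 hs0
    rw [← hμ] at hmax
    rw [htot]
    refine le_trans ?_ (hval.ge.trans hmono)
    rw [treeSum, ← hs]
    have := ih p.2
    rw [← hc] at this
    linarith

end TreeLower

section GaussianSquare

lemma integral_exp_sq_gaussianReal {a s D : ℝ} (hD : 0 < D) (h : D = 1 - 2 * a * s ^ 2) (x : ℝ) :
    ∫ g, Real.exp (a * (x + s * g) ^ 2) ∂(gaussianReal 0 1)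
      = (√D)⁻¹ * Real.exp (a * x ^ 2 / D) := by
  rw [integral_gaussianReal_eq_integral_smul one_ne_zero]
  have hv : Real.toNNReal D⁻¹ ≠ 0 := (Real.toNNReal_pos.2 (inv_pos.2 hD)).ne'
  have e : ∀ g : ℝ, gaussianPDFReal 0 1 g • Real.exp (a * (x + s * g) ^ 2)
      = ((√D)⁻¹ * Real.exp (a * x ^ 2 / D)) *
        gaussianPDFReal (2 * a * s * x / D) (Real.toNNReal D⁻¹) g := by
    intro g
    simp only [gaussianPDFReal, smul_eq_mul, NNReal.coe_one, mul_one,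
      Real.coe_toNNReal _ (inv_pos.2 hD).le]
    have h1 : (√(2 * Real.pi * D⁻¹))⁻¹ = (√(2 * Real.pi))⁻¹ * √D := by
      rw [Real.sqrt_mul (by positivity), Real.sqrt_inv, mul_inv, inv_inv]
    have hsD : √D ≠ 0 := (Real.sqrt_pos.2 hD).ne'
    rw [h1, mul_assoc, ← Real.exp_add]
    have h2 : -(g - 0) ^ 2 / 2 + a * (x + s * g) ^ 2
        = a * x ^ 2 / D + -(g - 2 * a * s * x / D) ^ 2 / (2 * D⁻¹) := by
      field_simp
      rw [h]
      ring
    rw [h2, Real.exp_add]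
    field_simp
  rw [integral_congr_ae (ae_of_all _ e), integral_const_mul, integral_gaussianPDFReal_eq_one _ hv,
    mul_one]

lemma lintegral_exp_sq_stdGaussian {ι : Type*} [Fintype ι] {a s D : ℝ} (hD : 0 < D)
    (h : D = 1 - 2 * a * s ^ 2) (x : EuclideanSpace ℝ ι) :
    ∫⁻ g, ENNReal.ofReal (Real.exp (a * ‖x + s • g‖ ^ 2)) ∂(stdGaussian (EuclideanSpace ℝ ι))
      = ENNReal.ofReal (Real.exp (a * ‖x‖ ^ 2 / D - Fintype.card ι / 2 * Real.log D)) := by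
  have hm : Measurable (WithLp.toLp 2 : (ι → ℝ) → EuclideanSpace ℝ ι) := by fun_prop
  rw [← map_pi_eq_stdGaussian, lintegral_map (by fun_prop) hm]
  have e : ∀ g : ι → ℝ, Real.exp (a * ‖x + s • WithLp.toLp 2 g‖ ^ 2)
      = ∏ i, Real.exp (a * (x i + s * g i) ^ 2) := by
    intro g
    rw [EuclideanSpace.norm_sq_eq, Finset.mul_sum, Real.exp_sum]
    simp
  simp_rw [e]
  have hi : ∫ g : ι → ℝ, ∏ i, Real.exp (a * (x i + s * g i) ^ 2)
      ∂(Measure.pi fun _ => gaussianReal 0 1)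
      = Real.exp (a * ‖x‖ ^ 2 / D - Fintype.card ι / 2 * Real.log D) := by
    rw [integral_fintype_prod_eq_prod (fun i (y : ℝ) => Real.exp (a * (x i + s * y) ^ 2))]
    simp_rw [integral_exp_sq_gaussianReal hD h]
    rw [Finset.prod_mul_distrib, ← Real.exp_sum, Finset.prod_const, Finset.card_univ,
      EuclideanSpace.norm_sq_eq, sub_eq_neg_add, Real.exp_add]
    congr 1
    · rw [← Real.exp_log (inv_pos.2 (Real.sqrt_pos.2 hD)), ← Real.exp_nat_mul, Real.log_inv,
        Real.log_sqrt hD.le]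
      ring_nf
    · simp only [Real.norm_eq_abs, sq_abs]
      rw [Finset.mul_sum, Finset.sum_div]
  rw [← ofReal_integral_eq_lintegral_ofReal, hi]
  · refine not_imp_comm.1 integral_undef ?_
    rw [hi]
    positivity
  · exact ae_of_all _ fun g => Finset.prod_nonneg fun i _ => (Real.exp_pos _).le

lemma rpow_sum_le_sum_rpow {ι : Type*} (s : Finset ι) (f : ι → ℝ≥0∞) {p : ℝ} (hp : 0 < p)
    (hp1 : p ≤ 1) : (∑ i ∈ s, f i) ^ p ≤ ∑ i ∈ s, f i ^ p := by
  classical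
  induction s using Finset.induction_on with
  | empty => simp [hp]
  | insert i s hi ih =>
    rw [Finset.sum_insert hi, Finset.sum_insert hi]
    exact (ENNReal.rpow_add_le_add_rpow _ _ hp.le hp1).trans (by gcongr)

lemma lintegral_rpow_le_rpow_lintegral {α : Type*} [MeasurableSpace α] {μ : Measure α}
    [IsProbabilityMeasure μ] {f : α → ℝ≥0∞} (hf : AEMeasurable f μ) {p : ℝ} (hp : 0 < p)
    (hp1 : p ≤ 1) : ∫⁻ x, f x ^ p ∂μ ≤ (∫⁻ x, f x ∂μ) ^ p := by
  have h := eLpNorm'_le_eLpNorm'_of_exponent_le hp hp1 μ (f := f) hf.aestronglyMeasurable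
  simp only [eLpNorm'_eq_lintegral_enorm, enorm_eq_self, ENNReal.rpow_one, div_one] at h
  calc ∫⁻ x, f x ^ p ∂μ = ((∫⁻ x, f x ^ p ∂μ) ^ (1 / p)) ^ p := by
        rw [← ENNReal.rpow_mul, one_div_mul_cancel hp.ne', ENNReal.rpow_one]
    _ ≤ _ := ENNReal.rpow_le_rpow h hp.le

end GaussianSquare

section TreeUpper

/-- The last level of the tree. -/
def lastLevel : ℝ → List (ℕ × ℝ) → ℝ
  | q₀, [] => q₀
  | _, p :: l => lastLevel p.2 l

/-- The increments of `B` relative to those of `h` are positive, nondecreasing, at least `m` and at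
most `β` along the levels of the tree. -/
def TreeSlope (h B : ℝ → ℝ) (β : ℝ) : ℝ → ℝ → List (ℕ × ℝ) → Prop
  | _, _, [] => True
  | m, q₀, p :: l => h q₀ < h p.2 ∧ B q₀ < B p.2 ∧ m ≤ (B p.2 - B q₀) / (h p.2 - h q₀) ∧
      (B p.2 - B q₀) / (h p.2 - h q₀) ≤ β ∧
      TreeSlope h B β ((B p.2 - B q₀) / (h p.2 - h q₀)) p.2 l

variable {ι : Type} [Fintype ι]

/-- The partition function of the tree of norms. -/
def treeZ (h : ℝ → ℝ) (a : ℝ) (q₀ : ℝ) (l : List (ℕ × ℝ)) (x : EuclideanSpace ℝ ι)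
    (g : TreeG (EuclideanSpace ℝ ι) l) : ℝ≥0∞ :=
  ∑ α : Leaf l, ENNReal.ofReal (Real.exp (a * ‖x + treeField h q₀ l g α‖))

lemma measurable_treeZ (h : ℝ → ℝ) (a : ℝ) (q₀ : ℝ) (l : List (ℕ × ℝ)) :
    Measurable (fun y : EuclideanSpace ℝ ι × TreeG (EuclideanSpace ℝ ι) l =>
      treeZ h a q₀ l y.1 y.2) := by
  unfold treeZ
  refine Finset.measurable_sum _ fun α _ => ENNReal.measurable_ofReal.comp
    (Real.measurable_exp.comp (Measurable.const_mul (Measurable.norm ?_) a))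
  exact measurable_fst.add ((measurable_treeField h q₀ l α).comp measurable_snd)

lemma measurable_treeZ_right (h : ℝ → ℝ) (a : ℝ) (q₀ : ℝ) (l : List (ℕ × ℝ))
    (x : EuclideanSpace ℝ ι) :
    Measurable (fun g : TreeG (EuclideanSpace ℝ ι) l => treeZ h a q₀ l x g) := by
  unfold treeZ
  exact Finset.measurable_sum _ fun α _ => ENNReal.measurable_ofReal.comp
    (Real.measurable_exp.comp (Measurable.const_mul
      (Measurable.norm ((measurable_treeField h q₀ l α).const_add x)) a))

lemma treeZ_cons (h : ℝ → ℝ) (a : ℝ) (q₀ : ℝ) (p : ℕ × ℝ) (l : List (ℕ × ℝ))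
    (x : EuclideanSpace ℝ ι) (g : Fin (p.1 + 1) → EuclideanSpace ℝ ι × TreeG _ l) :
    treeZ h a q₀ (p :: l) x g
      = ∑ i, treeZ h a p.2 l (x + √(h p.2 - h q₀) • (g i).1) (g i).2 := by
  refine (Fintype.sum_prod_type _).trans ?_
  simp only [treeZ, treeField, add_assoc]

/-- The exponent in the moment bound for `treeZ`. -/
def treeKappa (h B : ℝ → ℝ) (r n : ℝ) (q₀ : ℝ) (l : List (ℕ × ℝ)) : ℝ :=
  r ^ 2 * B (lastLevel q₀ l) / 2 + treeSum (fun M q q' => (h q' - h q) / (B q' - B q) *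
    (Real.log (M + 1) + n / 2 * Real.log (B q' / B q))) q₀ l

lemma lintegral_treeZ_rpow_le {h B : ℝ → ℝ} {β r : ℝ} (hβ : 0 < β) {m : ℝ} (hm : 0 < m)
    (hmβ : m ≤ β)
    {q₀ : ℝ} {l : List (ℕ × ℝ)} (hB : 0 < B q₀) (hl : TreeSlope h B β m q₀ l)
    (x : EuclideanSpace ℝ ι) :
    ∫⁻ g, treeZ h (β * r) q₀ l x g ^ (m / β) ∂(treeMeasure _ l)
      ≤ ENNReal.ofReal (Real.exp (m * (‖x‖ ^ 2 / (2 * B q₀)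
        + treeKappa h B r (Fintype.card ι) q₀ l))) := by
  induction l generalizing q₀ x m with
  | nil =>
    have e : ∀ g, treeZ h (β * r) q₀ [] x g = ENNReal.ofReal (Real.exp (β * r * ‖x‖)) := by
      intro g
      change ∑ _ : Unit, ENNReal.ofReal (Real.exp (β * r * ‖x + 0‖)) = _
      simp
    simp only [e, lintegral_const, measure_univ, mul_one]
    rw [ENNReal.ofReal_rpow_of_pos (Real.exp_pos _), ← Real.exp_mul]
    refine ENNReal.ofReal_le_ofReal (Real.exp_le_exp.2 ?_)
    simp only [treeKappa, lastLevel, treeSum, add_zero]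
    have e1 : β * r * ‖x‖ * (m / β) = m * (r * ‖x‖) := by field_simp
    rw [e1]
    refine mul_le_mul_of_nonneg_left ?_ hm.le
    rw [← sub_nonneg]
    have : ‖x‖ ^ 2 / (2 * B q₀) + r ^ 2 * B q₀ / 2 - r * ‖x‖
        = (‖x‖ - r * B q₀) ^ 2 / (2 * B q₀) := by
      field_simp
      ring
    rw [this]
    positivity
  | cons p l ih =>
    obtain ⟨hh, hBB, hm1, hmβ', hl⟩ := hl
    obtain ⟨m₁, hm₁⟩ : ∃ m₁, m₁ = (B p.2 - B q₀) / (h p.2 - h q₀) := ⟨_, rfl⟩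
    rw [← hm₁] at hm1 hmβ' hl
    have hm₁0 : 0 < m₁ := hm.trans_le hm1
    have hBp : 0 < B p.2 := hB.trans hBB
    obtain ⟨s, hs⟩ : ∃ s, s = √(h p.2 - h q₀) := ⟨_, rfl⟩
    have hs2 : s ^ 2 = h p.2 - h q₀ := by rw [hs, Real.sq_sqrt (by linarith)]
    obtain ⟨κ, hκ⟩ : ∃ κ, κ = treeKappa h B r (Fintype.card ι) p.2 l := ⟨_, rfl⟩
    obtain ⟨μ, hμ⟩ : ∃ μ, μ = (stdGaussian (EuclideanSpace ℝ ι)).prod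
      (treeMeasure (EuclideanSpace ℝ ι) l) := ⟨_, rfl⟩
    have hμp : IsProbabilityMeasure μ := by rw [hμ]; infer_instance
    have hmZ : Measurable (fun y : EuclideanSpace ℝ ι × TreeG (EuclideanSpace ℝ ι) l =>
        treeZ h (β * r) p.2 l (x + s • y.1) y.2 ^ (m₁ / β)) := by
      have h1 : Measurable (fun y : EuclideanSpace ℝ ι × TreeG (EuclideanSpace ℝ ι) l =>
          (x + s • y.1, y.2)) :=
        ((measurable_fst.const_smul s).const_add x).prodMk measurable_snd
      exact ((measurable_treeZ h (β * r) p.2 l).comp h1).pow_const _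
    have hD : (B q₀ / B p.2) = 1 - 2 * (m₁ / (2 * B p.2)) * s ^ 2 := by
      have : h p.2 - h q₀ ≠ 0 := by linarith
      rw [hs2, hm₁]
      field_simp
      ring
    have hone : ∫⁻ y, treeZ h (β * r) p.2 l (x + s • y.1) y.2 ^ (m₁ / β) ∂μ
        ≤ ENNReal.ofReal (Real.exp (m₁ * κ + (m₁ * (‖x‖ ^ 2 / (2 * B q₀))
          + Fintype.card ι / 2 * Real.log (B p.2 / B q₀)))) := by
      rw [hμ, lintegral_prod _ hmZ.aemeasurable]
      calc _ ≤ ∫⁻ g : EuclideanSpace ℝ ι, ENNReal.ofReal (Real.exp (m₁ * κ)) *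
            ENNReal.ofReal (Real.exp (m₁ / (2 * B p.2) * ‖x + s • g‖ ^ 2))
              ∂(stdGaussian _) := by
            refine lintegral_mono fun g => (ih hm₁0 hmβ' hBp hl (x + s • g)).trans (le_of_eq ?_)
            rw [← ENNReal.ofReal_mul (Real.exp_pos _).le, ← Real.exp_add, ← hκ]
            congr 2
            field_simp
            ring
        _ = _ := by
            rw [lintegral_const_mul _ (by fun_prop),
              lintegral_exp_sq_stdGaussian (by positivity) hD,
              ← ENNReal.ofReal_mul (Real.exp_pos _).le, ← Real.exp_add]
            congr 3
            rw [← inv_div (B p.2), Real.log_inv]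
            field_simp
            ring
    have hmid : ∫⁻ g, treeZ h (β * r) q₀ (p :: l) x g ^ (m₁ / β) ∂(treeMeasure _ (p :: l))
        ≤ ENNReal.ofReal (Real.exp (m₁ * (‖x‖ ^ 2 / (2 * B q₀)
        + treeKappa h B r (Fintype.card ι) q₀ (p :: l)))) := by
      calc ∫⁻ g, treeZ h (β * r) q₀ (p :: l) x g ^ (m₁ / β) ∂(treeMeasure _ (p :: l))
          ≤ ∫⁻ g : Fin (p.1 + 1) → EuclideanSpace ℝ ι × TreeG (EuclideanSpace ℝ ι) l,
            ∑ i, treeZ h (β * r) p.2 l (x + s • (g i).1) (g i).2 ^ (m₁ / β)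
              ∂(Measure.pi fun _ => μ) := by
            rw [hμ]
            refine lintegral_mono fun g => ?_
            rw [hs]
            refine (ENNReal.rpow_le_rpow (treeZ_cons h (β * r) q₀ p l x g).le
              (by positivity)).trans ?_
            exact rpow_sum_le_sum_rpow _ _ (by positivity) ((div_le_one hβ).2 hmβ')
        _ = ∑ _i : Fin (p.1 + 1), ∫⁻ y, treeZ h (β * r) p.2 l (x + s • y.1) y.2 ^ (m₁ / β) ∂μ := by
            refine (lintegral_finsetSum _ fun i _ => hmZ.comp (measurable_pi_apply i)).trans ?_
            refine Finset.sum_congr rfl fun i _ => ?_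
            have hmp := measurePreserving_eval (fun _ : Fin (p.1 + 1) => μ) i
            exact hmp.lintegral_comp hmZ
        _ ≤ ∑ _i : Fin (p.1 + 1), ENNReal.ofReal (Real.exp (m₁ * κ + (m₁ * (‖x‖ ^ 2 / (2 * B q₀))
          + Fintype.card ι / 2 * Real.log (B p.2 / B q₀)))) := Finset.sum_le_sum fun i _ => hone
        _ = _ := by
            rw [Finset.sum_const, Finset.card_univ, Fintype.card_fin, nsmul_eq_mul,
              ← ENNReal.ofReal_natCast, ← ENNReal.ofReal_mul (by positivity)]
            have hp1 : (0 : ℝ) < ((p.1 + 1 : ℕ) : ℝ) := by positivity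
            conv_lhs => rw [← Real.exp_log hp1]
            rw [← Real.exp_add]
            congr 2
            have e1 : treeKappa h B r (Fintype.card ι) q₀ (p :: l)
                = κ + m₁⁻¹ * (Real.log (p.1 + 1)
                  + Fintype.card ι / 2 * Real.log (B p.2 / B q₀)) := by
              rw [hκ, hm₁, inv_div]
              simp only [treeKappa, treeSum, lastLevel]
              ring
            rw [e1]
            push_cast
            field_simp
            ring
    have hZm := measurable_treeZ_right h (β * r) q₀ (p :: l) x
    calc ∫⁻ g, treeZ h (β * r) q₀ (p :: l) x g ^ (m / β) ∂(treeMeasure _ (p :: l))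
        = ∫⁻ g, (treeZ h (β * r) q₀ (p :: l) x g ^ (m₁ / β)) ^ (m / m₁)
            ∂(treeMeasure _ (p :: l)) := by
          refine lintegral_congr fun g => ?_
          rw [← ENNReal.rpow_mul]
          congr 1
          field_simp
      _ ≤ (∫⁻ g, treeZ h (β * r) q₀ (p :: l) x g ^ (m₁ / β) ∂(treeMeasure _ (p :: l)))
            ^ (m / m₁) :=
          lintegral_rpow_le_rpow_lintegral (hZm.pow_const _).aemeasurable (by positivity)
            ((div_le_one hm₁0).2 hm1)
      _ ≤ _ := ENNReal.rpow_le_rpow hmid (by positivity)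
      _ = _ := by
          rw [ENNReal.ofReal_rpow_of_pos (Real.exp_pos _), ← Real.exp_mul]
          congr 2
          field_simp

/-- Upper bound for the expected log-partition function of the tree of norms. -/
lemma integral_LSE_norm_treeField_le {h B : ℝ → ℝ} {β r : ℝ} (hβ : 0 < β) {m : ℝ} (hm : 0 < m)
    (hmβ : m ≤ β) {q₀ : ℝ} {l : List (ℕ × ℝ)} (hB : 0 < B q₀) (hl : TreeSlope h B β m q₀ l) :
    ∫ g : TreeG (EuclideanSpace ℝ ι) l, LSE (fun α => β * r * ‖treeField h q₀ l g α‖)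
      ∂(treeMeasure _ l) ≤ β * treeKappa h B r (Fintype.card ι) q₀ l := by
  obtain ⟨κ, hκ⟩ : ∃ κ, κ = treeKappa h B r (Fintype.card ι) q₀ l := ⟨_, rfl⟩
  obtain ⟨L, hL⟩ : ∃ L : TreeG (EuclideanSpace ℝ ι) l → ℝ,
    L = fun g => LSE (fun α => β * r * ‖treeField h q₀ l g α‖) := ⟨_, rfl⟩
  have hLi : Integrable L (treeMeasure _ l) := by
    rw [hL]
    exact integrable_LSE_of_integrable fun α => (integrable_treeField h q₀ l α).norm.const_mul _
  have hbound := lintegral_treeZ_rpow_le (r := r) hβ hm hmβ hB hl (0 : EuclideanSpace ℝ ι)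
  rw [← hκ] at hbound
  have hZ : ∀ g, treeZ h (β * r) q₀ l (0 : EuclideanSpace ℝ ι) g ^ (m / β)
      = ENNReal.ofReal (Real.exp (m / β * L g)) := by
    intro g
    rw [treeZ, ← ENNReal.ofReal_sum_of_nonneg fun _ _ => (Real.exp_pos _).le]
    simp only [zero_add]
    rw [← exp_LSE, ENNReal.ofReal_rpow_of_pos (Real.exp_pos _), ← Real.exp_mul, mul_comm (m / β),
      hL]
  simp_rw [hZ] at hbound
  have hei : Integrable (fun g => Real.exp (m / β * L g)) (treeMeasure _ l) := by
    refine ⟨(Real.continuous_exp.comp_aestronglyMeasurable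
      (hLi.aestronglyMeasurable.const_mul _)), ?_⟩
    rw [hasFiniteIntegral_iff_ofReal (ae_of_all _ fun g => (Real.exp_pos _).le)]
    exact hbound.trans_lt ENNReal.ofReal_lt_top
  have hexp : ∫ g, Real.exp (m / β * L g) ∂(treeMeasure _ l) ≤ Real.exp (m * κ) := by
    rw [integral_eq_lintegral_of_nonneg_ae (ae_of_all _ fun g => (Real.exp_pos _).le)
      hei.aestronglyMeasurable]
    refine ENNReal.toReal_le_of_le_ofReal (Real.exp_pos _).le (hbound.trans (le_of_eq ?_))
    simp
  have hpt : ∀ g, m / β * L g ≤ Real.exp (-(m * κ)) * Real.exp (m / β * L g) + (m * κ - 1) := by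
    intro g
    rw [← Real.exp_add]
    linarith [Real.add_one_le_exp (-(m * κ) + m / β * L g)]
  have hi := integral_mono (hLi.const_mul _) ((hei.const_mul _).add (integrable_const _)) hpt
  have e2 : ∫ g, (Real.exp (-(m * κ)) * Real.exp (m / β * L g) + (m * κ - 1)) ∂(treeMeasure _ l)
      = Real.exp (-(m * κ)) * ∫ g, Real.exp (m / β * L g) ∂(treeMeasure _ l) + (m * κ - 1) := by
    rw [integral_add (hei.const_mul _) (integrable_const _), integral_const_mul]
    simp
  have h3 : Real.exp (-(m * κ)) * ∫ g, Real.exp (m / β * L g) ∂(treeMeasure _ l) ≤ 1 := by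
    calc _ ≤ Real.exp (-(m * κ)) * Real.exp (m * κ) := by gcongr
      _ = 1 := by rw [← Real.exp_add]; simp
  have h4 : m / β * ∫ g, L g ∂(treeMeasure _ l) ≤ m * κ := by
    rw [← integral_const_mul]
    refine hi.trans (e2.le.trans ?_)
    linarith
  rw [← hκ, ← hL]
  have h5 : ∫ g, L g ∂(treeMeasure _ l) = (β / m) * (m / β * ∫ g, L g ∂(treeMeasure _ l)) := by
    field_simp
  rw [h5]
  calc _ ≤ β / m * (m * κ) := by gcongr
    _ = β * κ := by field_simp

end TreeUpper

section Features

variable {N P : ℕ} {c : ℕ → ℝ}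

/-- The feature vector of a configuration, which represents the Hamiltonian as a linear form. -/
def featV (N P : ℕ) (c : ℕ → ℝ) (σ : Fin N → ℝ) : EuclideanSpace ℝ (GIdx N P) :=
  WithLp.toLp 2 fun i =>
    c (i.1 : ℕ) * (N : ℝ) ^ (-((((i.1 : ℕ) : ℝ) - 1) / 2)) * ∏ t, σ (i.2 t)

lemma sum_GIdx (f : (k : ℕ) → (Fin k → Fin N) → ℝ) :
    ∑ i : GIdx N P, f i.1 i.2 = ∑ k ∈ Finset.Icc 2 P, ∑ j : Fin k → Fin N, f k j := by
  rw [Fintype.sum_sigma]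
  exact Finset.sum_coe_sort (Finset.Icc 2 P) fun k => ∑ j : Fin k → Fin N, f k j

lemma hamiltonian_eq_inner (g : (k : ℕ) → (Fin k → Fin N) → ℝ) (σ : Fin N → ℝ) :
    hamiltonian N P c g σ = ⟪featV N P c σ, WithLp.toLp 2 (flatten N P g)⟫ := by
  have h : ⟪featV N P c σ, WithLp.toLp 2 (flatten N P g)⟫
      = ∑ i : GIdx N P, g i.1 i.2 * (c (i.1 : ℕ) * (N : ℝ) ^ (-((((i.1 : ℕ) : ℝ) - 1) / 2))
        * ∏ t, σ (i.2 t)) := by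
    simp only [featV, flatten, PiLp.inner_apply, RCLike.inner_apply, conj_trivial]
  rw [h, sum_GIdx fun k j => g k j * (c k * (N : ℝ) ^ (-(((k : ℝ) - 1) / 2)) * ∏ t, σ (j t)),
    hamiltonian]
  refine Finset.sum_congr rfl fun k _ => ?_
  rw [Finset.mul_sum]
  exact Finset.sum_congr rfl fun j _ => by ring

lemma inner_featV (hN : 1 ≤ N) (σ τ : Fin N → ℝ) :
    ⟪featV N P c σ, featV N P c τ⟫ = N * xiFun P c (ovl σ τ) := by
  have hN0 : (0 : ℝ) < N := by positivity
  have h : ⟪featV N P c σ, featV N P c τ⟫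
      = ∑ i : GIdx N P, (c (i.1 : ℕ) * (N : ℝ) ^ (-((((i.1 : ℕ) : ℝ) - 1) / 2))) ^ 2
        * ((∏ t, σ (i.2 t)) * ∏ t, τ (i.2 t)) := by
    simp only [featV, PiLp.inner_apply, RCLike.inner_apply, conj_trivial]
    exact Finset.sum_congr rfl fun j _ => by ring
  rw [h, sum_GIdx fun k j => (c k * (N : ℝ) ^ (-(((k : ℝ) - 1) / 2))) ^ 2
    * ((∏ t, σ (j t)) * ∏ t, τ (j t)), xiFun, Finset.mul_sum]
  refine Finset.sum_congr rfl fun k hk => ?_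
  rw [← Finset.mul_sum]
  have h1 := inner_tpow k σ τ
  simp only [tpow, PiLp.inner_apply, RCLike.inner_apply, conj_trivial] at h1
  have h2 : ∑ j : Fin k → Fin N, (∏ t, σ (j t)) * ∏ t, τ (j t) = (∑ i, σ i * τ i) ^ k := by
    rw [← h1]
    exact Finset.sum_congr rfl fun j _ => by ring
  rw [h2, mul_pow, ovl, dotp, div_pow]
  have h3 : ((N : ℝ) ^ (-(((k : ℝ) - 1) / 2))) ^ 2 = N / (N : ℝ) ^ k := by
    rw [← Real.rpow_natCast, ← Real.rpow_mul hN0.le]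
    have : -(((k : ℝ) - 1) / 2) * ((2 : ℕ) : ℝ) = 1 - k := by push_cast; ring
    rw [this, Real.rpow_sub hN0, Real.rpow_one, Real.rpow_natCast]
  rw [h3]
  ring

lemma xiD1_one_nonneg (P : ℕ) (c : ℕ → ℝ) : 0 ≤ xiD1 P c 1 :=
  Finset.sum_nonneg fun k _ => by positivity

lemma norm_featV (hN : 1 ≤ N) {σ : Fin N → ℝ} (hσ : σ ∈ sphereSet N) :
    ‖featV N P c σ‖ = √(N * xiFun P c 1) := by
  rw [norm_eq_sqrt_real_inner, inner_featV hN, ovl_self hN hσ]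

lemma xiFun_one_sub_le {R : ℝ} (hR : |R| ≤ 1) : xiFun P c 1 - xiFun P c R ≤ xiD1 P c 1 * (1 - R) := by
  rw [xiFun, xiFun, xiD1, ← Finset.sum_sub_distrib, Finset.sum_mul]
  refine Finset.sum_le_sum fun k _ => ?_
  have h := one_add_mul_le_pow (a := R - 1) (by linarith [(abs_le.1 hR).1]) k
  rw [add_sub_cancel] at h
  have := mul_le_mul_of_nonneg_left h (sq_nonneg (c k))
  simp only [one_pow, mul_one]
  linarith

lemma sum_sub_sq (hN : 1 ≤ N) {σ τ : Fin N → ℝ} (hσ : σ ∈ sphereSet N) (hτ : τ ∈ sphereSet N) :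
    ∑ i, (σ i - τ i) ^ 2 = 2 * N * (1 - ovl σ τ) := by
  have h1 : ∑ i, (σ i) ^ 2 = (N : ℝ) := hσ
  have h2 : ∑ i, (τ i) ^ 2 = (N : ℝ) := hτ
  have hN0 : (N : ℝ) ≠ 0 := by positivity
  have e : ∑ i, (σ i - τ i) ^ 2 = ∑ i, σ i ^ 2 + ∑ i, τ i ^ 2 - 2 * dotp σ τ := by
    unfold dotp
    rw [Finset.mul_sum, ← Finset.sum_add_distrib, ← Finset.sum_sub_distrib]
    exact Finset.sum_congr rfl fun i _ => by ring
  rw [e, h1, h2, ovl]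
  field_simp
  ring

lemma norm_featV_sub_sq_le (hN : 1 ≤ N) {σ τ : Fin N → ℝ} (hσ : σ ∈ sphereSet N)
    (hτ : τ ∈ sphereSet N) :
    ‖featV N P c σ - featV N P c τ‖ ^ 2 ≤ xiD1 P c 1 * ∑ i, (σ i - τ i) ^ 2 := by
  rw [norm_sub_sq_real, ← real_inner_self_eq_norm_sq, ← real_inner_self_eq_norm_sq, inner_featV hN,
    inner_featV hN, inner_featV hN, ovl_self hN hσ, ovl_self hN hτ, sum_sub_sq hN hσ hτ]
  have := mul_le_mul_of_nonneg_left (xiFun_one_sub_le (P := P) (c := c) (abs_ovl_le hN hσ hτ))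
    (Nat.cast_nonneg (α := ℝ) N)
  linarith

/-- The maximum of the linear forms of all configurations on the sphere. -/
def psi (N P : ℕ) (c : ℕ → ℝ) (x : EuclideanSpace ℝ (GIdx N P)) : ℝ :=
  ⨆ σ : sphereSet N, ⟪featV N P c σ.1, x⟫

lemma maxH_eq_psi (g : (k : ℕ) → (Fin k → Fin N) → ℝ) :
    maxH N P c g = psi N P c (WithLp.toLp 2 (flatten N P g)) := by
  simp only [maxH, psi, hamiltonian_eq_inner]

instance instNonemptySphereSet : Nonempty (sphereSet N) :=
  ⟨⟨fun _ => 1, by simp [sphereSet]⟩⟩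

lemma inner_featV_le (hN : 1 ≤ N) {σ : Fin N → ℝ} (hσ : σ ∈ sphereSet N)
    (x : EuclideanSpace ℝ (GIdx N P)) : ⟪featV N P c σ, x⟫ ≤ √(N * xiFun P c 1) * ‖x‖ := by
  rw [← norm_featV (c := c) hN hσ]
  exact real_inner_le_norm _ _

lemma le_psi (hN : 1 ≤ N) {σ : Fin N → ℝ} (hσ : σ ∈ sphereSet N)
    (x : EuclideanSpace ℝ (GIdx N P)) : ⟪featV N P c σ, x⟫ ≤ psi N P c x :=
  le_ciSup (f := fun σ : sphereSet N => ⟪featV N P c σ.1, x⟫)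
    ⟨√(N * xiFun P c 1) * ‖x‖, by rintro _ ⟨τ, rfl⟩; exact inner_featV_le hN τ.2 x⟩ ⟨σ, hσ⟩

lemma psi_le {x : EuclideanSpace ℝ (GIdx N P)} {b : ℝ}
    (h : ∀ σ ∈ sphereSet N, ⟪featV N P c σ, x⟫ ≤ b) : psi N P c x ≤ b :=
  ciSup_le fun σ => h σ.1 σ.2

lemma psi_le_add (hN : 1 ≤ N) (x y : EuclideanSpace ℝ (GIdx N P)) :
    psi N P c x ≤ psi N P c y + √(N * xiFun P c 1) * ‖x - y‖ := by
  refine psi_le fun σ hσ => ?_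
  have h1 := le_psi (c := c) hN hσ y
  have h2 := inner_featV_le (c := c) hN hσ (x - y)
  rw [inner_sub_right] at h2
  linarith

lemma lipschitzWith_psi (hN : 1 ≤ N) :
    LipschitzWith (Real.toNNReal √(N * xiFun P c 1)) (psi N P c) := by
  refine LipschitzWith.of_dist_le_mul fun x y => ?_
  rw [Real.coe_toNNReal _ (Real.sqrt_nonneg _), Real.dist_eq, dist_eq_norm, abs_le]
  have h1 := psi_le_add (c := c) hN x y
  have h2 := psi_le_add (c := c) hN y x
  rw [norm_sub_rev] at h2
  constructor <;> linarith

lemma continuous_psi (hN : 1 ≤ N) : Continuous (psi N P c) := (lipschitzWith_psi hN).continuous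

lemma abs_psi_le (hN : 1 ≤ N) (x : EuclideanSpace ℝ (GIdx N P)) :
    |psi N P c x| ≤ √(N * xiFun P c 1) * ‖x‖ := by
  have h0 : psi N P c (0 : EuclideanSpace ℝ (GIdx N P)) = 0 := by
    simp [psi]
  have h := (lipschitzWith_psi (P := P) (c := c) hN).dist_le_mul x 0
  rwa [Real.coe_toNNReal _ (Real.sqrt_nonneg _), h0, Real.dist_eq, sub_zero,
    dist_zero_right] at h

lemma integrable_psi (hN : 1 ≤ N) : Integrable (psi N P c) (stdGaussian _) :=
  (integrable_norm_stdGaussian.const_mul √(N * xiFun P c 1)).mono'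
    (continuous_psi hN).aestronglyMeasurable (ae_of_all _ (abs_psi_le hN))

lemma integral_maxH {Ω : Type*} [MeasureSpace Ω] [IsProbabilityMeasure (ℙ : Measure Ω)]
    (hN : 1 ≤ N) {G : Ω → (k : ℕ) → (Fin k → Fin N) → ℝ} (hG : StdGaussianCouplings N P G) :
    ∫ ω, maxH N P c (G ω) ∂ℙ = ∫ x, psi N P c x ∂(stdGaussian _) := by
  have hG' : Measure.map (fun ω => flatten N P (G ω)) ℙ
    = Measure.pi fun _ : GIdx N P => gaussianReal 0 1 := hG
  have hae : AEMeasurable (fun ω => flatten N P (G ω)) (ℙ : Measure Ω) := by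
    by_contra hcon
    rw [Measure.map_of_not_aemeasurable hcon] at hG'
    exact IsProbabilityMeasure.ne_zero (Measure.pi fun _ : GIdx N P => gaussianReal 0 1) hG'.symm
  have hc : Continuous (fun x : GIdx N P → ℝ => psi N P c (WithLp.toLp 2 x)) :=
    (continuous_psi hN).comp (by fun_prop)
  simp_rw [maxH_eq_psi]
  rw [← map_pi_eq_stdGaussian, integral_map (by fun_prop) (continuous_psi hN).aestronglyMeasurable,
    ← hG', integral_map hae hc.aestronglyMeasurable]

lemma integral_norm_stdGaussian_le {ι : Type*} [Fintype ι] :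
    ∫ g, ‖g‖ ∂(stdGaussian (EuclideanSpace ℝ ι)) ≤ 1 + Fintype.card ι := by
  classical
  have hc : ∀ (i : ι) (g : EuclideanSpace ℝ ι), ⟪EuclideanSpace.single i (1 : ℝ), g⟫ = g i := by
    intro i g
    simp [EuclideanSpace.inner_single_left]
  have hi : ∀ i : ι, Integrable (fun g : EuclideanSpace ℝ ι => (g i) ^ 2) (stdGaussian _) := by
    intro i
    have := integrable_inner_sq (EuclideanSpace.single i (1 : ℝ))
    simpa only [hc] using this
  have hv : ∀ i : ι, ∫ g : EuclideanSpace ℝ ι, (g i) ^ 2 ∂(stdGaussian _) = 1 := by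
    intro i
    have := integral_inner_sq (EuclideanSpace.single i (1 : ℝ))
    simpa [hc] using this
  have hs : Integrable (fun g : EuclideanSpace ℝ ι => ∑ i, (g i) ^ 2) (stdGaussian _) :=
    integrable_finsetSum _ fun i _ => hi i
  calc ∫ g, ‖g‖ ∂(stdGaussian (EuclideanSpace ℝ ι))
      ≤ ∫ g : EuclideanSpace ℝ ι, (1 + ∑ i, (g i) ^ 2) ∂(stdGaussian _) := by
        refine integral_mono integrable_norm_stdGaussian ((integrable_const 1).add hs) fun g => ?_
        have h := EuclideanSpace.norm_sq_eq g
        simp only [Real.norm_eq_abs, sq_abs] at h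
        change ‖g‖ ≤ 1 + ∑ i, (g i) ^ 2
        rw [← h]
        nlinarith [sq_nonneg (‖g‖ - 1)]
    _ = 1 + Fintype.card ι := by
        rw [integral_add (integrable_const 1) hs, integral_finsetSum _ fun i _ => hi i]
        simp [hv]

lemma card_GIdx_le (hN : 1 ≤ N) : Fintype.card (GIdx N P) ≤ P * N ^ P := by
  have h1 : Fintype.card (GIdx N P) = ∑ k ∈ Finset.Icc 2 P, N ^ k := by
    rw [Fintype.card_sigma, ← Finset.sum_coe_sort (Finset.Icc 2 P)]
    simp
  rw [h1]
  calc ∑ k ∈ Finset.Icc 2 P, N ^ k ≤ ∑ _k ∈ Finset.Icc 2 P, N ^ P :=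
        Finset.sum_le_sum fun k hk => Nat.pow_le_pow_right hN (Finset.mem_Icc.1 hk).2
    _ = (P + 1 - 2) * N ^ P := by simp
    _ ≤ P * N ^ P := Nat.mul_le_mul_right _ (by omega)

/-- A polynomially fine net of the sphere. -/
lemma exists_net (hN : 1 ≤ N) (m : ℕ) : ∃ (n : ℕ) (a : Fin (n + 1) → Fin N → ℝ),
    (∀ u, a u ∈ sphereSet N) ∧ n + 1 ≤ (3 * N ^ (m + 1)) ^ N ∧
    ∀ σ ∈ sphereSet N, ∃ u, ∑ i, (σ i - a u i) ^ 2 ≤ N * ((N : ℝ) ^ m)⁻¹ ^ 2 := by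
  classical
  have hN1 : (1 : ℝ) ≤ N := by exact_mod_cast hN
  obtain ⟨M, hM⟩ : ∃ M : ℕ, M = N ^ (m + 1) := ⟨_, rfl⟩
  have hM1 : 1 ≤ M := by rw [hM]; exact Nat.one_le_pow _ _ hN
  have hmem : ∀ σ ∈ sphereSet N, ∀ i, ⌊σ i * (N : ℝ) ^ m⌋ ∈ Set.Icc (-(M : ℤ)) M := by
    intro σ hσ i
    have h1 : ∑ i, (σ i) ^ 2 = (N : ℝ) := hσ
    have h2 : (σ i) ^ 2 ≤ N := by
      rw [← h1]
      exact Finset.single_le_sum (f := fun i => (σ i) ^ 2) (fun _ _ => sq_nonneg _)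
        (Finset.mem_univ i)
    have h3 : |σ i| ≤ N := abs_le_of_sq_le_sq (by nlinarith) (by positivity)
    have h4 : |σ i * (N : ℝ) ^ m| ≤ M := by
      rw [abs_mul, abs_of_nonneg (by positivity : (0 : ℝ) ≤ (N : ℝ) ^ m), hM]
      push_cast
      rw [pow_succ']
      gcongr
    rw [abs_le] at h4
    constructor
    · rw [Int.le_floor]
      push_cast
      exact h4.1
    · have := (Int.floor_le (σ i * (N : ℝ) ^ m)).trans h4.2
      exact_mod_cast this
  obtain ⟨F, hF⟩ : ∃ F : sphereSet N → (Fin N → Set.Icc (-(M : ℤ)) M),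
    F = fun σ i => ⟨⌊σ.1 i * (N : ℝ) ^ m⌋, hmem σ.1 σ.2 i⟩ := ⟨_, rfl⟩
  obtain ⟨n, hn⟩ : ∃ n, Fintype.card (Set.range F) = n + 1 :=
    Nat.exists_eq_succ_of_ne_zero Fintype.card_ne_zero
  obtain ⟨e⟩ : Nonempty (Set.range F ≃ Fin (n + 1)) :=
    ⟨Fintype.equivFinOfCardEq hn⟩
  choose s hs using fun y : Set.range F => y.2
  refine ⟨n, fun u => (s (e.symm u)).1, fun u => (s (e.symm u)).2, ?_, fun σ hσ => ?_⟩
  · rw [← hn, ← hM]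
    calc Fintype.card (Set.range F) ≤ Fintype.card (Fin N → Set.Icc (-(M : ℤ)) M) :=
          Fintype.card_subtype_le _
      _ = (2 * M + 1) ^ N := by
          rw [Fintype.card_fun, Fintype.card_fin, ← Set.toFinset_card, Set.toFinset_Icc, Int.card_Icc]
          congr 1
          omega
      _ ≤ (3 * M) ^ N := Nat.pow_le_pow_left (by omega) N
  · refine ⟨e ⟨F ⟨σ, hσ⟩, ⟨_, rfl⟩⟩, ?_⟩
    simp only [Equiv.symm_apply_apply]
    obtain ⟨τ, hτ⟩ : ∃ τ, τ = s ⟨F ⟨σ, hσ⟩, ⟨_, rfl⟩⟩ := ⟨_, rfl⟩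
    have h1 := hs ⟨F ⟨σ, hσ⟩, ⟨_, rfl⟩⟩
    rw [← hτ] at h1 ⊢
    have h2 : ∀ i, ⌊τ.1 i * (N : ℝ) ^ m⌋ = ⌊σ i * (N : ℝ) ^ m⌋ := by
      intro i
      have := congrArg Subtype.val (congrFun h1 i)
      simpa only [hF] using this
    have h3 : ∀ i, (σ i - τ.1 i) ^ 2 ≤ ((N : ℝ) ^ m)⁻¹ ^ 2 := by
      intro i
      have hp : (0 : ℝ) < (N : ℝ) ^ m := by positivity
      have h5 := Int.abs_sub_lt_one_of_floor_eq_floor (h2 i)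
      rw [← sub_mul, abs_mul, abs_of_pos hp] at h5
      have h6 : |τ.1 i - σ i| ≤ ((N : ℝ) ^ m)⁻¹ := by
        rw [← one_div, le_div_iff₀ hp]
        exact h5.le
      rw [abs_sub_comm] at h6
      rw [← sq_abs]
      gcongr
    calc ∑ i, (σ i - τ.1 i) ^ 2 ≤ ∑ _i : Fin N, ((N : ℝ) ^ m)⁻¹ ^ 2 :=
          Finset.sum_le_sum fun i _ => h3 i
      _ = _ := by simp

/-- Comparison of the maximum over the sphere with a free energy on a finite net. -/
lemma integral_psi_le_freeE (hN : 1 ≤ N) {β : ℝ} (hβ : 0 < β) :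
    ∃ (n : ℕ) (a : Fin (n + 1) → Fin N → ℝ), (∀ u, a u ∈ sphereSet N) ∧
      n + 1 ≤ (3 * N ^ (P + 1)) ^ N ∧
      ∫ x, psi N P c x ∂(stdGaussian _)
        ≤ β⁻¹ * freeE 0 (fun u => β • featV N P c (a u)) + √(xiD1 P c 1) * (1 + P) * √N := by
  obtain ⟨n, a, ha, hn, hnet⟩ := exists_net hN P
  refine ⟨n, a, ha, hn, ?_⟩
  have hN1 : (1 : ℝ) ≤ N := by exact_mod_cast hN
  obtain ⟨δ, hδ⟩ : ∃ δ, δ = √(xiD1 P c 1) * (√N * ((N : ℝ) ^ P)⁻¹) := ⟨_, rfl⟩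
  have hpt : ∀ x, psi N P c x ≤ β⁻¹ * LSE (field 0 (fun u => β • featV N P c (a u)) x)
      + δ * ‖x‖ := by
    intro x
    refine psi_le fun σ hσ => ?_
    obtain ⟨u, hu⟩ := hnet σ hσ
    have h1 := le_LSE (field 0 (fun u => β • featV N P c (a u)) x) u
    simp only [field, Pi.zero_apply, zero_add, real_inner_smul_left] at h1
    have h2 : ⟪featV N P c (a u), x⟫ ≤ β⁻¹ * LSE (field 0 (fun u => β • featV N P c (a u)) x) := by
      rw [← div_eq_inv_mul, le_div_iff₀ hβ, mul_comm]
      simpa only [field, Pi.zero_apply, zero_add, real_inner_smul_left] using h1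
    have h3 : ‖featV N P c σ - featV N P c (a u)‖ ≤ δ := by
      refine abs_le_of_sq_le_sq' ?_ (by rw [hδ]; positivity) |>.2
      refine (norm_featV_sub_sq_le hN hσ (ha u)).trans ?_
      rw [hδ, mul_pow, Real.sq_sqrt (xiD1_one_nonneg P c), mul_pow,
        Real.sq_sqrt (Nat.cast_nonneg N)]
      exact mul_le_mul_of_nonneg_left hu (xiD1_one_nonneg P c)
    have h4 := real_inner_le_norm (featV N P c σ - featV N P c (a u)) x
    rw [inner_sub_left] at h4
    have h5 := mul_le_mul_of_nonneg_right h3 (norm_nonneg x)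
    linarith
  have hL := (integrable_LSE_field 0 (fun u => β • featV N P c (a u))).const_mul β⁻¹
  have hn' := (integrable_norm_stdGaussian (E := EuclideanSpace ℝ (GIdx N P))).const_mul δ
  have hm := integral_mono (integrable_psi hN) (hL.add hn') hpt
  have e : ∫ x, (β⁻¹ * LSE (field 0 (fun u => β • featV N P c (a u)) x) + δ * ‖x‖)
      ∂(stdGaussian (EuclideanSpace ℝ (GIdx N P)))
      = β⁻¹ * freeE 0 (fun u => β • featV N P c (a u)) + δ * ∫ x, ‖x‖ ∂(stdGaussian (EuclideanSpace ℝ (GIdx N P))) := by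
    rw [integral_add hL hn', integral_const_mul, integral_const_mul, freeE]
  refine hm.trans (e.le.trans (add_le_add le_rfl ?_))
  have hδ0 : 0 ≤ δ := by rw [hδ]; positivity
  have hcard : (Fintype.card (GIdx N P) : ℝ) ≤ P * (N : ℝ) ^ P := by
    exact_mod_cast card_GIdx_le hN
  have hNP : (1 : ℝ) ≤ (N : ℝ) ^ P := one_le_pow₀ hN1
  calc δ * ∫ x, ‖x‖ ∂(stdGaussian (EuclideanSpace ℝ (GIdx N P))) ≤ δ * ((N : ℝ) ^ P * (1 + P)) := by
        refine mul_le_mul_of_nonneg_left (integral_norm_stdGaussian_le.trans ?_) hδ0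
        linarith
    _ = √(xiD1 P c 1) * (1 + P) * √N := by
        rw [hδ]
        field_simp

end Features

section Mixture

variable {P : ℕ} {c : ℕ → ℝ}

lemma hasDerivAt_xiFun (x : ℝ) : HasDerivAt (xiFun P c) (xiD1 P c x) x := by
  unfold xiFun xiD1
  refine (HasDerivAt.fun_sum fun k _ => (hasDerivAt_pow k x).const_mul (c k ^ 2)).congr_deriv ?_
  exact Finset.sum_congr rfl fun k _ => by ring

lemma hasDerivAt_xiD1 (x : ℝ) : HasDerivAt (xiD1 P c) (xiD2 P c x) x := by
  unfold xiD1 xiD2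
  refine (HasDerivAt.fun_sum fun k _ =>
    (hasDerivAt_pow (k - 1) x).const_mul ((k : ℝ) * c k ^ 2)).congr_deriv ?_
  refine Finset.sum_congr rfl fun k hk => ?_
  have hk2 := (Finset.mem_Icc.1 hk).1
  rw [Nat.cast_sub (by omega), Nat.sub_sub]
  push_cast
  ring

lemma hasDerivAt_xiD2 (x : ℝ) : HasDerivAt (xiD2 P c) (xiD3 P c x) x := by
  unfold xiD2 xiD3
  refine (HasDerivAt.fun_sum fun k _ =>
    (hasDerivAt_pow (k - 2) x).const_mul ((k : ℝ) * ((k : ℝ) - 1) * c k ^ 2)).congr_deriv ?_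
  refine Finset.sum_congr rfl fun k hk => ?_
  have hk2 := (Finset.mem_Icc.1 hk).1
  rw [Nat.cast_sub hk2, Nat.sub_sub]
  push_cast
  ring

lemma continuous_xiFun : Continuous (xiFun P c) := by unfold xiFun; fun_prop
lemma continuous_xiD1 : Continuous (xiD1 P c) := by unfold xiD1; fun_prop
lemma continuous_xiD2 : Continuous (xiD2 P c) := by unfold xiD2; fun_prop
lemma continuous_xiD3 : Continuous (xiD3 P c) := by unfold xiD3; fun_prop

lemma xiFun_nonneg {x : ℝ} (hx : 0 ≤ x) : 0 ≤ xiFun P c x :=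
  Finset.sum_nonneg fun k _ => by positivity

lemma xiD1_nonneg {x : ℝ} (hx : 0 ≤ x) : 0 ≤ xiD1 P c x :=
  Finset.sum_nonneg fun k _ => by positivity

lemma xiD2_nonneg {x : ℝ} (hx : 0 ≤ x) : 0 ≤ xiD2 P c x :=
  Finset.sum_nonneg fun k hk => by
    have hk2 : (2 : ℝ) ≤ k := by exact_mod_cast (Finset.mem_Icc.1 hk).1
    have : (0 : ℝ) ≤ (k : ℝ) - 1 := by linarith
    positivity

lemma xiD3_nonneg {x : ℝ} (hx : 0 ≤ x) : 0 ≤ xiD3 P c x :=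
  Finset.sum_nonneg fun k hk => by
    have hk2 : (2 : ℝ) ≤ k := by exact_mod_cast (Finset.mem_Icc.1 hk).1
    have : (0 : ℝ) ≤ (k : ℝ) - 1 := by linarith
    have : (0 : ℝ) ≤ (k : ℝ) - 2 := by linarith
    positivity

lemma xiD2_mono {x y : ℝ} (hx : 0 ≤ x) (hxy : x ≤ y) : xiD2 P c x ≤ xiD2 P c y := by
  refine Finset.sum_le_sum fun k hk => ?_
  have hk2 : (2 : ℝ) ≤ k := by exact_mod_cast (Finset.mem_Icc.1 hk).1
  have : (0 : ℝ) ≤ (k : ℝ) - 1 := by linarith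
  gcongr

lemma xiD1_mono {x y : ℝ} (hx : 0 ≤ x) (hxy : x ≤ y) : xiD1 P c x ≤ xiD1 P c y := by
  refine Finset.sum_le_sum fun k hk => ?_
  gcongr

lemma xiFun_zero : xiFun P c 0 = 0 :=
  Finset.sum_eq_zero fun k hk => by
    rw [zero_pow (by have := (Finset.mem_Icc.1 hk).1; omega), mul_zero]

lemma xiD1_zero : xiD1 P c 0 = 0 :=
  Finset.sum_eq_zero fun k hk => by
    rw [zero_pow (by have := (Finset.mem_Icc.1 hk).1; omega), mul_zero]

lemma xiD2_zero (hP : 2 ≤ P) : xiD2 P c 0 = 2 * c 2 ^ 2 := by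
  unfold xiD2
  rw [Finset.sum_eq_single 2]
  · norm_num
  · intro k hk hk2
    have := (Finset.mem_Icc.1 hk).1
    rw [zero_pow (by omega), mul_zero]
  · intro h
    exact absurd (Finset.mem_Icc.2 ⟨le_rfl, hP⟩) h

lemma two_mul_sub_xiFun_le (r : ℝ) (hP : 2 ≤ P) (hr : 0 ≤ r) :
    2 * c 2 ^ 2 * r ^ 2 - xiFun P c r ≤ xiFun P c (-r) := by
  have h2 : 2 ∈ Finset.Icc 2 P := Finset.mem_Icc.2 ⟨le_rfl, hP⟩
  unfold xiFun
  rw [← Finset.add_sum_erase _ _ h2, ← Finset.add_sum_erase _ _ h2]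
  have : -∑ k ∈ (Finset.Icc 2 P).erase 2, c k ^ 2 * r ^ k
      ≤ ∑ k ∈ (Finset.Icc 2 P).erase 2, c k ^ 2 * (-r) ^ k := by
    rw [← Finset.sum_neg_distrib]
    refine Finset.sum_le_sum fun k _ => ?_
    rw [← mul_neg]
    refine mul_le_mul_of_nonneg_left ?_ (sq_nonneg _)
    have := neg_abs_le ((-r) ^ k)
    rwa [abs_pow, abs_neg, abs_of_nonneg hr] at this
  nlinarith

lemma neg_xiFun_one_le {R : ℝ} (hR : |R| ≤ 1) : -xiFun P c 1 ≤ xiFun P c R := by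
  unfold xiFun
  rw [← Finset.sum_neg_distrib]
  refine Finset.sum_le_sum fun k _ => ?_
  rw [← mul_neg]
  refine mul_le_mul_of_nonneg_left ?_ (sq_nonneg _)
  have := neg_abs_le (R ^ k)
  rw [abs_pow] at this
  have h1 := pow_le_one₀ (n := k) (abs_nonneg R) hR
  rw [one_pow]
  linarith

/-- The Legendre-type function `q ξ'(q) - ξ(q)`. -/
def xiTheta (P : ℕ) (c : ℕ → ℝ) (q : ℝ) : ℝ := q * xiD1 P c q - xiFun P c q

lemma xiTheta_zero : xiTheta P c 0 = 0 := by simp [xiTheta, xiFun_zero]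

lemma xiFun_tangent_le {x y : ℝ} (hx : 0 ≤ x) (hy : 0 ≤ y) :
    xiFun P c x + xiD1 P c x * (y - x) ≤ xiFun P c y := by
  have hconv : ConvexOn ℝ (Set.Ici 0) (xiFun P c) := by
    refine MonotoneOn.convexOn_of_deriv (convex_Ici 0) continuous_xiFun.continuousOn
      (fun z _ => (hasDerivAt_xiFun z).differentiableAt.differentiableWithinAt) ?_
    intro a ha b hb hab
    rw [(hasDerivAt_xiFun a).deriv, (hasDerivAt_xiFun b).deriv]
    exact xiD1_mono (interior_subset ha) hab
  rcases lt_trichotomy x y with h | h | h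
  · have := hconv.le_slope_of_hasDerivAt (Set.mem_Ici.2 hx) (Set.mem_Ici.2 hy) h (hasDerivAt_xiFun x)
    rw [slope_def_field, le_div_iff₀ (by linarith)] at this
    linarith
  · simp [h]
  · have := hconv.slope_le_of_hasDerivAt (Set.mem_Ici.2 hy) (Set.mem_Ici.2 hx) h (hasDerivAt_xiFun x)
    rw [slope_def_field, div_le_iff₀ (by linarith)] at this
    linarith

lemma mul_xiD1_sub_le_xiTheta_sub {x y : ℝ} (hx : 0 ≤ x) (hy : 0 ≤ y) :
    x * (xiD1 P c y - xiD1 P c x) ≤ xiTheta P c y - xiTheta P c x := by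
  have := xiFun_tangent_le (P := P) (c := c) hy hx
  unfold xiTheta
  linarith

lemma xiTheta_nonneg {x : ℝ} (hx : 0 ≤ x) : 0 ≤ xiTheta P c x := by
  have := mul_xiD1_sub_le_xiTheta_sub (P := P) (c := c) le_rfl hx
  rw [xiTheta_zero] at this
  linarith

lemma xiD1_sub_mem {x y : ℝ} (hx : 0 ≤ x) (hxy : x ≤ y) :
    xiD2 P c x * (y - x) ≤ xiD1 P c y - xiD1 P c x ∧
      xiD1 P c y - xiD1 P c x ≤ xiD2 P c y * (y - x) := by
  rcases hxy.eq_or_lt with rfl | h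
  · simp
  obtain ⟨z, hz, hz'⟩ := exists_hasDerivAt_eq_slope (xiD1 P c) (xiD2 P c) h
    continuous_xiD1.continuousOn fun z _ => hasDerivAt_xiD1 z
  rw [eq_div_iff (by linarith)] at hz'
  rw [← hz']
  have h1 := xiD2_mono (P := P) (c := c) hx hz.1.le
  have h2 := xiD2_mono (P := P) (c := c) (hx.trans hz.1.le) hz.2.le
  constructor <;> exact mul_le_mul_of_nonneg_right (by assumption) (by linarith)

/-- The square root of `ξ''`. -/
def xiS (P : ℕ) (c : ℕ → ℝ) (t : ℝ) : ℝ := √(xiD2 P c t)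

/-- The order parameter `ξ''' / (2 ξ''^{3/2})`. -/
def xiGam (P : ℕ) (c : ℕ → ℝ) (t : ℝ) : ℝ := xiD3 P c t / (xiD2 P c t) ^ ((3 : ℝ) / 2) / 2

/-- The hypotheses of the no-overlap-gap regime. -/
structure NoGap (P : ℕ) (c : ℕ → ℝ) : Prop where
  two_le : 2 ≤ P
  pos : ∀ t ∈ Set.Ioc (0 : ℝ) 1, 0 < xiD2 P c t
  mono : MonotoneOn (fun t => xiD3 P c t / (xiD2 P c t) ^ ((3 : ℝ) / 2)) (Set.Ioo 0 1)

lemma continuous_xiS : Continuous (xiS P c) := continuous_xiD2.sqrt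

lemma xiS_nonneg (t : ℝ) : 0 ≤ xiS P c t := Real.sqrt_nonneg _

lemma xiS_sq {t : ℝ} (ht : 0 ≤ t) : xiS P c t ^ 2 = xiD2 P c t := Real.sq_sqrt (xiD2_nonneg ht)

lemma xiS_mono {x y : ℝ} (hx : 0 ≤ x) (hxy : x ≤ y) : xiS P c x ≤ xiS P c y :=
  Real.sqrt_le_sqrt (xiD2_mono hx hxy)

lemma rpow_three_halves {y : ℝ} (hy : 0 < y) : y ^ ((3 : ℝ) / 2) = y * √y := by
  rw [Real.sqrt_eq_rpow, ← Real.rpow_one_add' hy.le (by norm_num)]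
  norm_num

lemma hasDerivAt_xiS {t : ℝ} (ht : 0 < xiD2 P c t) :
    HasDerivAt (xiS P c) (xiGam P c t * xiD2 P c t) t := by
  refine ((hasDerivAt_xiD2 t).sqrt ht.ne').congr_deriv ?_
  rw [xiGam, rpow_three_halves ht]
  have := (Real.sqrt_pos.2 ht).ne'
  field_simp

lemma hasDerivAt_inv_xiS {t : ℝ} (ht : 0 < xiD2 P c t) :
    HasDerivAt (fun t => (xiS P c t)⁻¹) (-xiGam P c t) t := by
  have hs : xiS P c t ≠ 0 := (Real.sqrt_pos.2 ht).ne'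
  refine ((hasDerivAt_xiS ht).inv hs).congr_deriv ?_
  rw [xiS, Real.sq_sqrt ht.le]
  field_simp

lemma xiGam_nonneg {t : ℝ} (ht : 0 ≤ t) : 0 ≤ xiGam P c t :=
  div_nonneg (div_nonneg (xiD3_nonneg ht) (Real.rpow_nonneg (xiD2_nonneg ht) _)) zero_le_two

namespace NoGap

lemma xiGam_mono (h : NoGap P c) {x y : ℝ} (hx : x ∈ Set.Ioo (0 : ℝ) 1)
    (hy : y ∈ Set.Ioo (0 : ℝ) 1) (hxy : x ≤ y) :
    xiGam P c x ≤ xiGam P c y :=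
  div_le_div_of_nonneg_right (h.mono hx hy hxy) zero_le_two

end NoGap

end Mixture

section NoGapFacts

variable {P : ℕ} {c : ℕ → ℝ}

lemma nonneg_of_hasDerivAt_nonneg {g g' : ℝ → ℝ} {x : ℝ} (hx : 0 ≤ x) (h0 : 0 ≤ g 0)
    (hg : ∀ t ∈ Set.Icc 0 x, HasDerivAt g (g' t) t) (hg' : ∀ t ∈ Set.Ioo 0 x, 0 ≤ g' t) :
    0 ≤ g x := by
  rcases hx.eq_or_lt with rfl | hx
  · exact h0
  obtain ⟨z, hz, hz'⟩ := exists_hasDerivAt_eq_slope g g' hx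
    (fun t ht => (hg t ht).continuousAt.continuousWithinAt)
    fun t ht => hg t (Set.Ioo_subset_Icc_self ht)
  rw [eq_div_iff (by linarith)] at hz'
  have := mul_nonneg (hg' z hz) (sub_nonneg.2 hx.le)
  linarith

namespace NoGap

lemma inv_xiS_sub (h : NoGap P c) {x y : ℝ} (hx : 0 < x) (hxy : x < y) (hy : y ≤ 1) :
    ∃ z ∈ Set.Ioo x y, (xiS P c x)⁻¹ - (xiS P c y)⁻¹ = xiGam P c z * (y - x) := by
  have hd : ∀ t ∈ Set.Icc x y, HasDerivAt (fun t => (xiS P c t)⁻¹) (-xiGam P c t) t := fun t ht =>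
    hasDerivAt_inv_xiS (h.pos t ⟨hx.trans_le ht.1, ht.2.trans hy⟩)
  obtain ⟨z, hz, hz'⟩ := exists_hasDerivAt_eq_slope (fun t => (xiS P c t)⁻¹)
    (fun t => -xiGam P c t) hxy (fun t ht => (hd t ht).continuousAt.continuousWithinAt)
    fun t ht => hd t (Set.Ioo_subset_Icc_self ht)
  rw [eq_div_iff (by linarith)] at hz'
  exact ⟨z, hz, by linarith⟩

lemma xiD2_zero_pos (h : NoGap P c) : 0 < xiD2 P c 0 := by
  obtain ⟨D, hD⟩ : ∃ D, D = (xiS P c (1 / 2))⁻¹ + xiGam P c (1 / 2) / 2 := ⟨_, rfl⟩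
  have hSp : ∀ t ∈ Set.Ioc (0 : ℝ) 1, 0 < xiS P c t := fun t ht => Real.sqrt_pos.2 (h.pos t ht)
  have hDp : 0 < D := by
    have h1 := inv_pos.2 (hSp (1 / 2) (by norm_num))
    have h2 := xiGam_nonneg (P := P) (c := c) (t := 1 / 2) (by norm_num)
    linarith
  have hsub : Set.Ioo (0 : ℝ) (1 / 2) ⊆ {t | D⁻¹ ≤ xiS P c t} := by
    intro t ht
    obtain ⟨z, hz, hz'⟩ := h.inv_xiS_sub ht.1 ht.2 (by norm_num)
    have h1 := h.xiGam_mono (x := z) (y := 1 / 2) ⟨ht.1.trans hz.1, hz.2.trans (by norm_num)⟩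
      (by norm_num) hz.2.le
    have h2 := xiGam_nonneg (P := P) (c := c) (t := z) (ht.1.trans hz.1).le
    have h3 : (xiS P c t)⁻¹ ≤ D := by
      rw [hD]
      nlinarith [ht.1, ht.2]
    have hS := hSp t ⟨ht.1, by linarith [ht.2]⟩
    exact inv_le_of_inv_le₀ hS h3
  have hcl : IsClosed {t | D⁻¹ ≤ xiS P c t} := isClosed_le continuous_const continuous_xiS
  have h0 : (0 : ℝ) ∈ {t | D⁻¹ ≤ xiS P c t} := by
    refine closure_minimal hsub hcl ?_
    rw [closure_Ioo (by norm_num)]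
    norm_num
  exact Real.sqrt_pos.1 ((inv_pos.2 hDp).trans_le h0)

lemma xiD2_pos (h : NoGap P c) {t : ℝ} (h0 : 0 ≤ t) (h1 : t ≤ 1) : 0 < xiD2 P c t := by
  rcases h0.eq_or_lt with rfl | h0
  · exact h.xiD2_zero_pos
  · exact h.pos t ⟨h0, h1⟩

lemma xiS_pos (h : NoGap P c) {t : ℝ} (h0 : 0 ≤ t) (h1 : t ≤ 1) : 0 < xiS P c t :=
  Real.sqrt_pos.2 (h.xiD2_pos h0 h1)

lemma xiS_sub (h : NoGap P c) {x y : ℝ} (hx : 0 ≤ x) (hxy : x < y) (hy : y ≤ 1) :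
    ∃ z ∈ Set.Ioo x y, xiS P c y - xiS P c x = xiGam P c z * (xiD1 P c y - xiD1 P c x) := by
  obtain ⟨z, hz, hz'⟩ := exists_ratio_hasDerivAt_eq_ratio_slope (xiS P c)
    (fun t => xiGam P c t * xiD2 P c t) hxy continuous_xiS.continuousOn
    (fun t ht => hasDerivAt_xiS (h.xiD2_pos (hx.trans ht.1.le) (ht.2.le.trans hy)))
    (xiD1 P c) (xiD2 P c) continuous_xiD1.continuousOn fun t _ => hasDerivAt_xiD1 t
  refine ⟨z, hz, ?_⟩
  have := h.xiD2_pos (hx.trans hz.1.le) (hz.2.le.trans hy)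
  have h2 : xiD2 P c z * (xiS P c y - xiS P c x)
      = xiD2 P c z * (xiGam P c z * (xiD1 P c y - xiD1 P c x)) := by
    linarith
  exact mul_left_cancel₀ this.ne' h2

lemma xiS_mul_one_sub_le (h : NoGap P c) {t : ℝ} (h0 : 0 ≤ t) (h1 : t ≤ 1) :
    xiS P c t * (1 - t) ≤ xiS P c 0 := by
  rcases h0.eq_or_lt with rfl | h0
  · simp
  rcases h1.eq_or_lt with rfl | h1
  · simpa using xiS_nonneg 0
  have hd : ∀ s ∈ Set.Icc (0 : ℝ) 1, HasDerivAt (fun t => (xiS P c t)⁻¹) (-xiGam P c s) s :=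
    fun s hs => hasDerivAt_inv_xiS (h.xiD2_pos hs.1 hs.2)
  obtain ⟨z, hz, hz'⟩ := exists_hasDerivAt_eq_slope (fun t => (xiS P c t)⁻¹)
    (fun t => -xiGam P c t) h0
    (fun s hs => (hd s ⟨hs.1, hs.2.trans h1.le⟩).continuousAt.continuousWithinAt)
    fun s hs => hd s ⟨hs.1.le, hs.2.le.trans h1.le⟩
  obtain ⟨w, hw, hw'⟩ := h.inv_xiS_sub h0 h1 le_rfl
  rw [eq_div_iff (by linarith)] at hz'
  have hm := h.xiGam_mono ⟨hz.1, hz.2.trans h1⟩ ⟨h0.trans hw.1, hw.2⟩ (hz.2.trans hw.1).le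
  have hS0 := h.xiS_pos le_rfl zero_le_one
  have hSt := h.xiS_pos h0.le h1.le
  have hS1 := inv_pos.2 (h.xiS_pos zero_le_one le_rfl)
  have h2 : (1 - t) * (xiS P c 0)⁻¹ ≤ (xiS P c t)⁻¹ := by
    have e1 : t * (1 - t) * xiGam P c z ≤ t * (1 - t) * xiGam P c w :=
      mul_le_mul_of_nonneg_left hm (mul_nonneg h0.le (by linarith))
    have e2 : (1 - t) * ((xiS P c 0)⁻¹ - (xiS P c t)⁻¹) = t * (1 - t) * xiGam P c z := by
      linear_combination (1 - t) * hz'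
    have e3 : t * ((xiS P c t)⁻¹ - (xiS P c 1)⁻¹) = t * (1 - t) * xiGam P c w := by
      rw [hw']; ring
    nlinarith [mul_pos h0 hS1]
  rw [← div_eq_mul_inv, inv_eq_one_div, div_le_div_iff₀ hS0 hSt] at h2
  linarith

lemma xiD1_le (h : NoGap P c) {t : ℝ} (h0 : 0 ≤ t) (h1 : t < 1) :
    xiD1 P c t ≤ xiD2 P c 0 * (t / (1 - t)) := by
  have key := nonneg_of_hasDerivAt_nonneg
    (g := fun t => xiD2 P c 0 * (t / (1 - t)) - xiD1 P c t)
    (g' := fun t => xiD2 P c 0 * ((1 * (1 - t) - t * (-1)) / (1 - t) ^ 2) - xiD2 P c t)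
    h0 (by simp [xiD1_zero])
    (fun s hs => by
      have : 1 - s ≠ 0 := by linarith [hs.2]
      exact (((hasDerivAt_id s).div ((hasDerivAt_id s).const_sub 1) this).const_mul _).sub
        (hasDerivAt_xiD1 s))
    (fun s hs => by
      have h3 : 0 < 1 - s := by linarith [hs.2]
      have h2 := h.xiS_mul_one_sub_le hs.1.le (by linarith)
      have h4 := mul_self_le_mul_self (mul_nonneg (xiS_nonneg s) h3.le) h2
      have h5 := xiS_sq (P := P) (c := c) hs.1.le
      have h6 := xiS_sq (P := P) (c := c) (t := 0) le_rfl
      have h7 : xiD2 P c s * (1 - s) ^ 2 ≤ xiD2 P c 0 := by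
        rw [← h5, ← h6]; nlinarith
      have h8 : xiD2 P c s ≤ xiD2 P c 0 / (1 - s) ^ 2 := by
        rwa [le_div_iff₀ (by positivity)]
      have h9 : xiD2 P c 0 * ((1 * (1 - s) - s * (-1)) / (1 - s) ^ 2)
          = xiD2 P c 0 / (1 - s) ^ 2 := by
        rw [← mul_div_assoc]; congr 1; ring
      linarith)
  simpa using key

lemma xiFun_le (h : NoGap P c) {r : ℝ} (h0 : 0 ≤ r) (h1 : r ≤ 3 / 5) :
    xiFun P c r ≤ xiD2 P c 0 * r ^ 2 := by
  have ha := h.xiD2_zero_pos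
  have key := nonneg_of_hasDerivAt_nonneg
    (g := fun t => xiD2 P c 0 * (t ^ 2 / 2 + ((1 - t)⁻¹ - 1 - t - t ^ 2) / 3) - xiFun P c t)
    (g' := fun t => xiD2 P c 0 * (2 * t / 2 + ((1 : ℝ) / (1 - t) ^ 2 - 1 - 2 * t) / 3)
      - xiD1 P c t)
    h0 (by simp [xiFun_zero])
    (fun s hs => by
      have : 1 - s ≠ 0 := by linarith [hs.2]
      have e1 : HasDerivAt (fun t : ℝ => (1 - t)⁻¹) (1 / (1 - s) ^ 2) s :=
        (((hasDerivAt_id s).const_sub 1).inv this).congr_deriv (by simp)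
      have e2 : HasDerivAt (fun t : ℝ => t ^ 2) (2 * s) s := by simpa using hasDerivAt_pow 2 s
      exact (((e2.div_const 2).add
        ((((e1.sub_const 1).sub (hasDerivAt_id s)).sub e2).div_const 3 |>.congr_deriv
          (by simp))).const_mul _).sub (hasDerivAt_xiFun s))
    (fun s hs => by
      have h3 : 0 < 1 - s := by linarith [hs.2]
      have h2 := h.xiD1_le hs.1.le (by linarith)
      have h4 : s / (1 - s) ≤ 2 * s / 2 + ((1 : ℝ) / (1 - s) ^ 2 - 1 - 2 * s) / 3 := by
        rw [← sub_nonneg]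
        have : 2 * s / 2 + ((1 : ℝ) / (1 - s) ^ 2 - 1 - 2 * s) / 3 - s / (1 - s)
            = s ^ 3 / (3 * (1 - s) ^ 2) := by
          field_simp
          ring
        rw [this]
        exact div_nonneg (pow_nonneg hs.1.le 3) (by positivity)
      have := mul_le_mul_of_nonneg_left h4 ha.le
      linarith)
  have h3 : 0 < 1 - r := by linarith
  have h5 : r ^ 2 / 2 + ((1 - r)⁻¹ - 1 - r - r ^ 2) / 3 ≤ r ^ 2 := by
    have e : (1 - r)⁻¹ - 1 - r - r ^ 2 = r ^ 3 / (1 - r) := by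
      field_simp
      ring
    have e2 : r ^ 3 / (1 - r) ≤ 3 / 2 * r ^ 2 := by
      rw [div_le_iff₀ h3]
      nlinarith [sq_nonneg r, mul_nonneg (sq_nonneg r) (by linarith : 0 ≤ 3 / 5 - r)]
    linarith
  have := mul_le_mul_of_nonneg_left h5 ha.le
  linarith

lemma xiFun_nonneg_of_ge (h : NoGap P c) {r : ℝ} (h1 : -(3 / 5) ≤ r) : 0 ≤ xiFun P c r := by
  rcases le_total 0 r with h0 | h0
  · exact xiFun_nonneg h0
  have e1 := h.xiFun_le (r := -r) (by linarith) (by linarith)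
  have e2 := two_mul_sub_xiFun_le (P := P) (c := c) (-r) h.two_le (by linarith)
  rw [xiD2_zero h.two_le] at e1
  rw [neg_neg] at e2
  linarith

/-- The covariance gap in the interpolation towards the cavity tree. -/
lemma xiFun_add_xiTheta_sub_nonneg (h : NoGap P c) {r q : ℝ} (h1 : -(3 / 5) ≤ r) (hq : 0 ≤ q) :
    0 ≤ xiFun P c r + xiTheta P c q - r * xiD1 P c q := by
  rcases le_total 0 r with h0 | h0
  · have := xiFun_tangent_le (P := P) (c := c) hq h0
    unfold xiTheta
    linarith
  · have e1 := h.xiFun_nonneg_of_ge h1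
    have e2 := xiTheta_nonneg (P := P) (c := c) hq
    have e3 := mul_nonneg (neg_nonneg.2 h0) (xiD1_nonneg (P := P) (c := c) hq)
    linarith

end NoGap

lemma neg_xiFun_one_le_gap {r q : ℝ} (h1 : |r| ≤ 1) (h0 : r ≤ 0) (hq : 0 ≤ q) :
    -xiFun P c 1 ≤ xiFun P c r + xiTheta P c q - r * xiD1 P c q := by
  have e1 := neg_xiFun_one_le (P := P) (c := c) h1
  have e2 := xiTheta_nonneg (P := P) (c := c) hq
  have e3 := mul_nonneg (neg_nonneg.2 h0) (xiD1_nonneg (P := P) (c := c) hq)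
  linarith

end NoGapFacts

section ParisiValue

variable {P : ℕ} {c : ℕ → ℝ}

lemma lintegral_xiS_add_self : ∫⁻ t in Set.Ioo (0 : ℝ) 1,
    (ENNReal.ofReal (xiS P c t) + ENNReal.ofReal (xiS P c t))
      = ENNReal.ofReal (∫ t in Set.Ioo (0 : ℝ) 1, xiS P c t) * 2 := by
  rw [lintegral_add_left continuous_xiS.measurable.ennreal_ofReal, mul_two,
    ofReal_integral_eq_lintegral_ofReal]
  · exact (continuous_xiS.continuousOn (s := Set.Icc 0 1)).integrableOn_Icc.mono_set
      Set.Ioo_subset_Icc_self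
  · exact ae_of_all _ fun t => xiS_nonneg t

lemma ofReal_integral_xiS_le_PFunE (γ : ℝ → ℝ) :
    ENNReal.ofReal (∫ t in Set.Ioo (0 : ℝ) 1, xiS P c t) ≤ PFunE P c γ := by
  refine le_iInf₂ fun L _ => ?_
  rw [ENNReal.le_div_iff_mul_le (by simp) (by simp), ← lintegral_xiS_add_self]
  refine setLIntegral_mono' measurableSet_Ioo fun t ht => ?_
  obtain ⟨g, hg⟩ : ∃ g, g = L - (gammaLInt γ t).toReal := ⟨_, rfl⟩
  rw [← hg]
  rcases le_or_gt g 0 with h0 | h0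
  · simp [ENNReal.ofReal_of_nonpos h0]
  · rw [← ENNReal.ofReal_inv_of_pos h0, ← xiS_sq ht.1.le,
      ← ENNReal.ofReal_add (xiS_nonneg t) (xiS_nonneg t),
      ← ENNReal.ofReal_add (by positivity) (by positivity)]
    refine ENNReal.ofReal_le_ofReal ?_
    rw [← sub_nonneg]
    have : xiS P c t ^ 2 * g + g⁻¹ - (xiS P c t + xiS P c t) = (xiS P c t * g - 1) ^ 2 * g⁻¹ := by
      field_simp
      ring
    rw [this]
    positivity

/-- The minimizing order parameter. -/
def optGamma (P : ℕ) (c : ℕ → ℝ) (t : ℝ) : ℝ := if t ≤ 0 then 0 else xiGam P c t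

namespace NoGap

lemma continuousOn_xiGam (h : NoGap P c) : ContinuousOn (xiGam P c) (Set.Icc 0 1) := by
  refine ContinuousOn.div_const (ContinuousOn.div continuous_xiD3.continuousOn
    (continuous_xiD2.continuousOn.rpow_const fun t ht => Or.inl (h.xiD2_pos ht.1 ht.2).ne') ?_) 2
  exact fun t ht => (Real.rpow_pos_of_pos (h.xiD2_pos ht.1 ht.2) _).ne'

lemma integral_xiGam (h : NoGap P c) {t : ℝ} (h0 : 0 ≤ t) (h1 : t ≤ 1) :
    ∫ s in Set.Ioo 0 t, xiGam P c s = (xiS P c 0)⁻¹ - (xiS P c t)⁻¹ := by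
  rw [← integral_Ioc_eq_integral_Ioo, ← intervalIntegral.integral_of_le h0]
  have hc : ContinuousOn (fun s => -xiGam P c s) (Set.uIcc 0 t) := by
    rw [Set.uIcc_of_le h0]
    exact (h.continuousOn_xiGam.mono (Set.Icc_subset_Icc le_rfl h1)).neg
  have := intervalIntegral.integral_eq_sub_of_hasDerivAt (a := 0) (b := t)
    (f := fun s => (xiS P c s)⁻¹) (f' := fun s => -xiGam P c s) (fun s hs => by
      rw [Set.uIcc_of_le h0] at hs
      exact hasDerivAt_inv_xiS (h.xiD2_pos hs.1 (hs.2.trans h1))) hc.intervalIntegrable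
  rw [intervalIntegral.integral_neg] at this
  linarith

lemma gammaLInt_optGamma (h : NoGap P c) {t : ℝ} (h0 : 0 ≤ t) (h1 : t ≤ 1) :
    gammaLInt (optGamma P c) t = ENNReal.ofReal ((xiS P c 0)⁻¹ - (xiS P c t)⁻¹) := by
  rw [← h.integral_xiGam h0 h1, ofReal_integral_eq_lintegral_ofReal, gammaLInt]
  · refine setLIntegral_congr_fun measurableSet_Ioo fun s hs => ?_
    simp [optGamma, not_le.2 hs.1]
  · exact (h.continuousOn_xiGam.mono (Set.Icc_subset_Icc le_rfl h1)).integrableOn_Icc.mono_set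
      Set.Ioo_subset_Icc_self
  · exact (ae_restrict_iff' measurableSet_Ioo).2 (ae_of_all _ fun s hs => xiGam_nonneg hs.1.le)

lemma optGamma_mem_calU (h : NoGap P c) : optGamma P c ∈ calU := by
  have hnn : ∀ t, 0 ≤ optGamma P c t := fun t => by
    unfold optGamma
    split_ifs with ht
    · exact le_rfl
    · exact xiGam_nonneg (not_le.1 ht).le
  refine ⟨fun t _ => hnn t, fun x hx y hy hxy => ?_, ?_⟩
  · rcases le_or_gt x 0 with h0 | h0
    · simpa [optGamma, h0] using hnn y
    · have h0' := h0.trans_le hxy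
      simpa [optGamma, not_le.2 h0, not_le.2 h0'] using
        h.xiGam_mono ⟨h0, hx.2⟩ ⟨h0', hy.2⟩ hxy
  · refine (h.continuousOn_xiGam.integrableOn_Icc.mono_set Set.Ioo_subset_Icc_self).congr_fun
      (fun s hs => ?_) measurableSet_Ioo
    simp [optGamma, not_le.2 hs.1]

lemma PFunE_optGamma_le (h : NoGap P c) :
    PFunE P c (optGamma P c) ≤ ENNReal.ofReal (∫ t in Set.Ioo (0 : ℝ) 1, xiS P c t) := by
  have hle : ∀ t, 0 ≤ t → t ≤ 1 → (xiS P c t)⁻¹ ≤ (xiS P c 0)⁻¹ := fun t h0 h1 =>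
    inv_anti₀ (h.xiS_pos le_rfl zero_le_one) (xiS_mono le_rfl h0)
  refine (iInf₂_le (xiS P c 0)⁻¹ ?_).trans ?_
  · show gammaLInt (optGamma P c) 1 ≤ _
    rw [h.gammaLInt_optGamma zero_le_one le_rfl]
    refine ENNReal.ofReal_le_ofReal ?_
    have := inv_nonneg.2 (xiS_nonneg (P := P) (c := c) 1)
    linarith
  · rw [ENNReal.div_le_iff (by simp) (by simp), ← lintegral_xiS_add_self]
    refine (setLIntegral_congr_fun measurableSet_Ioo fun t ht => ?_).le
    have hp := h.xiS_pos ht.1.le ht.2.le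
    rw [h.gammaLInt_optGamma ht.1.le ht.2.le,
      ENNReal.toReal_ofReal (sub_nonneg.2 (hle t ht.1.le ht.2.le)), sub_sub_cancel,
      ENNReal.ofReal_inv_of_pos hp, inv_inv, ← xiS_sq ht.1.le]
    congr 2
    field_simp

lemma iInf_PFunE (h : NoGap P c) : (⨅ γ ∈ calU, PFunE P c γ)
    = ENNReal.ofReal (∫ t in Set.Ioo (0 : ℝ) 1, xiS P c t) :=
  le_antisymm ((iInf₂_le _ h.optGamma_mem_calU).trans h.PFunE_optGamma_le)
    (le_iInf₂ fun γ _ => ofReal_integral_xiS_le_PFunE γ)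

end NoGap

end ParisiValue

section TreeInterpolation

lemma TreeMono.comp {h : ℝ → ℝ} {q₀ : ℝ} {l : List (ℕ × ℝ)} (hl : TreeMono id q₀ l)
    (h0 : 0 ≤ q₀) (hh : ∀ x y, 0 ≤ x → x ≤ y → h x ≤ h y) : TreeMono h q₀ l := by
  induction l generalizing q₀ with
  | nil => trivial
  | cons p l ih => exact ⟨hh _ _ h0 hl.1, ih hl.2 (h0.trans hl.1)⟩

lemma TreeMono.le_leafOvl {q₀ : ℝ} {l : List (ℕ × ℝ)} (hl : TreeMono id q₀ l) (α α' : Leaf l) :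
    q₀ ≤ leafOvl q₀ l α α' := by
  induction l generalizing q₀ with
  | nil => exact le_rfl
  | cons p l ih =>
    have h1 : q₀ ≤ p.2 := hl.1
    have h2 := ih hl.2 α.2 α'.2
    simp only [leafOvl]
    split_ifs
    · exact h1.trans h2
    · exact le_rfl

lemma leafOvl_self (q₀ : ℝ) (l : List (ℕ × ℝ)) (α : Leaf l) :
    leafOvl q₀ l α α = lastLevel q₀ l := by
  induction l generalizing q₀ with
  | nil => rfl
  | cons p l ih =>
    simp only [leafOvl, if_true, lastLevel]
    exact ih _ _

lemma field_zero {E U : Type*} [NormedAddCommGroup E] [InnerProductSpace ℝ E] (z : U → E) (g : E) :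
    field 0 z g = fun u => ⟪z u, g⟫ := by
  funext u
  simp [field]

lemma freeE_toLp_prod {A L E F : Type*} [Fintype A] [Nonempty A] [Fintype L] [Nonempty L]
    [NormedAddCommGroup E] [InnerProductSpace ℝ E] [FiniteDimensional ℝ E]
    [MeasurableSpace E] [BorelSpace E] [NormedAddCommGroup F] [InnerProductSpace ℝ F]
    [FiniteDimensional ℝ F] [MeasurableSpace F] [BorelSpace F] (x : A → E) (y : L → F) :
    freeE 0 (fun u : A × L => (WithLp.toLp 2 (x u.1, y u.2) : WithLp 2 (E × F)))
      = freeE 0 x + freeE 0 y := by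
  have hmp := measurePreserving_toLp_prod (E := E) (F := F)
  have hi := integrable_LSE_field 0
    (fun u : A × L => (WithLp.toLp 2 (x u.1, y u.2) : WithLp 2 (E × F)))
  have hf : ∀ g : E × F, LSE (field 0
      (fun u : A × L => (WithLp.toLp 2 (x u.1, y u.2) : WithLp 2 (E × F))) (WithLp.toLp 2 g))
      = LSE (field 0 x g.1) + LSE (field 0 y g.2) := by
    intro g
    rw [← LSE_prod]
    congr 1
    funext u
    simp [field, WithLp.prod_inner_apply]
  unfold freeE
  rw [← hmp.map_eq, integral_map hmp.measurable.aemeasurable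
    (by rw [hmp.map_eq]; exact hi.aestronglyMeasurable)]
  simp only [hf]
  have h1 := (integrable_LSE_field 0 x).comp_fst (stdGaussian F)
  have h2 := (integrable_LSE_field 0 y).comp_snd (stdGaussian E)
  refine (integral_add h1 h2).trans ?_
  rw [integral_fun_fst (fun g => LSE (field 0 x g)), integral_fun_snd (fun g => LSE (field 0 y g))]
  simp

lemma inner_toLp_treeFeat {h : ℝ → ℝ} {q₀ : ℝ} {l : List (ℕ × ℝ)} (hl : TreeMono h q₀ l)
    (α α' : Leaf l) :
    ⟪(WithLp.toLp 2 (treeFeat h q₀ l α) : EuclideanSpace ℝ (TNode l)),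
      WithLp.toLp 2 (treeFeat h q₀ l α')⟫ = h (leafOvl q₀ l α α') - h q₀ := by
  rw [← sum_treeFeat hl, PiLp.inner_apply]
  exact Finset.sum_congr rfl fun ν _ => by simp [mul_comm]

lemma freeE_treeFeat {h : ℝ → ℝ} {q₀ : ℝ} {l : List (ℕ × ℝ)} (hl : TreeMono h q₀ l) :
    freeE 0 (fun α : Leaf l => (WithLp.toLp 2 (treeFeat h q₀ l α) : EuclideanSpace ℝ (TNode l)))
      = ∫ g, LSE (treeField h q₀ l g) ∂(treeMeasure ℝ l) := by
  have h1 := isGaussFamily_inner (fun u : Unit × Leaf l =>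
    (WithLp.toLp 2 (treeFeat h q₀ l u.2) : EuclideanSpace ℝ (TNode l)))
  have h2 := isGaussFamily_treeField (E := ℝ) hl (fun _ : Unit => (1 : ℝ))
  simp only [inner_toLp_treeFeat hl] at h1
  have hK : (fun u u' : Unit × Leaf l => ⟪(1 : ℝ), 1⟫ * (h (leafOvl q₀ l u.2 u'.2) - h q₀))
      = fun u u' => h (leafOvl q₀ l u.2 u'.2) - h q₀ := by
    funext u u'
    simp
  rw [hK] at h2
  have hm : Measurable (fun y : Unit × Leaf l → ℝ => LSE (fun α => y ((), α))) :=
    (continuous_LSE.comp (by fun_prop)).measurable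
  have := h1.integral_eq h2 hm
  simpa [freeE, field_zero] using this

variable {N P : ℕ} {c : ℕ → ℝ}

/-- Feature vectors of the cavity field. -/
def cavityFeat (h : ℝ → ℝ) (q₀ : ℝ) (l : List (ℕ × ℝ)) (β : ℝ) (σ : Fin N → ℝ) (α : Leaf l) :
    EuclideanSpace ℝ (Fin N × TNode l) :=
  WithLp.toLp 2 fun i => β * σ i.1 * treeFeat h q₀ l α i.2

lemma inner_cavityFeat {h : ℝ → ℝ} {q₀ : ℝ} {l : List (ℕ × ℝ)} (hl : TreeMono h q₀ l) (β : ℝ)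
    (σ τ : Fin N → ℝ) (α α' : Leaf l) :
    ⟪cavityFeat h q₀ l β σ α, cavityFeat h q₀ l β τ α'⟫
      = β ^ 2 * dotp σ τ * (h (leafOvl q₀ l α α') - h q₀) := by
  rw [← sum_treeFeat hl, PiLp.inner_apply, Fintype.sum_prod_type, dotp, mul_assoc,
    Finset.sum_mul_sum, Finset.mul_sum]
  refine Finset.sum_congr rfl fun i _ => ?_
  rw [Finset.mul_sum]
  refine Finset.sum_congr rfl fun ν _ => ?_
  simp [cavityFeat]
  ring

lemma norm_toLp_of_mem_sphereSet {σ : Fin N → ℝ} (hσ : σ ∈ sphereSet N) :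
    ‖(WithLp.toLp 2 σ : EuclideanSpace ℝ (Fin N))‖ = √N := by
  have h : ∑ i, (σ i) ^ 2 = (N : ℝ) := hσ
  rw [EuclideanSpace.norm_eq, ← h]
  simp

lemma freeE_cavityFeat_le {h : ℝ → ℝ} {q₀ : ℝ} {l : List (ℕ × ℝ)} (hl : TreeMono h q₀ l) {β : ℝ}
    (hβ : 0 ≤ β) {n : ℕ} {a : Fin (n + 1) → Fin N → ℝ} (ha : ∀ u, a u ∈ sphereSet N) :
    freeE 0 (fun u : Fin (n + 1) × Leaf l => cavityFeat h q₀ l β (a u.1) u.2)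
      ≤ Real.log (n + 1) + ∫ g : TreeG (EuclideanSpace ℝ (Fin N)) l,
        LSE (fun α => β * √N * ‖treeField h q₀ l g α‖) ∂(treeMeasure _ l) := by
  obtain ⟨s, hs⟩ : ∃ s : Fin (n + 1) → EuclideanSpace ℝ (Fin N),
    s = fun i => β • WithLp.toLp 2 (a i) := ⟨_, rfl⟩
  have hsn : ∀ i, ‖s i‖ = β * √N := fun i => by
    rw [hs, norm_smul, norm_toLp_of_mem_sphereSet (ha i), Real.norm_of_nonneg hβ]
  have h1 := isGaussFamily_inner (fun u : Fin (n + 1) × Leaf l =>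
    cavityFeat h q₀ l β (a u.1) u.2)
  have h2 := isGaussFamily_treeField hl s
  simp only [inner_cavityFeat hl] at h1
  have hK : (fun u u' : Fin (n + 1) × Leaf l => ⟪s u.1, s u'.1⟫
      * (h (leafOvl q₀ l u.2 u'.2) - h q₀)) = fun u u' =>
      β ^ 2 * dotp (a u.1) (a u'.1) * (h (leafOvl q₀ l u.2 u'.2) - h q₀) := by
    funext u u'
    rw [hs, real_inner_smul_left, real_inner_smul_right, PiLp.inner_apply, dotp]
    simp only [RCLike.inner_apply, conj_trivial, mul_comm (a u'.1 _)]
    ring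
  rw [hK] at h2
  have hm : Measurable (fun y : Fin (n + 1) × Leaf l → ℝ => LSE y) := continuous_LSE.measurable
  have he := h1.integral_eq h2 hm
  have hi : Integrable (fun g : TreeG (EuclideanSpace ℝ (Fin N)) l =>
      LSE (fun α => β * √N * ‖treeField h q₀ l g α‖)) (treeMeasure _ l) :=
    integrable_LSE_of_integrable fun α => (integrable_treeField h q₀ l α).norm.const_mul _
  have hi' : Integrable (fun g : TreeG (EuclideanSpace ℝ (Fin N)) l =>
      LSE (fun u : Fin (n + 1) × Leaf l => ⟪s u.1, treeField h q₀ l g u.2⟫)) (treeMeasure _ l) :=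
    integrable_LSE_of_integrable fun u => (integrable_treeField h q₀ l u.2).const_inner _
  have hle : ∀ g : TreeG (EuclideanSpace ℝ (Fin N)) l,
      LSE (fun u : Fin (n + 1) × Leaf l => ⟪s u.1, treeField h q₀ l g u.2⟫)
      ≤ Real.log (n + 1) + LSE (fun α => β * √N * ‖treeField h q₀ l g α‖) := by
    intro g
    have e0 : LSE (fun _ : Fin (n + 1) => (0 : ℝ)) = Real.log (n + 1) := by
      simp [LSE]
    rw [← e0, ← LSE_prod]
    refine LSE_mono fun u => ?_
    rw [zero_add, ← hsn u.1]
    exact real_inner_le_norm _ _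
  have e3 : freeE 0 (fun u : Fin (n + 1) × Leaf l => cavityFeat h q₀ l β (a u.1) u.2)
      = ∫ g : TreeG (EuclideanSpace ℝ (Fin N)) l,
      LSE (fun u : Fin (n + 1) × Leaf l => ⟪s u.1, treeField h q₀ l g u.2⟫) ∂(treeMeasure _ l) := by
    rw [← he]
    simp [freeE, field_zero]
  rw [e3]
  refine (integral_mono hi' ((integrable_const _).add hi) hle).trans ?_
  rw [integral_add' (integrable_const _) hi]
  simp

/-- Interpolation between the Hamiltonian and the cavity tree. -/
lemma NoGap.freeE_add_tree_le (h : NoGap P c) (hN : 1 ≤ N) {n : ℕ} {a : Fin (n + 1) → Fin N → ℝ}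
    (ha : ∀ u, a u ∈ sphereSet N) {β : ℝ} (hβ : 0 ≤ β) {k : ℕ} (hk : 1 ≤ k) {l : List (ℕ × ℝ)}
    (hl : TreeMono id 0 l) (hlast : lastLevel 0 l = 1) :
    freeE 0 (fun u => β • featV N P c (a u))
        + ∫ g, LSE (treeField (fun q => β ^ 2 * N * xiTheta P c q) 0 l g) ∂(treeMeasure ℝ l)
      ≤ Real.log (n + 1) + ∫ g : TreeG (EuclideanSpace ℝ (Fin N)) l,
          LSE (fun α => β * √N * ‖treeField (xiD1 P c) 0 l g α‖) ∂(treeMeasure _ l)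
        + 4 * 64 ^ k + 8 * (β ^ 2 * N * xiFun P c 1) * (15 / 16) ^ k := by
  have hN' : (0 : ℝ) < N := by exact_mod_cast hN
  have hl1 : TreeMono (xiD1 P c) 0 l := hl.comp le_rfl fun x y hx hxy => xiD1_mono hx hxy
  have hl2 : TreeMono (fun q => β ^ 2 * N * xiTheta P c q) 0 l := by
    refine hl.comp le_rfl fun x y hx hxy => mul_le_mul_of_nonneg_left ?_ (by positivity)
    have h1 := mul_xiD1_sub_le_xiTheta_sub (P := P) (c := c) hx (hx.trans hxy)
    have h2 := mul_nonneg hx (sub_nonneg.2 (xiD1_mono (P := P) (c := c) hx hxy))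
    linarith
  have hdot : ∀ σ τ : Fin N → ℝ, dotp σ τ = N * ovl σ τ := fun σ τ => by
    unfold ovl
    field_simp
  have hx : ∀ u v : Fin (n + 1) × Leaf l,
      ⟪(WithLp.toLp 2 (β • featV N P c (a u.1),
        (WithLp.toLp 2 (treeFeat (fun q => β ^ 2 * N * xiTheta P c q) 0 l u.2)
          : EuclideanSpace ℝ (TNode l))) : WithLp 2 (EuclideanSpace ℝ (GIdx N P) ×
            EuclideanSpace ℝ (TNode l))),
        WithLp.toLp 2 (β • featV N P c (a v.1),
          (WithLp.toLp 2 (treeFeat (fun q => β ^ 2 * N * xiTheta P c q) 0 l v.2)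
            : EuclideanSpace ℝ (TNode l)))⟫
      - ⟪cavityFeat (xiD1 P c) 0 l β (a u.1) u.2, cavityFeat (xiD1 P c) 0 l β (a v.1) v.2⟫
      = β ^ 2 * N * (xiFun P c (ovl (a u.1) (a v.1)) + xiTheta P c (leafOvl 0 l u.2 v.2)
        - ovl (a u.1) (a v.1) * xiD1 P c (leafOvl 0 l u.2 v.2)) := by
    intro u v
    rw [inner_cavityFeat hl1, WithLp.prod_inner_apply]
    simp only
    rw [inner_toLp_treeFeat hl2, real_inner_smul_left, real_inner_smul_right, inner_featV hN, hdot,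
      xiTheta_zero, xiD1_zero]
    ring
  have key := freeE_le_of_pertSystem (pertSystem_feat (U := Fin (n + 1) × Leaf l) hN hk
    (σ := fun u => a u.1) fun u => ha u.1) k
    (x := fun u : Fin (n + 1) × Leaf l => (WithLp.toLp 2 (β • featV N P c (a u.1),
        (WithLp.toLp 2 (treeFeat (fun q => β ^ 2 * N * xiTheta P c q) 0 l u.2)
          : EuclideanSpace ℝ (TNode l))) : WithLp 2 (EuclideanSpace ℝ (GIdx N P) ×
            EuclideanSpace ℝ (TNode l))))
    (y := fun u => cavityFeat (xiD1 P c) 0 l β (a u.1) u.2)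
    (C := β ^ 2 * N * xiFun P c 1) ?_ ?_
    (mul_nonneg (by positivity) (xiFun_nonneg zero_le_one)) ?_
  · rw [freeE_toLp_prod (fun u => β • featV N P c (a u)) (fun α : Leaf l =>
      (WithLp.toLp 2 (treeFeat (fun q => β ^ 2 * N * xiTheta P c q) 0 l α)
          : EuclideanSpace ℝ (TNode l))), freeE_treeFeat hl2] at key
    have := freeE_cavityFeat_le hl1 hβ ha
    linarith
  · intro u v t
    have b := fun u v : Fin (n + 1) × Leaf l => abs_le.1 (abs_ovl_le hN (ha u.1) (ha v.1))
    have h3 := ovl_triple hN (ha u.1) (ha v.1) (ha t.1)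
    have := three_pow_le (a := (1 - ovl (a u.1) (a v.1)) / 2) (b := (1 - ovl (a v.1) (a t.1)) / 2)
      (c := (1 - ovl (a u.1) (a t.1)) / 2) (by linarith [b u v]) (by linarith [b v t])
      (by linarith [b u t]) (by linarith) k
    linarith
  · intro u
    rw [← real_inner_self_eq_norm_sq, ← real_inner_self_eq_norm_sq, ← sub_eq_zero, hx,
      ovl_self hN (ha u.1), leafOvl_self, hlast]
    unfold xiTheta
    ring
  · intro u v
    rw [hx]
    have hq := hl.le_leafOvl u.2 v.2
    have hR := abs_ovl_le hN (ha u.1) (ha v.1)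
    have hW : 0 ≤ (1 - ovl (a u.1) (a v.1)) / 2 := by linarith [(abs_le.1 hR).2]
    have hx1 : 0 ≤ xiFun P c 1 := xiFun_nonneg zero_le_one
    rcases le_total (-(3 / 5)) (ovl (a u.1) (a v.1)) with h1 | h1
    · have e1 := mul_nonneg (by positivity : 0 ≤ β ^ 2 * (N : ℝ))
        (h.xiFun_add_xiTheta_sub_nonneg h1 hq)
      have e2 : 0 ≤ β ^ 2 * N * xiFun P c 1 * (5 / 4) ^ k
          * ((1 - ovl (a u.1) (a v.1)) / 2) ^ k := by positivity
      linarith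
    · have e1 := mul_le_mul_of_nonneg_left
        (neg_xiFun_one_le_gap (P := P) (c := c) hR (by linarith) hq)
        (by positivity : 0 ≤ β ^ 2 * (N : ℝ))
      have e2 : (1 : ℝ) ≤ (5 / 4) ^ k * ((1 - ovl (a u.1) (a v.1)) / 2) ^ k := by
        rw [← mul_pow]
        exact one_le_pow₀ (by linarith)
      have e3 : 0 ≤ β ^ 2 * N * xiFun P c 1 := by positivity
      have e4 := mul_le_mul_of_nonneg_left e2 e3
      linarith

end TreeInterpolation

section Levels

/-- The tree with levels `p 1, …, p n` and branching numbers determined by consecutive levels. -/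
def levels (M : ℝ → ℝ → ℕ) : (ℕ → ℝ) → ℕ → List (ℕ × ℝ)
  | _, 0 => []
  | p, n + 1 => (M (p 0) (p 1), p 1) :: levels M (fun j => p (j + 1)) n

variable (M : ℝ → ℝ → ℕ)

lemma treeSum_levels (f : ℕ → ℝ → ℝ → ℝ) (p : ℕ → ℝ) (n : ℕ) :
    treeSum f (p 0) (levels M p n)
      = ∑ i ∈ Finset.range n, f (M (p i) (p (i + 1))) (p i) (p (i + 1)) := by
  induction n generalizing p with
  | zero => rfl
  | succ n ih =>
    rw [Finset.sum_range_succ', levels, treeSum, ih fun j => p (j + 1), add_comm]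

lemma lastLevel_levels (p : ℕ → ℝ) (n : ℕ) : lastLevel (p 0) (levels M p n) = p n := by
  induction n generalizing p with
  | zero => rfl
  | succ n ih => exact ih fun j => p (j + 1)

lemma treeMono_levels {h : ℝ → ℝ} {p : ℕ → ℝ} {n : ℕ} (hp : ∀ i < n, h (p i) ≤ h (p (i + 1))) :
    TreeMono h (p 0) (levels M p n) := by
  induction n generalizing p with
  | zero => trivial
  | succ n ih => exact ⟨hp 0 n.succ_pos, ih fun i hi => hp (i + 1) (by omega)⟩

lemma treeSlope_levels {h B : ℝ → ℝ} {β m : ℝ} {p : ℕ → ℝ} {n : ℕ}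
    (hh : ∀ i < n, h (p i) < h (p (i + 1))) (hB : ∀ i < n, B (p i) < B (p (i + 1)))
    (hβ : ∀ i < n, (B (p (i + 1)) - B (p i)) / (h (p (i + 1)) - h (p i)) ≤ β)
    (hm : 0 < n → m ≤ (B (p 1) - B (p 0)) / (h (p 1) - h (p 0)))
    (hs : ∀ i, i + 1 < n → (B (p (i + 1)) - B (p i)) / (h (p (i + 1)) - h (p i))
      ≤ (B (p (i + 2)) - B (p (i + 1))) / (h (p (i + 2)) - h (p (i + 1)))) :
    TreeSlope h B β m (p 0) (levels M p n) := by
  induction n generalizing p m with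
  | zero => trivial
  | succ n ih =>
    exact ⟨hh 0 n.succ_pos, hB 0 n.succ_pos, hm n.succ_pos, hβ 0 n.succ_pos,
      ih (fun i hi => hh (i + 1) (by omega)) (fun i hi => hB (i + 1) (by omega))
        (fun i hi => hβ (i + 1) (by omega)) (fun hn => hs 0 (by omega))
        fun i hi => hs (i + 1) (by omega)⟩

end Levels

section Grid

variable {P : ℕ} {c : ℕ → ℝ}

/-- The Lagrange profile `√ξ'' + ε ξ'`. -/
def gridB (P : ℕ) (c : ℕ → ℝ) (ε q : ℝ) : ℝ := xiS P c q + ε * xiD1 P c q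

/-- The discrete order parameter between two levels. -/
def gridM (P : ℕ) (c : ℕ → ℝ) (ε q q' : ℝ) : ℝ :=
  (gridB P c ε q' - gridB P c ε q) / (xiD1 P c q' - xiD1 P c q)

/-- The discretized Parisi functional along the grid `i / r`. -/
def gridV (P : ℕ) (c : ℕ → ℝ) (ε : ℝ) (r : ℕ) : ℝ :=
  (gridB P c ε 1 + ∑ i ∈ Finset.range r,
    ((xiD1 P c ((i + 1 : ℕ) / r) - xiD1 P c (i / r)) / gridB P c ε (i / r)
      - gridM P c ε (i / r) ((i + 1 : ℕ) / r)
        * (xiTheta P c ((i + 1 : ℕ) / r) - xiTheta P c (i / r)))) / 2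

lemma grid_mem {r i : ℕ} (hi : i < r) : (0 : ℝ) ≤ i / r ∧ (i / r : ℝ) < (i + 1 : ℕ) / r ∧
    ((i + 1 : ℕ) / r : ℝ) ≤ 1 := by
  have hr : (0 : ℝ) < r := by exact_mod_cast (Nat.zero_le i).trans_lt hi
  refine ⟨by positivity, ?_, ?_⟩
  · gcongr
    simp
  · rw [div_le_one hr]
    exact_mod_cast hi

lemma xiTheta_mono {x y : ℝ} (hx : 0 ≤ x) (hxy : x ≤ y) : xiTheta P c x ≤ xiTheta P c y := by
  have h1 := mul_xiD1_sub_le_xiTheta_sub (P := P) (c := c) hx (hx.trans hxy)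
  have h2 := mul_nonneg hx (sub_nonneg.2 (xiD1_mono (P := P) (c := c) hx hxy))
  linarith

namespace NoGap

lemma xiD1_lt (h : NoGap P c) {x y : ℝ} (hx : 0 ≤ x) (hxy : x < y) (hy : y ≤ 1) :
    xiD1 P c x < xiD1 P c y := by
  have h1 := (xiD1_sub_mem (P := P) (c := c) hx hxy.le).1
  have h2 := mul_pos (h.xiD2_pos hx (hxy.le.trans hy)) (sub_pos.2 hxy)
  linarith

lemma gridM_eq (h : NoGap P c) (ε : ℝ) {x y : ℝ} (hx : 0 ≤ x) (hxy : x < y) (hy : y ≤ 1) :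
    ∃ z ∈ Set.Ioo x y, gridM P c ε x y = xiGam P c z + ε := by
  obtain ⟨z, hz, hz'⟩ := h.xiS_sub hx hxy hy
  refine ⟨z, hz, ?_⟩
  rw [gridM, div_eq_iff (sub_pos.2 (h.xiD1_lt hx hxy hy)).ne', gridB, gridB]
  linear_combination hz'

lemma le_gridM (h : NoGap P c) (ε : ℝ) {x y : ℝ} (hx : 0 ≤ x) (hxy : x < y) (hy : y ≤ 1) :
    ε ≤ gridM P c ε x y := by
  obtain ⟨z, hz, hz'⟩ := h.gridM_eq ε hx hxy hy
  have := xiGam_nonneg (P := P) (c := c) (hx.trans hz.1.le)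
  linarith

lemma gridM_mono (h : NoGap P c) (ε : ℝ) {x y w : ℝ} (hx : 0 ≤ x) (hxy : x < y) (hyw : y < w)
    (hw : w ≤ 1) : gridM P c ε x y ≤ gridM P c ε y w := by
  obtain ⟨z, hz, hz'⟩ := h.gridM_eq ε hx hxy (hyw.le.trans hw)
  obtain ⟨t, ht, ht'⟩ := h.gridM_eq ε (hx.trans hxy.le) hyw hw
  have := h.xiGam_mono ⟨hx.trans_lt hz.1, hz.2.trans (hyw.trans_le hw)⟩
    ⟨(hx.trans hxy.le).trans_lt ht.1, ht.2.trans_le hw⟩ (hz.2.trans ht.1).le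
  linarith

lemma gridB_pos (h : NoGap P c) {ε x : ℝ} (hε : 0 ≤ ε) (hx : 0 ≤ x) (hx1 : x ≤ 1) :
    0 < gridB P c ε x :=
  add_pos_of_pos_of_nonneg (h.xiS_pos hx hx1) (mul_nonneg hε (xiD1_nonneg hx))

lemma gridB_lt (h : NoGap P c) {ε x y : ℝ} (hε : 0 < ε) (hx : 0 ≤ x) (hxy : x < y) (hy : y ≤ 1) :
    gridB P c ε x < gridB P c ε y :=
  add_lt_add_of_le_of_lt (xiS_mono hx hxy.le) (mul_lt_mul_of_pos_left (h.xiD1_lt hx hxy hy) hε)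

end NoGap

/-- The branching numbers of the tree. -/
def gridBranch (P : ℕ) (c : ℕ → ℝ) (ε : ℝ) (N : ℕ) (q q' : ℝ) : ℕ :=
  ⌈Real.exp (gridM P c ε q q' ^ 2 * (N * (xiTheta P c q' - xiTheta P c q)) / 2)⌉₊

lemma le_log_gridBranch (ε : ℝ) (N : ℕ) (q q' : ℝ) :
    gridM P c ε q q' ^ 2 * (N * (xiTheta P c q' - xiTheta P c q)) / 2
      ≤ Real.log (gridBranch P c ε N q q' + 1) := by
  rw [Real.le_log_iff_exp_le (by positivity)]
  exact (Nat.le_ceil _).trans (le_add_of_nonneg_right zero_le_one)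

lemma log_gridBranch_le (ε : ℝ) (N : ℕ) {q q' : ℝ} (hq : xiTheta P c q ≤ xiTheta P c q') :
    Real.log (gridBranch P c ε N q q' + 1)
      ≤ gridM P c ε q q' ^ 2 * (N * (xiTheta P c q' - xiTheta P c q)) / 2 + 2 := by
  obtain ⟨x, hx⟩ : ∃ x, x = gridM P c ε q q' ^ 2 * (N * (xiTheta P c q' - xiTheta P c q)) / 2 :=
    ⟨_, rfl⟩
  have hx0 : 0 ≤ x := by
    rw [hx]
    have := sub_nonneg.2 hq
    positivity
  rw [← hx, Real.log_le_iff_le_exp (by positivity), gridBranch, ← hx, Real.exp_add]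
  have h1 := Nat.ceil_lt_add_one (Real.exp_pos x).le
  have h2 := Real.one_le_exp hx0
  have h3 : (3 : ℝ) ≤ Real.exp 2 := by linarith [Real.add_one_le_exp (2 : ℝ)]
  nlinarith

end Grid

section FixedSize

variable {N P : ℕ} {c : ℕ → ℝ}

lemma NoGap.tree_lower_term (h : NoGap P c) {ε β : ℝ} (hε : 0 < ε) (hβ : 0 < β) {x y : ℝ}
    (hx : 0 ≤ x) (hxy : x < y) (hy : y ≤ 1) :
    β * (N * (gridM P c ε x y * (xiTheta P c y - xiTheta P c x))
        - 14 * (√N * √(xiTheta P c y - xiTheta P c x)))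
      ≤ √(β ^ 2 * N * xiTheta P c y - β ^ 2 * N * xiTheta P c x)
        * (√(2 * Real.log (gridBranch P c ε N x y + 1)) - 14) := by
  have hm := hε.trans_le (h.le_gridM ε hx hxy hy)
  have hθ : 0 ≤ xiTheta P c y - xiTheta P c x := sub_nonneg.2 (xiTheta_mono hx hxy.le)
  have e1 : √(β ^ 2 * N * xiTheta P c y - β ^ 2 * N * xiTheta P c x)
      = β * (√N * √(xiTheta P c y - xiTheta P c x)) := by
    rw [← mul_sub, mul_assoc, Real.sqrt_mul (by positivity), Real.sqrt_sq hβ.le,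
      Real.sqrt_mul (by positivity)]
  have e2 : gridM P c ε x y * (√N * √(xiTheta P c y - xiTheta P c x))
      ≤ √(2 * Real.log (gridBranch P c ε N x y + 1)) := by
    refine Real.le_sqrt_of_sq_le ?_
    rw [mul_pow, mul_pow, Real.sq_sqrt (by positivity), Real.sq_sqrt hθ]
    linarith [le_log_gridBranch (P := P) (c := c) ε N x y]
  rw [e1]
  have e3 : N * (xiTheta P c y - xiTheta P c x)
      = (√N * √(xiTheta P c y - xiTheta P c x)) ^ 2 := by
    rw [mul_pow, Real.sq_sqrt (by positivity), Real.sq_sqrt hθ]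
  have e4 := mul_le_mul_of_nonneg_left e2
    (by positivity : 0 ≤ β * (√N * √(xiTheta P c y - xiTheta P c x)))
  calc _ = β * (√N * √(xiTheta P c y - xiTheta P c x))
        * (gridM P c ε x y * (√N * √(xiTheta P c y - xiTheta P c x)))
        - β * (√N * √(xiTheta P c y - xiTheta P c x)) * 14 := by
          linear_combination β * gridM P c ε x y * e3
    _ ≤ _ := by linarith

lemma NoGap.tree_upper_term (h : NoGap P c) {ε : ℝ} (hε : 0 < ε) {x y : ℝ}
    (hx : 0 ≤ x) (hxy : x < y) (hy : y ≤ 1) :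
    (xiD1 P c y - xiD1 P c x) / (gridB P c ε y - gridB P c ε x)
        * (Real.log (gridBranch P c ε N x y + 1)
          + (N : ℝ) / 2 * Real.log (gridB P c ε y / gridB P c ε x))
      ≤ N * (gridM P c ε x y * (xiTheta P c y - xiTheta P c x)) / 2 + 2 / ε
        + N * ((xiD1 P c y - xiD1 P c x) / gridB P c ε x) / 2 := by
  have hεm := h.le_gridM ε hx hxy hy
  have hm := hε.trans_le hεm
  have hΔ := sub_pos.2 (h.xiD1_lt hx hxy hy)
  have hB := h.gridB_pos hε.le hx (hxy.le.trans hy)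
  have hB' := h.gridB_pos hε.le (hx.trans hxy.le) hy
  have hd := sub_pos.2 (h.gridB_lt hε hx hxy hy)
  have e1 : (xiD1 P c y - xiD1 P c x) / (gridB P c ε y - gridB P c ε x)
      = (gridM P c ε x y)⁻¹ := by
    rw [gridM, inv_div]
  have e2 := log_gridBranch_le (P := P) (c := c) ε N (xiTheta_mono hx hxy.le)
  have e3 : Real.log (gridB P c ε y / gridB P c ε x)
      ≤ (gridB P c ε y - gridB P c ε x) / gridB P c ε x := by
    refine (Real.log_le_sub_one_of_pos (div_pos hB' hB)).trans (le_of_eq ?_)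
    field_simp
  have e4 : (gridM P c ε x y)⁻¹ * ((gridB P c ε y - gridB P c ε x) / gridB P c ε x)
      = (xiD1 P c y - xiD1 P c x) / gridB P c ε x := by
    rw [← e1]
    field_simp
  have e5 := mul_le_mul_of_nonneg_left e3 (inv_pos.2 hm).le
  rw [e4] at e5
  have e6 := mul_le_mul_of_nonneg_left e2 (inv_pos.2 hm).le
  have e7 : (gridM P c ε x y)⁻¹ * 2 ≤ 2 / ε := by
    rw [div_eq_inv_mul]
    gcongr
  have e8 : (gridM P c ε x y)⁻¹ * (gridM P c ε x y ^ 2 *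
      (N * (xiTheta P c y - xiTheta P c x)) / 2)
      = N * (gridM P c ε x y * (xiTheta P c y - xiTheta P c x)) / 2 := by
    field_simp
  rw [mul_add, e8] at e6
  rw [e1, mul_add]
  have e9 := mul_le_mul_of_nonneg_left e5 (by positivity : (0 : ℝ) ≤ N / 2)
  linarith

lemma NoGap.integral_psi_le (h : NoGap P c) (hN : 1 ≤ N) {r : ℕ} (hr : 1 ≤ r) {ε : ℝ} (hε : 0 < ε)
    {β : ℝ} (hβ0 : 0 < β)
    (hβ : ∀ i < r, gridM P c ε (i / r) ((i + 1 : ℕ) / r) ≤ β) {k : ℕ} (hk : 1 ≤ k) :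
    ∫ x, psi N P c x ∂(stdGaussian _)
      ≤ N * gridV P c ε r + β⁻¹ * (N * Real.log (3 * N ^ (P + 1))) + β⁻¹ * (4 * 64 ^ k)
        + 8 * (β * N * xiFun P c 1) * (15 / 16) ^ k
        + 14 * √N * ∑ i ∈ Finset.range r, √(xiTheta P c ((i + 1 : ℕ) / r) - xiTheta P c (i / r))
        + r * (2 / ε) + √(xiD1 P c 1) * (1 + P) * √N := by
  obtain ⟨n, a, ha, hn, hpsi⟩ := integral_psi_le_freeE (P := P) (c := c) hN hβ0
  have hN' : (1 : ℝ) ≤ N := by exact_mod_cast hN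
  have hr' : (0 : ℝ) < r := by exact_mod_cast hr
  obtain ⟨p, hp⟩ : ∃ p : ℕ → ℝ, p = fun i : ℕ => (i : ℝ) / r := ⟨_, rfl⟩
  have hp0 : p 0 = 0 := by simp [hp]
  have hpr : p r = 1 := by simp [hp, hr'.ne']
  have hpm : ∀ i < r, 0 ≤ p i ∧ p i < p (i + 1) ∧ p (i + 1) ≤ 1 := fun i hi => by
    simpa only [hp] using grid_mem hi
  have hlast := lastLevel_levels (gridBranch P c ε N) p r
  have hmono := treeMono_levels (gridBranch P c ε N) (h := id) (fun i hi => (hpm i hi).2.1.le)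
  have hslope : TreeSlope (xiD1 P c) (gridB P c ε) β (gridM P c ε (p 0) (p 1)) (p 0)
      (levels (gridBranch P c ε N) p r) := by
    refine treeSlope_levels _ (fun i hi => h.xiD1_lt (hpm i hi).1 (hpm i hi).2.1 (hpm i hi).2.2)
      (fun i hi => h.gridB_lt hε (hpm i hi).1 (hpm i hi).2.1 (hpm i hi).2.2)
      (fun i hi => by rw [hp]; exact hβ i hi) (fun _ => le_rfl) (fun i hi => ?_)
    exact h.gridM_mono ε (hpm i (by omega)).1 (hpm i (by omega)).2.1 (hpm (i + 1) hi).2.1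
      (hpm (i + 1) hi).2.2
  have hm0 : 0 < gridM P c ε (p 0) (p 1) :=
    hε.trans_le (h.le_gridM ε (hpm 0 hr).1 (hpm 0 hr).2.1 (hpm 0 hr).2.2)
  have hmβ : gridM P c ε (p 0) (p 1) ≤ β := by simpa only [hp] using hβ 0 hr
  have hkap := integral_LSE_norm_treeField_le (ι := Fin N) (r := √N) hβ0 hm0 hmβ
    (h.gridB_pos hε.le (hpm 0 hr).1 ((hpm 0 hr).2.1.le.trans (hpm 0 hr).2.2)) hslope
  have hlow := le_integral_LSE_tree (fun q => β ^ 2 * N * xiTheta P c q) (p 0)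
    (levels (gridBranch P c ε N) p r)
  rw [treeSum_levels] at hlow
  rw [treeKappa, treeSum_levels, hlast, hpr, Real.sq_sqrt (by positivity), Fintype.card_fin] at hkap
  rw [hpr] at hlast
  rw [hp0] at hlast hmono hkap hlow
  have hint := h.freeE_add_tree_le hN ha hβ0.le hk hmono hlast
  have hlow' := (Finset.sum_le_sum fun i hi => h.tree_lower_term (N := N) hε hβ0
    (hpm i (Finset.mem_range.1 hi)).1 (hpm i (Finset.mem_range.1 hi)).2.1
    (hpm i (Finset.mem_range.1 hi)).2.2).trans hlow
  have hup' := Finset.sum_le_sum fun i hi => h.tree_upper_term (N := N) hε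
    (hpm i (Finset.mem_range.1 hi)).1 (hpm i (Finset.mem_range.1 hi)).2.1
    (hpm i (Finset.mem_range.1 hi)).2.2
  have hlog : Real.log (n + 1) ≤ N * Real.log (3 * N ^ (P + 1)) := by
    rw [← Real.log_pow]
    refine Real.log_le_log (by positivity) ?_
    exact_mod_cast hn
  obtain ⟨A, hA⟩ : ∃ A, A = ∑ i ∈ Finset.range r,
    gridM P c ε (p i) (p (i + 1)) * (xiTheta P c (p (i + 1)) - xiTheta P c (p i)) := ⟨_, rfl⟩
  obtain ⟨D, hD⟩ : ∃ D, D = ∑ i ∈ Finset.range r,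
    √(xiTheta P c (p (i + 1)) - xiTheta P c (p i)) := ⟨_, rfl⟩
  obtain ⟨Q, hQ⟩ : ∃ Q, Q = ∑ i ∈ Finset.range r,
    (xiD1 P c (p (i + 1)) - xiD1 P c (p i)) / gridB P c ε (p i) := ⟨_, rfl⟩
  have hV : gridV P c ε r = (gridB P c ε 1 + (Q - A)) / 2 := by
    rw [hQ, hA, ← Finset.sum_sub_distrib, gridV, hp]
  have hD' : D = ∑ i ∈ Finset.range r,
      √(xiTheta P c ((i + 1 : ℕ) / r) - xiTheta P c (i / r)) := by
    rw [hD, hp]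
  rw [← hD', hV]
  rw [← Finset.mul_sum, Finset.sum_sub_distrib, ← Finset.mul_sum, ← Finset.mul_sum,
    ← Finset.mul_sum, ← hA, ← hD] at hlow'
  rw [Finset.sum_add_distrib, Finset.sum_add_distrib, Finset.sum_const, Finset.card_range,
    nsmul_eq_mul, ← Finset.sum_div, ← Finset.sum_div, ← Finset.mul_sum, ← Finset.mul_sum, ← hA,
    ← hQ] at hup'
  have hfree : freeE 0 (fun u => β • featV N P c (a u)) ≤ N * Real.log (3 * N ^ (P + 1))
      + β * (N * gridB P c ε 1 / 2 + (N * A / 2 + r * (2 / ε) + N * Q / 2))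
      + 4 * 64 ^ k + 8 * (β ^ 2 * N * xiFun P c 1) * (15 / 16) ^ k
      - β * (N * A - 14 * (√N * D)) := by
    have := mul_le_mul_of_nonneg_left hup' hβ0.le
    linarith
  have hfin := mul_le_mul_of_nonneg_left hfree (inv_pos.2 hβ0).le
  refine hpsi.trans ?_
  have hexp : β⁻¹ * (N * Real.log (3 * N ^ (P + 1))
      + β * (N * gridB P c ε 1 / 2 + (N * A / 2 + r * (2 / ε) + N * Q / 2))
      + 4 * 64 ^ k + 8 * (β ^ 2 * N * xiFun P c 1) * (15 / 16) ^ k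
      - β * (N * A - 14 * (√N * D)))
      = N * ((gridB P c ε 1 + (Q - A)) / 2) + β⁻¹ * (N * Real.log (3 * N ^ (P + 1)))
      + β⁻¹ * (4 * 64 ^ k) + 8 * (β * N * xiFun P c 1) * (15 / 16) ^ k + 14 * √N * D
      + r * (2 / ε) := by
    field_simp
    ring
  linarith

end FixedSize

section UpperLimit

variable {P : ℕ} {c : ℕ → ℝ}

lemma NoGap.gridV_term_le (h : NoGap P c) {ε : ℝ} (hε : 0 < ε) {x y : ℝ} (hx : 0 ≤ x) (hxy : x < y)
    (hy : y ≤ 1) :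
    (xiD1 P c y - xiD1 P c x) / gridB P c ε x
        - gridM P c ε x y * (xiTheta P c y - xiTheta P c x)
      ≤ 2 * (∫ t in x..y, xiS P c t) + (y - x) * (ε * xiD1 P c 1)
        + (y - x) * (xiS P c 1 / xiS P c 0 + 2) * (xiS P c y - xiS P c x)
        - (y * gridB P c ε y - x * gridB P c ε x) := by
  have hy0 := hx.trans hxy.le
  have hx1 := hxy.le.trans hy
  have hSx := h.xiS_pos hx hx1
  have hS0 := h.xiS_pos le_rfl zero_le_one
  have hS0x : xiS P c 0 ≤ xiS P c x := xiS_mono le_rfl hx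
  have hSxy : xiS P c x ≤ xiS P c y := xiS_mono hx hxy.le
  have hSy1 : xiS P c y ≤ xiS P c 1 := xiS_mono hy0 hy
  have hd : 0 < y - x := sub_pos.2 hxy
  have hint : xiS P c x * (y - x) ≤ ∫ t in x..y, xiS P c t := by
    have := intervalIntegral.integral_mono_on (μ := volume) hxy.le
      (intervalIntegrable_const (c := xiS P c x))
      (continuous_xiS.intervalIntegrable x y) fun t ht => xiS_mono hx ht.1
    rwa [intervalIntegral.integral_const, smul_eq_mul, mul_comm] at this
  have hm : x * (gridB P c ε y - gridB P c ε x)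
      ≤ gridM P c ε x y * (xiTheta P c y - xiTheta P c x) := by
    have hΔ := sub_pos.2 (h.xiD1_lt hx hxy hy)
    have e := mul_le_mul_of_nonneg_left (mul_xiD1_sub_le_xiTheta_sub (P := P) (c := c) hx hy0)
      (hε.le.trans (h.le_gridM ε hx hxy hy))
    refine le_trans (le_of_eq ?_) e
    rw [gridM]
    field_simp
  have hq : (xiD1 P c y - xiD1 P c x) / gridB P c ε x
      ≤ (y - x) * (xiS P c y + xiS P c 1 / xiS P c 0 * (xiS P c y - xiS P c x)) := by
    have e1 : (xiD1 P c y - xiD1 P c x) / gridB P c ε x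
        ≤ xiS P c y ^ 2 * (y - x) / xiS P c x := by
      rw [xiS_sq hy0]
      refine div_le_div₀ (mul_nonneg (xiD2_nonneg hy0) hd.le) (xiD1_sub_mem hx hxy.le).2 hSx ?_
      exact le_add_of_nonneg_right (mul_nonneg hε.le (xiD1_nonneg hx))
    have e2 : xiS P c y / xiS P c x ≤ xiS P c 1 / xiS P c 0 :=
      div_le_div₀ (xiS_nonneg _) hSy1 hS0 hS0x
    have e3 := mul_le_mul_of_nonneg_right e2 (sub_nonneg.2 hSxy)
    have e4 : xiS P c y ^ 2 * (y - x) / xiS P c x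
        = (y - x) * (xiS P c y + xiS P c y / xiS P c x * (xiS P c y - xiS P c x)) := by
      field_simp
      ring
    rw [e4] at e1
    refine e1.trans ?_
    gcongr
  have hB : gridB P c ε y ≤ xiS P c y + ε * xiD1 P c 1 := by
    rw [gridB]
    gcongr
    exact xiD1_mono hy0 hy
  have hB' := mul_le_mul_of_nonneg_left hB hd.le
  linarith

lemma NoGap.gridV_le (h : NoGap P c) {ε : ℝ} (hε : 0 < ε) {r : ℕ} (hr : 1 ≤ r) :
    gridV P c ε r ≤ (∫ t in (0 : ℝ)..1, xiS P c t) + ε * xiD1 P c 1 / 2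
      + (r : ℝ)⁻¹ * ((xiS P c 1 / xiS P c 0 + 2) * (xiS P c 1 - xiS P c 0) / 2) := by
  have hr' : (0 : ℝ) < r := by exact_mod_cast hr
  obtain ⟨F, hF⟩ : ∃ F : ℕ → ℝ, F = fun i : ℕ => 2 * (∫ t in (0 : ℝ)..(i / r : ℝ), xiS P c t)
    + (i / r : ℝ) * (ε * xiD1 P c 1) + (r : ℝ)⁻¹ * (xiS P c 1 / xiS P c 0 + 2) * xiS P c (i / r)
    - (i / r : ℝ) * gridB P c ε (i / r) := ⟨_, rfl⟩
  have key : ∑ i ∈ Finset.range r,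
      ((xiD1 P c ((i + 1 : ℕ) / r) - xiD1 P c (i / r)) / gridB P c ε (i / r)
        - gridM P c ε (i / r) ((i + 1 : ℕ) / r)
        * (xiTheta P c ((i + 1 : ℕ) / r) - xiTheta P c (i / r))) ≤ F r - F 0 := by
    rw [← Finset.sum_range_sub]
    refine Finset.sum_le_sum fun i hi => ?_
    obtain ⟨h0, h1, h2⟩ := grid_mem (Finset.mem_range.1 hi)
    refine (h.gridV_term_le hε h0 h1 h2).trans (le_of_eq ?_)
    have hd : ((i + 1 : ℕ) / r - i / r : ℝ) = (r : ℝ)⁻¹ := by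
      push_cast
      field_simp
      ring
    have hI := intervalIntegral.integral_interval_sub_left
      (continuous_xiS (P := P) (c := c).intervalIntegrable (μ := volume) 0 ((i + 1 : ℕ) / r : ℝ))
      (continuous_xiS (P := P) (c := c).intervalIntegrable (μ := volume) 0 (i / r : ℝ))
    rw [← hI, hF]
    linear_combination ((xiS P c 1 / xiS P c 0 + 2) * (xiS P c ((i + 1 : ℕ) / r) - xiS P c (i / r)))
      * hd
  have hF' : F r - F 0 = 2 * (∫ t in (0 : ℝ)..1, xiS P c t) + ε * xiD1 P c 1
      + (r : ℝ)⁻¹ * (xiS P c 1 / xiS P c 0 + 2) * (xiS P c 1 - xiS P c 0) - gridB P c ε 1 := by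
    simp only [hF, div_self hr'.ne', Nat.cast_zero, zero_div, intervalIntegral.integral_same]
    ring
  rw [hF'] at key
  rw [gridV]
  linarith

lemma tendsto_nat_log_atTop : Tendsto (fun N : ℕ => Nat.log 100000 N) atTop atTop :=
  tendsto_atTop.2 fun b => (eventually_ge_atTop (100000 ^ b)).mono fun N hN =>
    Nat.le_log_of_pow_le (by norm_num) hN

lemma tendsto_log_scale (a b : ℝ) :
    Tendsto (fun j : ℕ => ((j : ℝ) ^ 2)⁻¹ * (a + b * (j + 1))) atTop (nhds 0) := by
  have h1 := tendsto_inv_atTop_nhds_zero_nat (𝕜 := ℝ)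
  have h2 := ((h1.pow 2).const_mul (a + b)).add (h1.const_mul b)
  simp only [ne_eq, OfNat.ofNat_ne_zero, not_false_eq_true, zero_pow, mul_zero, add_zero] at h2
  refine h2.congr' ?_
  filter_upwards [eventually_ge_atTop 1] with j hj
  have : (0 : ℝ) < j := by exact_mod_cast hj
  field_simp
  ring

lemma log_le_nat_log {N : ℕ} (hN : 1 ≤ N) (P : ℕ) :
    Real.log (3 * (N : ℝ) ^ (P + 1))
      ≤ Real.log 3 + (P + 1) * Real.log 100000 * ((Nat.log 100000 N : ℕ) + 1) := by
  have hN' : (0 : ℝ) < N := by exact_mod_cast hN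
  have h1 : (N : ℝ) ≤ 100000 ^ (Nat.log 100000 N + 1) := by
    exact_mod_cast (Nat.lt_pow_succ_log_self (by norm_num) N).le
  have h2 := Real.log_le_log hN' h1
  rw [Real.log_pow] at h2
  push_cast at h2
  rw [Real.log_mul (by norm_num) (by positivity), Real.log_pow]
  have h3 := mul_le_mul_of_nonneg_left h2 (by positivity : (0 : ℝ) ≤ P + 1)
  push_cast
  linarith

lemma tendsto_sqrt_nat_inv : Tendsto (fun N : ℕ => (√(N : ℝ))⁻¹) atTop (nhds 0) :=
  tendsto_inv_atTop_zero.comp (Real.tendsto_sqrt_atTop.comp tendsto_natCast_atTop_atTop)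

lemma NoGap.eventually_integral_psi_le_grid (h : NoGap P c) {r : ℕ} (hr : 1 ≤ r) {ε : ℝ}
    (hε : 0 < ε) {η : ℝ} (hη : 0 < η) :
    ∀ᶠ N : ℕ in atTop, (∫ x, psi N P c x ∂(stdGaussian _)) / N ≤ gridV P c ε r + η := by
  obtain ⟨b, hb⟩ : ∃ b : ℝ, ∀ i < r, gridM P c ε (i / r) ((i + 1 : ℕ) / r) ≤ b := by
    obtain ⟨b, hb⟩ := ((Finset.range r).image
      fun i : ℕ => gridM P c ε (i / r) ((i + 1 : ℕ) / r)).exists_le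
    exact ⟨b, fun i hi => hb _ (Finset.mem_image_of_mem _ (Finset.mem_range.2 hi))⟩
  obtain ⟨D, hD⟩ : ∃ D, D = 14 * (∑ i ∈ Finset.range r,
    √(xiTheta P c ((i + 1 : ℕ) / r) - xiTheta P c (i / r))) + √(xiD1 P c 1) * (1 + P) := ⟨_, rfl⟩
  have hlim : Tendsto (fun N : ℕ =>
      (((Nat.log 100000 N : ℕ) : ℝ) ^ 2)⁻¹ * (Real.log 3
          + (P + 1) * Real.log 100000 * ((Nat.log 100000 N : ℕ) + 1))
      + 4 * ((((Nat.log 100000 N : ℕ) : ℝ) ^ 2)⁻¹ * (64 / 100000) ^ (Nat.log 100000 N))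
      + 8 * xiFun P c 1 * (((Nat.log 100000 N : ℕ) : ℝ) ^ 2 * (15 / 16) ^ (Nat.log 100000 N))
      + D * (√(N : ℝ))⁻¹ + r * (2 / ε) * (N : ℝ)⁻¹) atTop (nhds 0) := by
    have l1 := (tendsto_log_scale (Real.log 3) ((P + 1) * Real.log 100000)).comp
      tendsto_nat_log_atTop
    have l2 : Tendsto (fun j : ℕ => 4 * (((j : ℝ) ^ 2)⁻¹ * (64 / 100000) ^ j)) atTop (nhds 0) := by
      have := (((tendsto_inv_atTop_nhds_zero_nat (𝕜 := ℝ)).pow 2).mul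
        (tendsto_pow_atTop_nhds_zero_of_lt_one (r := (64 / 100000 : ℝ)) (by norm_num)
          (by norm_num))).const_mul 4
      simpa using this
    have l3 := (tendsto_pow_const_mul_const_pow_of_abs_lt_one 2
      (r := (15 / 16 : ℝ)) (by norm_num [abs_lt])).const_mul (8 * xiFun P c 1)
    have l4 := tendsto_sqrt_nat_inv.const_mul D
    have l5 := (tendsto_inv_atTop_nhds_zero_nat (𝕜 := ℝ)).const_mul (r * (2 / ε))
    have := (((l1.add (l2.comp tendsto_nat_log_atTop)).add (l3.comp tendsto_nat_log_atTop)).add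
      l4).add l5
    simp only [mul_zero, add_zero] at this
    exact this
  filter_upwards [hlim.eventually (gt_mem_nhds hη), eventually_ge_atTop 1,
    tendsto_nat_log_atTop.eventually_ge_atTop 1,
    tendsto_nat_log_atTop.eventually_ge_atTop ⌈b⌉₊] with N hN hN1 hj1 hjb
  have hpow : (100000 : ℝ) ^ Nat.log 100000 N ≤ N := by
    exact_mod_cast Nat.pow_log_le_self 100000 (by omega)
  have hlog := log_le_nat_log hN1 P
  obtain ⟨j, hj⟩ : ∃ j, j = Nat.log 100000 N := ⟨_, rfl⟩
  rw [← hj] at hN hj1 hjb hpow hlog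
  have hN' : (0 : ℝ) < N := by exact_mod_cast hN1
  have hj' : (1 : ℝ) ≤ j := by exact_mod_cast hj1
  have hjb' : b ≤ j := (Nat.le_ceil b).trans (by exact_mod_cast hjb)
  have hj2 : (j : ℝ) ≤ (j : ℝ) ^ 2 := by nlinarith
  have hmain := h.integral_psi_le hN1 hr hε (β := (j : ℝ) ^ 2) (by positivity)
    (fun i hi => (hb i hi).trans (hjb'.trans hj2)) hj1
  have hs : √(N : ℝ) = N * (√(N : ℝ))⁻¹ := by
    have := Real.mul_self_sqrt hN'.le
    field_simp
    linarith
  have h64 : (64 : ℝ) ^ j ≤ N * (64 / 100000) ^ j := by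
    rw [div_pow, mul_div_assoc', le_div_iff₀ (by positivity), mul_comm (N : ℝ)]
    gcongr
  have e1 := mul_le_mul_of_nonneg_left h64 (by positivity : (0 : ℝ) ≤ 4 * ((j : ℝ) ^ 2)⁻¹)
  have e2 := mul_le_mul_of_nonneg_left hlog (by positivity : (0 : ℝ) ≤ N * ((j : ℝ) ^ 2)⁻¹)
  have e3 := mul_le_mul_of_nonneg_left hN.le hN'.le
  have e4 : (r : ℝ) * (2 / ε) = N * (r * (2 / ε) * (N : ℝ)⁻¹) := by field_simp
  have e5 : 14 * √(N : ℝ) * (∑ i ∈ Finset.range r,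
      √(xiTheta P c ((i + 1 : ℕ) / r) - xiTheta P c (i / r))) + √(xiD1 P c 1) * (1 + P) * √(N : ℝ)
      = N * (D * (√(N : ℝ))⁻¹) := by
    rw [hD]
    linear_combination (14 * (∑ i ∈ Finset.range r,
      √(xiTheta P c ((i + 1 : ℕ) / r) - xiTheta P c (i / r))) + √(xiD1 P c 1) * (1 + P)) * hs
  rw [div_le_iff₀ hN']
  linarith

lemma NoGap.eventually_integral_psi_le (h : NoGap P c) {η : ℝ} (hη : 0 < η) :
    ∀ᶠ N : ℕ in atTop,
      (∫ x, psi N P c x ∂(stdGaussian _)) / N ≤ (∫ t in (0 : ℝ)..1, xiS P c t) + η := by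
  have hD1 := xiD1_one_nonneg P c
  obtain ⟨ε, hε, hε'⟩ : ∃ ε : ℝ, 0 < ε ∧ ε * xiD1 P c 1 / 2 ≤ η / 3 := by
    refine ⟨η / (3 * (xiD1 P c 1 + 1)), by positivity, ?_⟩
    rw [div_mul_eq_mul_div, div_div, div_le_div_iff₀ (by positivity) (by norm_num)]
    nlinarith
  have hlim := (tendsto_inv_atTop_nhds_zero_nat (𝕜 := ℝ)).mul_const
    ((xiS P c 1 / xiS P c 0 + 2) * (xiS P c 1 - xiS P c 0) / 2)
  rw [zero_mul] at hlim
  obtain ⟨r, hr, hr1⟩ := ((hlim.eventually_lt_const (by positivity : 0 < η / 3)).and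
    (eventually_ge_atTop 1)).exists
  filter_upwards [h.eventually_integral_psi_le_grid hr1 hε (η := η / 3) (by positivity)] with N hN
  linarith [h.gridV_le hε hr1]

end UpperLimit

section GaussianNorm

variable {E : Type*} [NormedAddCommGroup E] [InnerProductSpace ℝ E] [FiniteDimensional ℝ E]
  [MeasurableSpace E] [BorelSpace E] {ι : Type*} [Fintype ι]

lemma inv_sqrt_tangent_le {y z : ℝ} (hy : 0 < y) (hz : 0 < z) :
    (√z)⁻¹ - (2 * z * √z)⁻¹ * (y - z) ≤ (√y)⁻¹ := by
  have hu := Real.sqrt_pos.2 hy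
  have hv := Real.sqrt_pos.2 hz
  obtain ⟨u, hu'⟩ : ∃ u, u = √y := ⟨_, rfl⟩
  obtain ⟨v, hv'⟩ : ∃ v, v = √z := ⟨_, rfl⟩
  have hy' : y = u ^ 2 := by rw [hu', Real.sq_sqrt hy.le]
  have hz' : z = v ^ 2 := by rw [hv', Real.sq_sqrt hz.le]
  rw [← hu'] at hu ⊢
  rw [← hv'] at hv ⊢
  have key : u⁻¹ - (v⁻¹ - (2 * z * v)⁻¹ * (y - z)) = (u - v) ^ 2 * (u + 2 * v) / (2 * u * v ^ 3) := by
    rw [hy', hz']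
    field_simp
    ring
  have : 0 ≤ (u - v) ^ 2 * (u + 2 * v) / (2 * u * v ^ 3) := by positivity
  linarith

lemma integrable_sqrt_sum_inner_sq (a : ι → E) :
    Integrable (fun g => √(∑ i, ⟪a i, g⟫ ^ 2)) (stdGaussian E) := by
  have h1 : Integrable (fun g : E => 1 + ∑ i, ⟪a i, g⟫ ^ 2) (stdGaussian E) :=
    (integrable_const 1).add (integrable_finsetSum _ fun i _ => integrable_inner_sq (a i))
  refine h1.mono' (by fun_prop) (ae_of_all _ fun g => ?_)
  have h2 : 0 ≤ ∑ i, ⟪a i, g⟫ ^ 2 := by positivity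
  rw [Real.norm_of_nonneg (Real.sqrt_nonneg _)]
  nlinarith [Real.sq_sqrt h2, sq_nonneg (√(∑ i, ⟪a i, g⟫ ^ 2) - 1)]

lemma stein_normalized {a : ι → E} (ha : Orthonormal ℝ a) (l : ι) :
    ∫ g, ⟪a l, g⟫ * (⟪a l, g⟫ * (√(1 + ∑ i, ⟪a i, g⟫ ^ 2))⁻¹) ∂(stdGaussian E)
      = ∫ g, ((√(1 + ∑ i, ⟪a i, g⟫ ^ 2))⁻¹
        - ⟪a l, g⟫ ^ 2 * (√(1 + ∑ i, ⟪a i, g⟫ ^ 2))⁻¹ ^ 3) ∂(stdGaussian E) := by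
  classical
  have hY : ∀ g : E, ⟪a l, g⟫ ^ 2 ≤ ∑ i, ⟪a i, g⟫ ^ 2 := fun g =>
    Finset.single_le_sum (f := fun i => ⟪a i, g⟫ ^ 2) (fun i _ => sq_nonneg _) (Finset.mem_univ l)
  have hall : ∀ i, ⟪a i, a l⟫ = if i = l then 1 else 0 := fun i => by
    rw [orthonormal_iff_ite.1 ha]
  have hpos : ∀ g : E, 0 < 1 + ∑ i, ⟪a i, g⟫ ^ 2 := fun g => by positivity
  have hle1 : ∀ g : E, ⟪a l, g⟫ ^ 2 * (√(1 + ∑ i, ⟪a i, g⟫ ^ 2))⁻¹ ^ 2 ≤ 1 := fun g => by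
    rw [inv_pow, Real.sq_sqrt (hpos g).le, ← div_eq_mul_inv, div_le_one (hpos g)]
    linarith [hY g]
  have hρ1 : ∀ g : E, (√(1 + ∑ i, ⟪a i, g⟫ ^ 2))⁻¹ ≤ 1 := fun g => by
    refine inv_le_one_of_one_le₀ (Real.one_le_sqrt.2 ?_)
    linarith [hY g, sq_nonneg ⟪a l, g⟫]
  refine stein (C := 1) (fun g => ?_) (fun g => ?_) (fun g => ?_) (by fun_prop) (by fun_prop)
  · have hx : ∀ s : ℝ, ⟪a l, g + s • a l⟫ = ⟪a l, g⟫ + s := fun s => by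
      rw [inner_add_right, real_inner_smul_right, hall, if_pos rfl, mul_one]
    have hYs : ∀ s : ℝ, ∑ i, ⟪a i, g + s • a l⟫ ^ 2
        = ∑ i, ⟪a i, g⟫ ^ 2 + (2 * ⟪a l, g⟫ * s + s ^ 2) := fun s => by
      have : ∀ i, ⟪a i, g + s • a l⟫ ^ 2
          = ⟪a i, g⟫ ^ 2 + if i = l then 2 * ⟪a l, g⟫ * s + s ^ 2 else 0 := fun i => by
        rw [inner_add_right, real_inner_smul_right, hall]
        split_ifs with h
        · rw [h]; ring
        · ring
      simp_rw [this]
      rw [Finset.sum_add_distrib, Finset.sum_ite_eq' Finset.univ l, if_pos (Finset.mem_univ l)]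
    simp_rw [hx, hYs]
    obtain ⟨Y, hYd⟩ : ∃ Y, Y = ∑ i, ⟪a i, g⟫ ^ 2 := ⟨_, rfl⟩
    obtain ⟨x, hxd⟩ : ∃ x, x = ⟪a l, g⟫ := ⟨_, rfl⟩
    have hp := hpos g
    rw [← hYd] at hp ⊢
    rw [← hxd]
    have d1 : HasDerivAt (fun s : ℝ => 1 + (Y + (2 * x * s + s ^ 2))) (2 * x) 0 := by
      have := (((hasDerivAt_id (0 : ℝ)).const_mul (2 * x)).add (hasDerivAt_pow 2 (0 : ℝ)))
      refine ((this.const_add Y).const_add 1).congr_deriv ?_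
      simp
    have d2 : HasDerivAt (fun s : ℝ => x + s) 1 0 := (hasDerivAt_id (0 : ℝ)).const_add x
    have hne : 1 + (Y + (2 * x * 0 + (0 : ℝ) ^ 2)) = 1 + Y := by ring
    have d3 := d2.mul ((d1.sqrt (by rw [hne]; exact hp.ne')).inv
      (by rw [hne]; exact (Real.sqrt_pos.2 hp).ne'))
    refine d3.congr_deriv ?_
    simp only [Pi.inv_apply, hne]
    have := (Real.sqrt_pos.2 hp).ne'
    field_simp
    ring
  · rw [← sq_le_one_iff_abs_le_one, mul_pow]
    exact hle1 g
  · have h0 : 0 ≤ (√(1 + ∑ i, ⟪a i, g⟫ ^ 2))⁻¹ := by positivity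
    have e := mul_le_mul_of_nonneg_right (hle1 g) h0
    have e' : 0 ≤ ⟪a l, g⟫ ^ 2 * (√(1 + ∑ i, ⟪a i, g⟫ ^ 2))⁻¹ ^ 3 := by positivity
    rw [abs_le]
    constructor
    · linarith [hρ1 g]
    · linarith [hρ1 g]

/-- The expected norm of a standard Gaussian vector in dimension `n` is at least
`(n - 1) / √(n + 1)`. -/
lemma le_integral_sqrt_sum_inner_sq [Nonempty ι] {a : ι → E} (ha : Orthonormal ℝ a) :
    ((Fintype.card ι : ℝ) - 1) * (√(Fintype.card ι + 1))⁻¹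
      ≤ ∫ g, √(∑ i, ⟪a i, g⟫ ^ 2) ∂(stdGaussian E) := by
  have hn : (1 : ℝ) ≤ Fintype.card ι := by exact_mod_cast Fintype.card_pos (α := ι)
  obtain ⟨n, hnd⟩ : ∃ n : ℝ, n = Fintype.card ι := ⟨_, rfl⟩
  rw [← hnd] at hn ⊢
  obtain ⟨Y, hY⟩ : ∃ Y : E → ℝ, Y = fun g => ∑ i, ⟪a i, g⟫ ^ 2 := ⟨_, rfl⟩
  have hYg : ∀ g, ∑ i, ⟪a i, g⟫ ^ 2 = Y g := fun g => by rw [hY]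
  have hY0 : ∀ g, 0 ≤ Y g := fun g => by rw [hY]; positivity
  have hYm : Measurable Y := by rw [hY]; fun_prop
  have hYi : Integrable Y (stdGaussian E) := by
    rw [hY]
    exact integrable_finsetSum _ fun i _ => integrable_inner_sq (a i)
  have hYint : ∫ g, Y g ∂(stdGaussian E) = n := by
    rw [hY, integral_finsetSum _ fun i _ => integrable_inner_sq (a i)]
    simp [integral_inner_sq, ha.1, hnd]
  have hρ1 : ∀ g, |(√(1 + Y g))⁻¹| ≤ 1 := fun g => by
    rw [abs_of_nonneg (by positivity)]
    exact inv_le_one_of_one_le₀ (Real.one_le_sqrt.2 (by linarith [hY0 g]))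
  have hρi : Integrable (fun g => (√(1 + Y g))⁻¹) (stdGaussian E) :=
    Integrable.of_bound (by fun_prop) 1 (ae_of_all _ hρ1)
  have hst := fun l => stein_normalized ha l
  simp_rw [hYg] at hst ⊢
  have hxY : ∀ l g, ⟪a l, g⟫ ^ 2 ≤ Y g := fun l g => by
    rw [hY]
    exact Finset.single_le_sum (f := fun i => ⟪a i, g⟫ ^ 2) (fun i _ => sq_nonneg _)
      (Finset.mem_univ l)
  have hi1 : ∀ l, Integrable (fun g => ⟪a l, g⟫ * (⟪a l, g⟫ * (√(1 + Y g))⁻¹))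
      (stdGaussian E) := fun l => by
    refine (integrable_inner_sq (a l)).mono' (by fun_prop) (ae_of_all _ fun g => ?_)
    rw [← mul_assoc, ← sq, Real.norm_eq_abs, abs_mul, abs_sq]
    exact mul_le_of_le_one_right (sq_nonneg _) (hρ1 g)
  have hi2 : ∀ l, Integrable (fun g => (√(1 + Y g))⁻¹ - ⟪a l, g⟫ ^ 2 * (√(1 + Y g))⁻¹ ^ 3)
      (stdGaussian E) := fun l => by
    refine hρi.sub ((integrable_inner_sq (a l)).mono' (by fun_prop) (ae_of_all _ fun g => ?_))
    rw [Real.norm_eq_abs, abs_mul, abs_sq, abs_pow]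
    exact mul_le_of_le_one_right (sq_nonneg _) (pow_le_one₀ (abs_nonneg _) (hρ1 g))
  have hsum := Finset.sum_congr rfl fun l (_ : l ∈ Finset.univ) => hst l
  rw [← integral_finsetSum _ fun l _ => hi1 l, ← integral_finsetSum _ fun l _ => hi2 l] at hsum
  have hYn : Integrable (fun g => Y g - n) (stdGaussian E) := hYi.sub (integrable_const n)
  calc (n - 1) * (√(n + 1))⁻¹
      = ∫ g, (n - 1) * ((√(1 + n))⁻¹ - (2 * (1 + n) * √(1 + n))⁻¹ * (Y g - n))
          ∂(stdGaussian E) := by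
        rw [integral_const_mul, integral_sub (integrable_const _)
          (hYn.const_mul _), integral_const_mul,
          integral_sub hYi (integrable_const n), hYint]
        simp [add_comm]
    _ ≤ ∫ g, ∑ l, ((√(1 + Y g))⁻¹ - ⟪a l, g⟫ ^ 2 * (√(1 + Y g))⁻¹ ^ 3) ∂(stdGaussian E) := by
        refine integral_mono (((integrable_const _).sub
          (hYn.const_mul _)).const_mul _)
          (integrable_finsetSum _ fun l _ => hi2 l) fun g => ?_
        dsimp only
        have hp : 0 < 1 + Y g := by linarith [hY0 g]
        rw [Finset.sum_sub_distrib, Finset.sum_const, ← Finset.sum_mul, hYg, Finset.card_univ,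
          nsmul_eq_mul, ← hnd]
        have h1 := mul_le_mul_of_nonneg_left
          (inv_sqrt_tangent_le hp (by linarith : 0 < 1 + n)) (by linarith : 0 ≤ n - 1)
        have h2 : Y g * (√(1 + Y g))⁻¹ ^ 3 ≤ (√(1 + Y g))⁻¹ := by
          rw [pow_succ, ← mul_assoc]
          refine mul_le_of_le_one_left (by positivity) ?_
          rw [inv_pow, Real.sq_sqrt hp.le, ← div_eq_mul_inv, div_le_one hp]
          linarith
        rw [show 1 + Y g - (1 + n) = Y g - n by ring] at h1
        linarith
    _ = ∫ g, ∑ l, ⟪a l, g⟫ * (⟪a l, g⟫ * (√(1 + Y g))⁻¹) ∂(stdGaussian E) := hsum.symm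
    _ ≤ ∫ g, √(Y g) ∂(stdGaussian E) := by
        have hi := integrable_sqrt_sum_inner_sq a
        simp_rw [hYg] at hi
        refine integral_mono (integrable_finsetSum _ fun l _ => hi1 l) hi fun g => ?_
        dsimp only
        simp_rw [← mul_assoc, ← sq]
        rw [← Finset.sum_mul, hYg, ← div_eq_mul_inv]
        refine div_le_of_le_mul₀ (Real.sqrt_nonneg _) (Real.sqrt_nonneg _) ?_
        rw [← Real.sqrt_mul (hY0 g)]
        exact Real.le_sqrt_of_sq_le (by nlinarith [hY0 g])

end GaussianNorm

section Alignment

variable {E : Type*} [NormedAddCommGroup E] [InnerProductSpace ℝ E] [FiniteDimensional ℝ E]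
  [MeasurableSpace E] [BorelSpace E]

/-- Rotating the component of a Gaussian vector in `W` onto the direction `b` does not change the
expectation of an invariant function. -/
lemma integral_align {S : Set (E ≃ₗᵢ[ℝ] E)} {W : Submodule ℝ E} {b : E}
    (hcomm : ∀ U ∈ S, ∀ x, W.starProjection (U x) = U (W.starProjection x))
    (htrans : ∀ x ∈ W, ∃ U ∈ S, U x = ‖x‖ • b)
    {Φ : E → ℝ} (hΦ : Measurable Φ) (hinv : ∀ U ∈ S, ∀ x, Φ (U x) = Φ x)
    (hi : Integrable Φ (stdGaussian E))
    (hi' : Integrable (fun x => Φ (x + (‖W.starProjection x‖ • b - W.starProjection x)))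
      (stdGaussian E)) :
    ∫ x, Φ (x + (‖W.starProjection x‖ • b - W.starProjection x)) ∂(stdGaussian E)
      = ∫ x, Φ x ∂(stdGaussian E) := by
  have hidem : ∀ x, W.starProjection (W.starProjection x) = W.starProjection x := fun x =>
    Submodule.starProjection_eq_self_iff.2 (W.starProjection_apply_mem x)
  have hmap := map_resample W.starProjection W.inner_starProjection_left_eq_right hidem
  have hm : Measurable (fun g : E × E => W.starProjection g.1 + (g.2 - W.starProjection g.2)) := by
    fun_prop
  have hΦ' : Measurable fun x => Φ (x + (‖W.starProjection x‖ • b - W.starProjection x)) :=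
    hΦ.comp (by fun_prop)
  have e : ∀ F : E → ℝ, Measurable F → Integrable F (stdGaussian E) →
      ∫ x, F x ∂(stdGaussian E) = ∫ x, ∫ y, F (W.starProjection x + (y - W.starProjection y))
        ∂(stdGaussian E) ∂(stdGaussian E) := by
    intro F hF hFi
    rw [← hmap] at hFi
    have h2 := (integrable_map_measure hF.aestronglyMeasurable hm.aemeasurable).1 hFi
    conv_lhs => rw [← hmap]
    rw [integral_map hm.aemeasurable hF.aestronglyMeasurable]
    exact integral_prod _ h2
  rw [e _ hΦ' hi', e _ hΦ hi]
  refine integral_congr_ae (ae_of_all _ fun x => ?_)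
  dsimp only
  have hz : ∀ y, W.starProjection (W.starProjection x + (y - W.starProjection y))
      = W.starProjection x := fun y => by
    rw [map_add, map_sub, hidem, hidem, sub_self, add_zero]
  simp_rw [hz]
  obtain ⟨U, hU, hUx⟩ := htrans _ (W.starProjection_apply_mem x)
  have h1 : ∀ y, Φ (W.starProjection x + (y - W.starProjection y))
      = Φ (‖W.starProjection x‖ • b + (U y - W.starProjection (U y))) := fun y => by
    rw [← hinv U hU, map_add, map_sub, hUx, hcomm U hU]
  have h2 : ∀ y, W.starProjection x + (y - W.starProjection y)
      + (‖W.starProjection x‖ • b - W.starProjection x)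
      = ‖W.starProjection x‖ • b + (y - W.starProjection y) := fun y => by abel
  simp_rw [h1, h2]
  conv_lhs => rw [← stdGaussian_map U]
  rw [integral_map (by fun_prop)]
  exact (hΦ.comp (by fun_prop)).aestronglyMeasurable

/-- Successively rotate the components of `x` in the subspaces `W j`, `j < k`, onto `b j`. -/
def alignMap (W : ℕ → Submodule ℝ E) (b : ℕ → E) (k : ℕ) (x : E) : E :=
  x + ∑ j ∈ Finset.range k, (‖(W j).starProjection x‖ • b j - (W j).starProjection x)

lemma continuous_alignMap (W : ℕ → Submodule ℝ E) (b : ℕ → E) (k : ℕ) :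
    Continuous (alignMap W b k) := by
  unfold alignMap
  fun_prop

lemma norm_alignMap_le (W : ℕ → Submodule ℝ E) {b : ℕ → E} {k : ℕ} (hb : ∀ j < k, ‖b j‖ = 1)
    (x : E) : ‖alignMap W b k x‖ ≤ (1 + k * 2) * ‖x‖ := by
  have h : ∀ j ∈ Finset.range k,
      ‖‖(W j).starProjection x‖ • b j - (W j).starProjection x‖ ≤ 2 * ‖x‖ := fun j hj => by
    have h1 := (W j).norm_starProjection_apply_le x
    refine (norm_sub_le _ _).trans ?_
    rw [norm_smul, hb j (Finset.mem_range.1 hj), norm_norm]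
    linarith
  refine (norm_add_le _ _).trans ?_
  have := norm_sum_le_of_le _ h
  rw [Finset.sum_const, Finset.card_range, nsmul_eq_mul] at this
  linarith

lemma integral_alignMap {W : ℕ → Submodule ℝ E} {b : ℕ → E} {S : ℕ → Set (E ≃ₗᵢ[ℝ] E)} {K : ℕ}
    (hb : ∀ j < K, b j ∈ W j) (hb1 : ∀ j < K, ‖b j‖ = 1)
    (horth : ∀ i j, i < j → j < K → W i ⟂ W j)
    (hcomm : ∀ j k, j ≤ k → k < K → ∀ U ∈ S k, ∀ x,
      (W j).starProjection (U x) = U ((W j).starProjection x))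
    (hfix : ∀ j k, j < k → k < K → ∀ U ∈ S k, U (b j) = b j)
    (htrans : ∀ k < K, ∀ x ∈ W k, ∃ U ∈ S k, U x = ‖x‖ • b k)
    {Φ : E → ℝ} (hΦ : Continuous Φ) {C : ℝ} (hC : 0 ≤ C) (hΦC : ∀ x, |Φ x| ≤ C * ‖x‖)
    (hinv : ∀ k < K, ∀ U ∈ S k, ∀ x, Φ (U x) = Φ x) {k : ℕ} (hk : k ≤ K) :
    ∫ x, Φ (alignMap W b k x) ∂(stdGaussian E) = ∫ x, Φ x ∂(stdGaussian E) := by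
  have hi : ∀ k ≤ K, Integrable (fun x => Φ (alignMap W b k x)) (stdGaussian E) := fun k hk => by
    refine ((integrable_norm_stdGaussian (E := E)).const_mul (C * (1 + k * 2))).mono'
      (hΦ.comp (continuous_alignMap W b k)).aestronglyMeasurable (ae_of_all _ fun x => ?_)
    refine (hΦC _).trans ?_
    rw [mul_assoc]
    exact mul_le_mul_of_nonneg_left
      (norm_alignMap_le W (fun j hj => hb1 j (hj.trans_le hk)) x) hC
  induction k with
  | zero => simp [alignMap]
  | succ k ih =>
    rw [← ih (by omega)]
    have hstep : ∀ x, alignMap W b (k + 1) x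
        = alignMap W b k (x + (‖(W k).starProjection x‖ • b k - (W k).starProjection x)) := by
      intro x
      have hz : ∀ j ∈ Finset.range k, (W j).starProjection
          (x + (‖(W k).starProjection x‖ • b k - (W k).starProjection x))
          = (W j).starProjection x := fun j hj => by
        have hmem : ‖(W k).starProjection x‖ • b k - (W k).starProjection x ∈ W k :=
          (W k).sub_mem ((W k).smul_mem _ (hb k (by omega))) ((W k).starProjection_apply_mem x)
        have h0 := (W j).starProjection_apply_eq_zero_iff.2
          ((horth j k (Finset.mem_range.1 hj) (by omega)).symm hmem)
        rw [map_add, h0, add_zero]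
      unfold alignMap
      have hs : ∑ j ∈ Finset.range k, (‖(W j).starProjection
          (x + (‖(W k).starProjection x‖ • b k - (W k).starProjection x))‖ • b j
          - (W j).starProjection (x + (‖(W k).starProjection x‖ • b k - (W k).starProjection x)))
          = ∑ j ∈ Finset.range k, (‖(W j).starProjection x‖ • b j - (W j).starProjection x) :=
        Finset.sum_congr rfl fun j hj => by rw [hz j hj]
      rw [Finset.sum_range_succ, hs]
      abel
    have hIk := hi (k + 1) hk
    simp_rw [hstep] at hIk ⊢
    refine integral_align (hcomm k k le_rfl (by omega)) (htrans k (by omega))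
      (hΦ.comp (continuous_alignMap W b k)).measurable (fun U hU x => ?_) (hi k (by omega)) hIk
    have : alignMap W b k (U x) = U (alignMap W b k x) := by
      unfold alignMap
      rw [map_add, map_sum]
      congr 1
      refine Finset.sum_congr rfl fun j hj => ?_
      have hjk := Finset.mem_range.1 hj
      rw [hcomm j k hjk.le (by omega) U hU, map_sub, map_smul, hfix j k hjk (by omega) U hU,
        LinearIsometryEquiv.norm_map]
    rw [Function.comp_apply, Function.comp_apply, this, hinv k (by omega) U hU]

end Alignment

section TensorAction

variable {N P : ℕ} {c : ℕ → ℝ}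

lemma sum_sq_of_orthonormal_columns {ι κ : Type*} [Fintype ι] [Fintype κ] [DecidableEq κ]
    {A : ι → κ → ℝ} (hA : ∀ j j', ∑ i, A i j * A i j' = if j = j' then 1 else 0) (x : κ → ℝ) :
    ∑ i, (∑ j, A i j * x j) ^ 2 = ∑ j, x j ^ 2 := by
  have h1 : ∀ i, (∑ j, A i j * x j) ^ 2 = ∑ j, ∑ j', (x j * x j') * (A i j * A i j') := fun i => by
    rw [sq, Finset.sum_mul_sum]
    exact Finset.sum_congr rfl fun j _ => Finset.sum_congr rfl fun j' _ => by ring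
  simp_rw [h1]
  rw [Finset.sum_comm]
  refine Finset.sum_congr rfl fun j _ => ?_
  rw [Finset.sum_comm]
  simp_rw [← Finset.mul_sum, hA]
  simp [sq]

lemma sum_prod_mul_prod {k : ℕ} {q : Fin N → Fin N → ℝ}
    (hq : ∀ a a', ∑ b, q b a * q b a' = if a = a' then 1 else 0) (j j' : Fin k → Fin N) :
    ∑ i : Fin k → Fin N, (∏ t, q (i t) (j t)) * (∏ t, q (i t) (j' t))
      = if j = j' then 1 else 0 := by
  simp_rw [← Finset.prod_mul_distrib]
  have h := (Finset.prod_univ_sum (fun _ : Fin k => (Finset.univ : Finset (Fin N)))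
    fun t b => q b (j t) * q b (j' t)).symm
  rw [Fintype.piFinset_univ] at h
  rw [h]
  simp_rw [hq]
  rw [Finset.prod_ite_zero]
  simp [funext_iff]

/-- The matrix entries of an isometry. -/
def isoEntry (Q : EuclideanSpace ℝ (Fin N) ≃ₗᵢ[ℝ] EuclideanSpace ℝ (Fin N)) (b a : Fin N) : ℝ :=
  Q (EuclideanSpace.single a 1) b

lemma sum_isoEntry_mul (Q : EuclideanSpace ℝ (Fin N) ≃ₗᵢ[ℝ] EuclideanSpace ℝ (Fin N))
    (a a' : Fin N) : ∑ b, isoEntry Q b a * isoEntry Q b a' = if a = a' then 1 else 0 := by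
  have h := Q.inner_map_map (EuclideanSpace.single a' (1 : ℝ)) (EuclideanSpace.single a (1 : ℝ))
  rw [PiLp.inner_apply, EuclideanSpace.inner_single_left] at h
  simp only [RCLike.inner_apply, conj_trivial, one_mul] at h
  refine h.trans ?_
  simp [eq_comm]

lemma sum_isoEntry_apply (Q : EuclideanSpace ℝ (Fin N) ≃ₗᵢ[ℝ] EuclideanSpace ℝ (Fin N))
    (σ : EuclideanSpace ℝ (Fin N)) (b : Fin N) : ∑ a, isoEntry Q b a * σ a = Q σ b := by
  have h : σ = ∑ a, σ a • EuclideanSpace.single a (1 : ℝ) := by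
    ext b
    simp [Finset.sum_apply, Pi.single_apply]
  conv_rhs => rw [h]
  simp [map_sum, isoEntry, mul_comm]

/-- The action of an isometry of `ℝ^N` on the space of couplings. -/
def tensAct (N P : ℕ) (Q : EuclideanSpace ℝ (Fin N) ≃ₗᵢ[ℝ] EuclideanSpace ℝ (Fin N)) :
    EuclideanSpace ℝ (GIdx N P) →ₗᵢ[ℝ] EuclideanSpace ℝ (GIdx N P) where
  toFun x := WithLp.toLp 2 fun i =>
    ∑ j : Fin (i.1 : ℕ) → Fin N, (∏ t, isoEntry Q (i.2 t) (j t)) * x ⟨i.1, j⟩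
  map_add' x y := by
    ext i
    simp [mul_add, Finset.sum_add_distrib]
  map_smul' r x := by
    ext i
    simp only [PiLp.smul_apply, smul_eq_mul, RingHom.id_apply, Finset.mul_sum]
    exact Finset.sum_congr rfl fun j _ => by ring
  norm_map' x := by
    rw [EuclideanSpace.norm_eq, EuclideanSpace.norm_eq]
    congr 1
    simp only [Real.norm_eq_abs, sq_abs, LinearMap.coe_mk, AddHom.coe_mk]
    rw [Fintype.sum_sigma, Fintype.sum_sigma]
    refine Finset.sum_congr rfl fun k _ => ?_
    exact sum_sq_of_orthonormal_columns (sum_prod_mul_prod (sum_isoEntry_mul Q)) fun j => x ⟨k, j⟩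

/-- The feature vector of a point of Euclidean space. -/
def featS (N P : ℕ) (c : ℕ → ℝ) (σ : EuclideanSpace ℝ (Fin N)) : EuclideanSpace ℝ (GIdx N P) :=
  featV N P c σ.ofLp

lemma inner_featS (hN : 1 ≤ N) (σ τ : EuclideanSpace ℝ (Fin N)) :
    ⟪featS N P c σ, featS N P c τ⟫ = N * xiFun P c (⟪σ, τ⟫ / N) := by
  rw [featS, featS, inner_featV hN, ovl, dotp, PiLp.inner_apply]
  simp only [RCLike.inner_apply, conj_trivial, mul_comm]

lemma tensAct_featS (Q : EuclideanSpace ℝ (Fin N) ≃ₗᵢ[ℝ] EuclideanSpace ℝ (Fin N))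
    (σ : EuclideanSpace ℝ (Fin N)) : tensAct N P Q (featS N P c σ) = featS N P c (Q σ) := by
  ext i
  have h : ∏ t, Q σ (i.2 t)
      = ∑ j : Fin (i.1 : ℕ) → Fin N, ∏ t, isoEntry Q (i.2 t) (j t) * σ (j t) := by
    simp_rw [← sum_isoEntry_apply Q σ]
    rw [Finset.prod_univ_sum, Fintype.piFinset_univ]
  simp only [tensAct, featS, featV, LinearIsometry.coe_mk, LinearMap.coe_mk, AddHom.coe_mk, h,
    Finset.mul_sum]
  refine Finset.sum_congr rfl fun j _ => ?_
  rw [Finset.prod_mul_distrib]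
  ring

lemma featS_mem_iff {σ : EuclideanSpace ℝ (Fin N)} : σ.ofLp ∈ sphereSet N ↔ ‖σ‖ ^ 2 = N := by
  rw [EuclideanSpace.norm_sq_eq]
  simp [sphereSet]

lemma psi_tensAct (hN : 1 ≤ N) (Q : EuclideanSpace ℝ (Fin N) ≃ₗᵢ[ℝ] EuclideanSpace ℝ (Fin N))
    (x : EuclideanSpace ℝ (GIdx N P)) : psi N P c (tensAct N P Q x) = psi N P c x := by
  refine le_antisymm (psi_le fun σ hσ => ?_) (psi_le fun σ hσ => ?_)
  · have h1 : featV N P c σ = tensAct N P Q (featS N P c (Q.symm (WithLp.toLp 2 σ))) := by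
      rw [tensAct_featS, Q.apply_symm_apply, featS]
    rw [h1, LinearIsometry.inner_map_map]
    refine le_psi hN ?_ x
    rw [featS_mem_iff, Q.symm.norm_map]
    exact featS_mem_iff.1 hσ
  · have h1 : ⟪featV N P c σ, x⟫
        = ⟪featS N P c (Q (WithLp.toLp 2 σ)), tensAct N P Q x⟫ := by
      rw [← tensAct_featS, LinearIsometry.inner_map_map, featS]
    rw [h1]
    refine le_psi hN ?_ _
    rw [featS_mem_iff, Q.norm_map]
    exact featS_mem_iff.1 hσ

lemma differentiable_featS : Differentiable ℝ (featS N P c) := by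
  rw [differentiable_euclidean]
  intro i
  unfold featS featV
  fun_prop

/-- The derivative of the feature map. -/
def gradV (N P : ℕ) (c : ℕ → ℝ) (σ : EuclideanSpace ℝ (Fin N)) :
    EuclideanSpace ℝ (Fin N) →L[ℝ] EuclideanSpace ℝ (GIdx N P) := fderiv ℝ (featS N P c) σ

lemma hasDerivAt_featS_line (σ w : EuclideanSpace ℝ (Fin N)) :
    HasDerivAt (fun t : ℝ => featS N P c (σ + t • w)) (gradV N P c σ w) 0 := by
  have h1 : HasDerivAt (fun t : ℝ => σ + t • w) w 0 := by
    simpa using ((hasDerivAt_id (0 : ℝ)).smul_const w).const_add σ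
  have h2 : HasFDerivAt (featS N P c) (gradV N P c σ) (σ + (0 : ℝ) • w) := by
    rw [zero_smul, add_zero]
    exact (differentiable_featS σ).hasFDerivAt
  exact h2.comp_hasDerivAt 0 h1

lemma hasDerivAt_inner_line (τ σ w : EuclideanSpace ℝ (Fin N)) :
    HasDerivAt (fun t : ℝ => ⟪τ, σ + t • w⟫ / N) (⟪τ, w⟫ / N) 0 := by
  have : (fun t : ℝ => ⟪τ, σ + t • w⟫ / N) = fun t : ℝ => (⟪τ, σ⟫ + t * ⟪τ, w⟫) / N := by
    funext t
    rw [inner_add_right, real_inner_smul_right]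
  rw [this]
  simpa using (((hasDerivAt_id (0 : ℝ)).mul_const ⟪τ, w⟫).const_add ⟪τ, σ⟫).div_const (N : ℝ)

lemma inner_featS_gradV (hN : 1 ≤ N) (τ σ w : EuclideanSpace ℝ (Fin N)) :
    ⟪featS N P c τ, gradV N P c σ w⟫ = xiD1 P c (⟪τ, σ⟫ / N) * ⟪τ, w⟫ := by
  have hN' : (N : ℝ) ≠ 0 := by positivity
  have h1 : HasDerivAt (fun t : ℝ => ⟪featS N P c τ, featS N P c (σ + t • w)⟫)
      ⟪featS N P c τ, gradV N P c σ w⟫ 0 :=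
    (innerSL ℝ (featS N P c τ)).hasFDerivAt.comp_hasDerivAt 0 (hasDerivAt_featS_line σ w)
  simp_rw [inner_featS hN] at h1
  have h2 := ((hasDerivAt_xiFun (P := P) (c := c) (⟪τ, σ + (0 : ℝ) • w⟫ / N)).comp (0 : ℝ)
    (hasDerivAt_inner_line τ σ w)).const_mul (N : ℝ)
  rw [h1.unique h2, zero_smul, add_zero]
  field_simp

lemma inner_gradV_gradV (hN : 1 ≤ N) (τ u σ w : EuclideanSpace ℝ (Fin N)) :
    ⟪gradV N P c τ u, gradV N P c σ w⟫
      = xiD2 P c (⟪σ, τ⟫ / N) * (⟪σ, u⟫ / N) * ⟪w, τ⟫ + xiD1 P c (⟪σ, τ⟫ / N) * ⟪w, u⟫ := by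
  have h1 : HasDerivAt (fun t : ℝ => ⟪gradV N P c σ w, featS N P c (τ + t • u)⟫)
      ⟪gradV N P c σ w, gradV N P c τ u⟫ 0 :=
    (innerSL ℝ (gradV N P c σ w)).hasFDerivAt.comp_hasDerivAt 0 (hasDerivAt_featS_line τ u)
  have e : (fun t : ℝ => ⟪gradV N P c σ w, featS N P c (τ + t • u)⟫)
      = fun t : ℝ => xiD1 P c (⟪σ, τ + t • u⟫ / N) * (⟪w, τ⟫ + t * ⟪w, u⟫) := by
    funext t
    rw [real_inner_comm, inner_featS_gradV hN, real_inner_comm, real_inner_comm w,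
      inner_add_right w, real_inner_smul_right]
  rw [e] at h1
  have h2 := ((hasDerivAt_xiD1 (P := P) (c := c) (⟪σ, τ + (0 : ℝ) • u⟫ / N)).comp (0 : ℝ)
    (hasDerivAt_inner_line σ τ u)).mul
      (((hasDerivAt_id (0 : ℝ)).mul_const ⟪w, u⟫).const_add ⟪w, τ⟫)
  rw [real_inner_comm, h1.unique h2]
  simp

lemma tensAct_gradV (Q : EuclideanSpace ℝ (Fin N) ≃ₗᵢ[ℝ] EuclideanSpace ℝ (Fin N))
    (σ w : EuclideanSpace ℝ (Fin N)) :
    tensAct N P Q (gradV N P c σ w) = gradV N P c (Q σ) (Q w) := by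
  have h1 : HasDerivAt (fun t : ℝ => tensAct N P Q (featS N P c (σ + t • w)))
      (tensAct N P Q (gradV N P c σ w)) 0 :=
    (tensAct N P Q).toContinuousLinearMap.hasFDerivAt.comp_hasDerivAt 0 (hasDerivAt_featS_line σ w)
  have e : (fun t : ℝ => tensAct N P Q (featS N P c (σ + t • w)))
      = fun t : ℝ => featS N P c (Q σ + t • Q w) := by
    funext t
    rw [tensAct_featS, map_add, map_smul]
  rw [e] at h1
  exact h1.unique (hasDerivAt_featS_line (Q σ) (Q w))

end TensorAction

section Increments

variable {N P : ℕ} {c : ℕ → ℝ} {K : ℕ}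

/-- The standard basis of `ℝ^N`, extended by zero. -/
def stdE (N l : ℕ) : EuclideanSpace ℝ (Fin N) :=
  if h : l < N then EuclideanSpace.single ⟨l, h⟩ 1 else 0

lemma inner_stdE {l m : ℕ} (hl : l < N) (hm : m < N) :
    ⟪stdE N l, stdE N m⟫ = if l = m then 1 else 0 := by
  rw [stdE, stdE, dif_pos hl, dif_pos hm, EuclideanSpace.inner_single_left]
  simp

/-- The diagonal path `√(N/K) (e_0 + ⋯ + e_{k-1})`. -/
def pathPt (N K k : ℕ) : EuclideanSpace ℝ (Fin N) :=
  √((N : ℝ) / K) • ∑ l ∈ Finset.range k, stdE N l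

/-- The orthogonal complement of the first `k` basis vectors. -/
def restSpace (N k : ℕ) : Submodule ℝ (EuclideanSpace ℝ (Fin N)) where
  carrier := {w | ∀ l < k, ⟪stdE N l, w⟫ = 0}
  add_mem' hx hy l hl := by rw [inner_add_right, hx l hl, hy l hl, add_zero]
  zero_mem' l _ := inner_zero_right _
  smul_mem' r x hx l hl := by rw [real_inner_smul_right, hx l hl, mul_zero]

lemma restSpace_antitone {a b : ℕ} (hab : a ≤ b) : restSpace N b ≤ restSpace N a :=
  fun _ hw l hl => hw l (hl.trans_le hab)

lemma stdE_mem_restSpace {k l : ℕ} (hkl : k ≤ l) (hl : l < N) : stdE N l ∈ restSpace N k :=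
  fun m hm => by rw [inner_stdE (by omega) hl, if_neg (by omega)]

lemma inner_pathPt {a b : ℕ} {u : EuclideanSpace ℝ (Fin N)} (hab : a ≤ b)
    (hu : u ∈ restSpace N b) : ⟪pathPt N K a, u⟫ = 0 := by
  rw [pathPt, real_inner_smul_left, sum_inner, Finset.sum_eq_zero, mul_zero]
  exact fun l hl => hu l ((Finset.mem_range.1 hl).trans_le hab)

lemma inner_stdE_pathPt {l k : ℕ} (hl : l < k) (hk : k ≤ N) :
    ⟪pathPt N K k, stdE N l⟫ = √((N : ℝ) / K) := by
  rw [pathPt, real_inner_smul_left, sum_inner, Finset.sum_eq_single l, inner_stdE (by omega)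
    (by omega), if_pos rfl, mul_one]
  · intro m hm hml
    have := Finset.mem_range.1 hm
    rw [inner_stdE (by omega) (by omega), if_neg hml]
  · exact fun h => absurd (Finset.mem_range.2 hl) h

lemma inner_pathPt_pathPt (hN : 1 ≤ N) {a b : ℕ} (hab : a ≤ b) (hb : b ≤ N) :
    ⟪pathPt N K a, pathPt N K b⟫ / N = (a : ℝ) / K := by
  have h1 : ⟪pathPt N K a, pathPt N K b⟫ = √((N : ℝ) / K) * (a * √((N : ℝ) / K)) := by
    conv_lhs => rw [pathPt, real_inner_smul_left, sum_inner]
    rw [Finset.sum_congr rfl fun l hl => by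
      rw [real_inner_comm, inner_stdE_pathPt ((Finset.mem_range.1 hl).trans_le hab) hb]]
    rw [Finset.sum_const, Finset.card_range, nsmul_eq_mul]
  have h2 := Real.mul_self_sqrt (by positivity : 0 ≤ (N : ℝ) / K)
  have hN' : (N : ℝ) ≠ 0 := by positivity
  rw [h1, div_eq_iff hN']
  linear_combination (a : ℝ) * h2

lemma norm_pathPt_sq (hN : 1 ≤ N) (hK : 1 ≤ K) (hKN : K ≤ N) : ‖pathPt N K K‖ ^ 2 = N := by
  have hN' : (N : ℝ) ≠ 0 := by positivity
  have hK' : (K : ℝ) ≠ 0 := by positivity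
  have h := inner_pathPt_pathPt (K := K) hN le_rfl hKN
  rwa [div_self hK', div_eq_one_iff_eq hN', real_inner_self_eq_norm_sq] at h

lemma inner_gradV_pathPt (hN : 1 ≤ N) {a b : ℕ} (hab : a ≤ b) (hb : b ≤ N)
    {u : EuclideanSpace ℝ (Fin N)} (hu : u ∈ restSpace N a) (w : EuclideanSpace ℝ (Fin N)) :
    ⟪gradV N P c (pathPt N K b) u, gradV N P c (pathPt N K a) w⟫
      = xiD1 P c (a / K) * ⟪w, u⟫ := by
  rw [inner_gradV_gradV hN, inner_pathPt le_rfl hu, inner_pathPt_pathPt hN hab hb]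
  simp

/-- The increment of the gradient along the path. -/
def gradInc (N P : ℕ) (c : ℕ → ℝ) (K j : ℕ) :
    EuclideanSpace ℝ (Fin N) →L[ℝ] EuclideanSpace ℝ (GIdx N P) :=
  gradV N P c (pathPt N K (j + 1)) - gradV N P c (pathPt N K j)

/-- The variance of the gradient increments. -/
def incVar (P : ℕ) (c : ℕ → ℝ) (K j : ℕ) : ℝ :=
  xiD1 P c ((j + 1 : ℕ) / K) - xiD1 P c (j / K)

lemma inner_gradInc_self (hN : 1 ≤ N) {j : ℕ} (hj : j + 1 ≤ N) {u w : EuclideanSpace ℝ (Fin N)}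
    (hu : u ∈ restSpace N (j + 1)) (hw : w ∈ restSpace N (j + 1)) :
    ⟪gradInc N P c K j u, gradInc N P c K j w⟫ = incVar P c K j * ⟪u, w⟫ := by
  have hu' := restSpace_antitone (Nat.le_succ j) hu
  have hw' := restSpace_antitone (Nat.le_succ j) hw
  have h1 := inner_gradV_pathPt (P := P) (c := c) (K := K) hN le_rfl hj hu w
  have h2 := inner_gradV_pathPt (P := P) (c := c) (K := K) hN (Nat.le_succ j) hj hu' w
  have h3 := inner_gradV_pathPt (P := P) (c := c) (K := K) hN (Nat.le_succ j) hj hw' u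
  have h4 := inner_gradV_pathPt (P := P) (c := c) (K := K) hN le_rfl (by omega) hu' w
  rw [real_inner_comm] at h3
  rw [real_inner_comm u w] at h1 h2 h4
  rw [gradInc, sub_apply, sub_apply, inner_sub_left,
    inner_sub_right, inner_sub_right, incVar]
  rw [h1, h2, h3, h4]
  ring

lemma inner_gradInc_of_lt (hN : 1 ≤ N) {i j : ℕ} (hij : i < j) (hj : j + 1 ≤ N)
    {u : EuclideanSpace ℝ (Fin N)} (hu : u ∈ restSpace N (j + 1)) (w : EuclideanSpace ℝ (Fin N)) :
    ⟪gradInc N P c K i w, gradInc N P c K j u⟫ = 0 := by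
  have h : ∀ a b, a ≤ b → b ≤ j + 1 → ⟪gradV N P c (pathPt N K a) w, gradV N P c (pathPt N K b) u⟫
      = xiD1 P c (a / K) * ⟪w, u⟫ := fun a b hab hb => by
    rw [real_inner_comm, inner_gradV_pathPt hN hab (hb.trans hj)
      (restSpace_antitone (hab.trans hb) hu)]
  rw [gradInc, gradInc, sub_apply, sub_apply,
    inner_sub_left, inner_sub_right, inner_sub_right, h _ _ (by omega) (by omega),
    h _ _ (by omega) (by omega), h _ _ (by omega) (by omega), h _ _ (by omega) (by omega)]
  ring

lemma norm_gradInc (hN : 1 ≤ N) {j : ℕ} (hj : j + 1 ≤ N) {w : EuclideanSpace ℝ (Fin N)}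
    (hw : w ∈ restSpace N (j + 1)) : ‖gradInc N P c K j w‖ = √(incVar P c K j) * ‖w‖ := by
  rw [norm_eq_sqrt_real_inner, inner_gradInc_self hN hj hw hw, real_inner_self_eq_norm_sq,
    Real.sqrt_mul' _ (sq_nonneg _), Real.sqrt_sq (norm_nonneg _)]

/-- The range of the gradient increments in the unexplored directions. -/
def incSpace (N P : ℕ) (c : ℕ → ℝ) (K j : ℕ) : Submodule ℝ (EuclideanSpace ℝ (GIdx N P)) :=
  (restSpace N (j + 1)).map (gradInc N P c K j).toLinearMap

/-- The unit gradient increment in direction `l`. -/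
def incDir (N P : ℕ) (c : ℕ → ℝ) (K j l : ℕ) : EuclideanSpace ℝ (GIdx N P) :=
  (√(incVar P c K j))⁻¹ • gradInc N P c K j (stdE N l)

lemma incDir_mem {j l : ℕ} (hjl : j + 1 ≤ l) (hl : l < N) :
    incDir N P c K j l ∈ incSpace N P c K j :=
  Submodule.smul_mem _ _ (Submodule.mem_map_of_mem (stdE_mem_restSpace hjl hl))

lemma inner_incDir (hN : 1 ≤ N) {j l m : ℕ} (hΔ : 0 < incVar P c K j) (hl : j + 1 ≤ l) (hl' : l < N)
    (hm : j + 1 ≤ m) (hm' : m < N) :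
    ⟪incDir N P c K j l, incDir N P c K j m⟫ = if l = m then 1 else 0 := by
  rw [incDir, incDir, real_inner_smul_left, real_inner_smul_right,
    inner_gradInc_self hN (by omega) (stdE_mem_restSpace hl hl') (stdE_mem_restSpace hm hm'),
    inner_stdE hl' hm', ← mul_assoc, ← mul_assoc, ← mul_inv, Real.mul_self_sqrt hΔ.le,
    inv_mul_cancel₀ hΔ.ne', one_mul]

lemma incSpace_isOrtho (hN : 1 ≤ N) {i j : ℕ} (hij : i < j) (hj : j + 1 ≤ N) :
    incSpace N P c K i ⟂ incSpace N P c K j := by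
  rw [Submodule.isOrtho_iff_inner_eq]
  rintro _ ⟨w, _, rfl⟩ _ ⟨u, hu, rfl⟩
  exact inner_gradInc_of_lt hN hij hj hu w

/-- The isometries induced by the rotations that fix the first `k + 1` basis vectors. -/
def fixRot (N P k : ℕ) : Set (EuclideanSpace ℝ (GIdx N P) ≃ₗᵢ[ℝ] EuclideanSpace ℝ (GIdx N P)) :=
  {U | ∃ Q : EuclideanSpace ℝ (Fin N) ≃ₗᵢ[ℝ] EuclideanSpace ℝ (Fin N),
    (∀ l ≤ k, Q (stdE N l) = stdE N l) ∧ ∀ x, U x = tensAct N P Q x}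

lemma tensAct_gradInc {Q : EuclideanSpace ℝ (Fin N) ≃ₗᵢ[ℝ] EuclideanSpace ℝ (Fin N)} {j k : ℕ}
    (hjk : j ≤ k) (hQ : ∀ l ≤ k, Q (stdE N l) = stdE N l) (w : EuclideanSpace ℝ (Fin N)) :
    tensAct N P Q (gradInc N P c K j w) = gradInc N P c K j (Q w) := by
  have h : ∀ a ≤ j + 1, Q (pathPt N K a) = pathPt N K a := fun a ha => by
    rw [pathPt, map_smul, map_sum]
    congr 1
    refine Finset.sum_congr rfl fun l hl => hQ l ?_
    have := Finset.mem_range.1 hl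
    omega
  rw [gradInc, sub_apply, sub_apply, map_sub,
    tensAct_gradV, tensAct_gradV, h _ le_rfl, h _ (Nat.le_succ j)]

lemma starProjection_fixRot {j k : ℕ} (hjk : j ≤ k)
    {U : EuclideanSpace ℝ (GIdx N P) ≃ₗᵢ[ℝ] EuclideanSpace ℝ (GIdx N P)} (hU : U ∈ fixRot N P k)
    (x : EuclideanSpace ℝ (GIdx N P)) :
    (incSpace N P c K j).starProjection (U x) = U ((incSpace N P c K j).starProjection x) := by
  obtain ⟨Q, hQ, hQU⟩ := hU
  have hle : (incSpace N P c K j).map U.toLinearEquiv.toLinearMap ≤ incSpace N P c K j := by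
    rintro _ ⟨_, ⟨w, hw, rfl⟩, rfl⟩
    refine ⟨Q w, fun l hl => ?_, ?_⟩
    · rw [← hQ l (by omega), Q.inner_map_map]
      exact hw l hl
    · exact ((hQU _).trans (tensAct_gradInc hjk hQ w)).symm
  have heq : (incSpace N P c K j).map U.toLinearEquiv.toLinearMap = incSpace N P c K j :=
    Submodule.eq_of_le_of_finrank_eq hle (LinearEquiv.finrank_map_eq U.toLinearEquiv _)
  have h := Submodule.starProjection_map_apply U (incSpace N P c K j) (U x)
  rw [U.symm_apply_apply] at h
  rw [← h]
  congr 2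
  exact heq.symm

lemma fixRot_incDir {j k : ℕ} (hjk : j < k)
    {U : EuclideanSpace ℝ (GIdx N P) ≃ₗᵢ[ℝ] EuclideanSpace ℝ (GIdx N P)} (hU : U ∈ fixRot N P k) :
    U (incDir N P c K j (j + 1)) = incDir N P c K j (j + 1) := by
  obtain ⟨Q, hQ, hQU⟩ := hU
  rw [hQU, incDir, map_smul, tensAct_gradInc hjk.le hQ, hQ _ hjk]

lemma exists_fixRot (hN : 1 ≤ N) {k : ℕ} (hk : k + 1 < N) (hΔ : 0 < incVar P c K k)
    {x : EuclideanSpace ℝ (GIdx N P)} (hx : x ∈ incSpace N P c K k) :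
    ∃ U ∈ fixRot N P k, U x = ‖x‖ • incDir N P c K k (k + 1) := by
  obtain ⟨w, hw, rfl⟩ := hx
  have he := stdE_mem_restSpace (le_refl (k + 1)) hk
  have hnorm : ‖stdE N (k + 1)‖ = 1 := by
    rw [norm_eq_sqrt_real_inner, inner_stdE hk hk, if_pos rfl, Real.sqrt_one]
  obtain ⟨Q, hQd⟩ : ∃ Q, Q = (ℝ ∙ (w - ‖w‖ • stdE N (k + 1)))ᗮ.reflection := ⟨_, rfl⟩
  have hQw : Q w = ‖w‖ • stdE N (k + 1) := by
    rw [hQd]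
    exact Submodule.reflection_sub (by rw [norm_smul, norm_norm, hnorm, mul_one])
  have hQ : ∀ l ≤ k, Q (stdE N l) = stdE N l := fun l hl => by
    rw [hQd]
    refine Submodule.reflection_mem_subspace_eq_self ?_
    rw [Submodule.mem_orthogonal_singleton_iff_inner_left, inner_sub_right, real_inner_smul_right,
      hw l (by omega), he l (by omega), mul_zero, sub_zero]
  refine ⟨(tensAct N P Q).toLinearIsometryEquiv rfl, ⟨Q, hQ, fun x => rfl⟩, ?_⟩
  have hs := (Real.sqrt_pos.2 hΔ).ne'
  change tensAct N P Q (gradInc N P c K k w) = ‖gradInc N P c K k w‖ • _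
  rw [tensAct_gradInc le_rfl hQ, hQw, map_smul, norm_gradInc hN hk.le hw, incDir, smul_smul]
  congr 1
  field_simp

end Increments

section LowerBound

variable {N P : ℕ} {c : ℕ → ℝ} {K : ℕ}

lemma inner_featS_incDir (hN : 1 ≤ N) {j : ℕ} (hj : j + 1 < K) (hKN : K ≤ N)
    (hΔ : 0 < incVar P c K j) :
    ⟪featS N P c (pathPt N K K), incDir N P c K j (j + 1)⟫
      = √((N : ℝ) / K) * √(incVar P c K j) := by
  have hs := Real.mul_self_sqrt hΔ.le
  have hs' := (Real.sqrt_pos.2 hΔ).ne'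
  rw [incDir, real_inner_smul_right, gradInc, sub_apply, inner_sub_right, inner_featS_gradV hN,
    inner_featS_gradV hN, inner_stdE_pathPt hj hKN, real_inner_comm (pathPt N K (j + 1)),
    real_inner_comm (pathPt N K j), inner_pathPt_pathPt hN hj.le hKN,
    inner_pathPt_pathPt hN (by omega) hKN, ← sub_mul, ← incVar]
  field_simp
  linear_combination -√((N : ℝ) / K) * hs

lemma orthonormal_incDir (hN : 1 ≤ N) {j : ℕ} (hΔ : 0 < incVar P c K j) :
    Orthonormal ℝ fun i : Fin (N - j - 1) => incDir N P c K j (j + 1 + i) := by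
  rw [orthonormal_iff_ite]
  intro a b
  have ha := a.2
  have hb := b.2
  rw [inner_incDir hN hΔ (by omega) (by omega) (by omega) (by omega)]
  simp [Fin.ext_iff]

lemma integrable_norm_starProjection {E : Type*} [NormedAddCommGroup E] [InnerProductSpace ℝ E]
    [FiniteDimensional ℝ E] [MeasurableSpace E] [BorelSpace E] (W : Submodule ℝ E) :
    Integrable (fun x => ‖W.starProjection x‖) (stdGaussian E) := by
  refine (integrable_norm_stdGaussian (E := E)).mono' (by fun_prop) (ae_of_all _ fun x => ?_)
  rw [norm_norm]
  exact W.norm_starProjection_apply_le x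

lemma sqrt_sum_inner_sq_le_norm_starProjection {E ι : Type*} [Fintype ι] [NormedAddCommGroup E]
    [InnerProductSpace ℝ E] [FiniteDimensional ℝ E] {W : Submodule ℝ E} {a : ι → E}
    (ha : Orthonormal ℝ a) (haW : ∀ i, a i ∈ W) (x : E) :
    √(∑ i, ⟪a i, x⟫ ^ 2) ≤ ‖W.starProjection x‖ := by
  refine Real.sqrt_le_iff.2 ⟨norm_nonneg _, ?_⟩
  have h := ha.sum_inner_products_le (W.starProjection x) (s := Finset.univ)
  refine le_trans (Finset.sum_le_sum fun i _ => ?_) h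
  rw [← W.inner_starProjection_left_eq_right, W.starProjection_eq_self_iff.2 (haW i),
    Real.norm_eq_abs, sq_abs]

lemma le_integral_norm_starProjection_incSpace {j : ℕ} (hj : j + 1 < K) (hKN : K < N)
    (hΔ : 0 < incVar P c K j) :
    ((N : ℝ) - K) / √N
      ≤ ∫ x, ‖(incSpace N P c K j).starProjection x‖ ∂(stdGaussian (EuclideanSpace ℝ (GIdx N P))) := by
  have hN : 1 ≤ N := by omega
  have hne : Nonempty (Fin (N - j - 1)) := ⟨⟨0, by omega⟩⟩
  have ho := orthonormal_incDir (P := P) (c := c) hN hΔ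
  have h1 := le_integral_sqrt_sum_inner_sq ho
  have h2 := integral_mono (integrable_sqrt_sum_inner_sq _) (integrable_norm_starProjection _)
    (sqrt_sum_inner_sq_le_norm_starProjection (W := incSpace N P c K j) ho
      fun i => incDir_mem (by omega) (by omega))
  refine le_trans ?_ (h1.trans h2)
  have hn : (((N - j - 1 : ℕ) : ℝ)) = N - j - 1 := by
    rw [Nat.sub_sub, Nat.cast_sub (by omega)]
    push_cast
    ring
  have hj' : (j : ℝ) + 2 ≤ K := by exact_mod_cast hj
  have hKN' : (K : ℝ) < N := by exact_mod_cast hKN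
  have hj0 : (0 : ℝ) ≤ j := j.cast_nonneg
  rw [Fintype.card_fin, hn, div_eq_mul_inv]
  refine mul_le_mul (by linarith) ?_ (by positivity) (by linarith)
  refine inv_anti₀ (Real.sqrt_pos.2 (by linarith)) (Real.sqrt_le_sqrt (by linarith))

lemma le_integral_psi (hK : 1 ≤ K) (hKN : K < N) (hΔ : ∀ j < K, 0 < incVar P c K j) :
    ((N : ℝ) - K) * ∑ j ∈ Finset.range (K - 1), √(incVar P c K j / K)
      ≤ ∫ x, psi N P c x ∂(stdGaussian _) := by
  have hN : 1 ≤ N := by omega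
  obtain ⟨W, hW⟩ : ∃ W, W = incSpace N P c K := ⟨_, rfl⟩
  obtain ⟨b, hb⟩ : ∃ b : ℕ → _, b = fun j => incDir N P c K j (j + 1) := ⟨_, rfl⟩
  have hb1 : ∀ j < K - 1, ‖b j‖ = 1 := fun j hj => by
    rw [hb, norm_eq_sqrt_real_inner,
      inner_incDir hN (hΔ j (by omega)) le_rfl (by omega) le_rfl (by omega), if_pos rfl,
      Real.sqrt_one]
  have halign := integral_alignMap (W := W) (b := b) (S := fixRot N P) (K := K - 1)
    (fun j hj => by rw [hW, hb]; exact incDir_mem le_rfl (by omega)) hb1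
    (fun i j hij hj => by rw [hW]; exact incSpace_isOrtho hN hij (by omega))
    (fun j k hjk _ U hU x => by rw [hW]; exact starProjection_fixRot hjk hU x)
    (fun j k hjk _ U hU => by rw [hb]; exact fixRot_incDir hjk hU)
    (fun k hk x hx => by
      rw [hW] at hx
      rw [hb]
      exact exists_fixRot hN (by omega) (hΔ k (by omega)) hx)
    (continuous_psi (P := P) (c := c) hN) (Real.sqrt_nonneg _) (abs_psi_le hN)
    (fun k _ U hU x => by
      obtain ⟨Q, _, hQ⟩ := hU
      rw [hQ, psi_tensAct hN]) le_rfl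
  obtain ⟨v, hv⟩ : ∃ v, v = featS N P c (pathPt N K K) := ⟨_, rfl⟩
  have hint1 : Integrable (fun x => ⟪v, x⟫) (stdGaussian (EuclideanSpace ℝ (GIdx N P))) :=
    integrable_inner_stdGaussian v
  have hzero : ∀ u : EuclideanSpace ℝ (GIdx N P), ∫ x, ⟪u, x⟫ ∂(stdGaussian _) = 0 := fun u => by
    have := integral_inner (𝕜 := ℝ) (IsGaussian.integrable_id (μ := stdGaussian _)) u
    simp only [id_eq, integral_id_stdGaussian, inner_zero_right] at this
    exact this
  have hexp : ∀ x, ⟪v, alignMap W b (K - 1) x⟫ = ⟪v, x⟫ + ∑ j ∈ Finset.range (K - 1),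
      (‖(W j).starProjection x‖ * ⟪v, b j⟫ - ⟪(W j).starProjection v, x⟫) := fun x => by
    rw [alignMap, inner_add_right, inner_sum]
    congr 1
    refine Finset.sum_congr rfl fun j _ => ?_
    rw [inner_sub_right, real_inner_smul_right, (W j).inner_starProjection_left_eq_right]
  have hintj : ∀ j ∈ Finset.range (K - 1), Integrable (fun x => ‖(W j).starProjection x‖ * ⟪v, b j⟫
      - ⟪(W j).starProjection v, x⟫) (stdGaussian (EuclideanSpace ℝ (GIdx N P))) := fun j _ =>
    ((integrable_norm_starProjection (W j)).mul_const _).sub (integrable_inner_stdGaussian _)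
  have hval : ∫ x, ⟪v, alignMap W b (K - 1) x⟫ ∂(stdGaussian _)
      = ∑ j ∈ Finset.range (K - 1), (∫ x, ‖(W j).starProjection x‖ ∂(stdGaussian _)) * ⟪v, b j⟫ := by
    simp_rw [hexp]
    rw [integral_add hint1 (integrable_finsetSum _ hintj), hzero, zero_add,
      integral_finsetSum _ hintj]
    refine Finset.sum_congr rfl fun j _ => ?_
    rw [integral_sub ((integrable_norm_starProjection (W j)).mul_const _)
      (integrable_inner_stdGaussian _), hzero, sub_zero, integral_mul_const]
  have hle : ∫ x, ⟪v, alignMap W b (K - 1) x⟫ ∂(stdGaussian _)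
      ≤ ∫ x, psi N P c (alignMap W b (K - 1) x) ∂(stdGaussian _) := by
    refine integral_mono ?_ ?_ fun x => ?_
    · simp_rw [hexp]
      exact hint1.add (integrable_finsetSum _ hintj)
    · refine ((integrable_norm_stdGaussian (E := EuclideanSpace ℝ (GIdx N P))).const_mul
        (√(N * xiFun P c 1) * (1 + (K - 1 : ℕ) * 2))).mono'
        ((continuous_psi hN).comp (continuous_alignMap W b (K - 1))).aestronglyMeasurable
        (ae_of_all _ fun x => ?_)
      refine (abs_psi_le hN _).trans ?_
      rw [mul_assoc]
      exact mul_le_mul_of_nonneg_left (norm_alignMap_le W hb1 x) (Real.sqrt_nonneg _)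
    · rw [hv]
      exact le_psi hN (featS_mem_iff.2 (norm_pathPt_sq hN hK hKN.le)) _
  rw [← halign]
  refine le_trans ?_ hle
  rw [hval, Finset.mul_sum]
  refine Finset.sum_le_sum fun j hj => ?_
  have hjK := Finset.mem_range.1 hj
  have hΔj := hΔ j (by omega)
  have hN0 : (0 : ℝ) < √N := Real.sqrt_pos.2 (by exact_mod_cast hN)
  have hvb : ⟪v, b j⟫ = √N * √(incVar P c K j / K) := by
    rw [hv, hb, inner_featS_incDir hN (by omega) hKN.le hΔj, Real.sqrt_div N.cast_nonneg,
      Real.sqrt_div hΔj.le]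
    ring
  have h1 := le_integral_norm_starProjection_incSpace (by omega) hKN hΔj
  rw [hvb, hW, ← mul_assoc]
  refine mul_le_mul_of_nonneg_right ?_ (Real.sqrt_nonneg _)
  rwa [div_le_iff₀ hN0] at h1

lemma integral_xiS_sub_le (hK : 1 ≤ K) :
    (∫ t in (0 : ℝ)..1, xiS P c t) - 2 * xiS P c 1 / K
      ≤ ∑ j ∈ Finset.range (K - 1), √(incVar P c K j / K) := by
  obtain ⟨n, rfl⟩ : ∃ n, K = n + 1 := ⟨K - 1, by omega⟩
  obtain ⟨r, hr⟩ : ∃ r : ℕ, r = n + 1 := ⟨_, rfl⟩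
  rw [← hr, show r - 1 = n by omega]
  have hr0 : (0 : ℝ) < r := by rw [hr]; positivity
  have hI : ∀ x y : ℝ, IntervalIntegrable (xiS P c) volume x y :=
    fun x y => continuous_xiS.intervalIntegrable x y
  have hstep : ∀ j : ℕ, ((j + 1 : ℕ) / r : ℝ) - j / r = 1 / r := fun j => by
    push_cast
    ring
  have hup : ∀ j < r, ∫ t in (j / r : ℝ)..((j + 1 : ℕ) / r : ℝ), xiS P c t
      ≤ xiS P c ((j + 1 : ℕ) / r) / r := fun j hj => by
    obtain ⟨h0, h1, _⟩ := grid_mem hj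
    refine (intervalIntegral.integral_mono_on h1.le (hI _ _) intervalIntegrable_const
      fun t ht => xiS_mono (h0.trans ht.1) ht.2).trans_eq ?_
    rw [intervalIntegral.integral_const, hstep, smul_eq_mul]
    ring
  have hlow : ∀ j < r, xiS P c (j / r) / r ≤ √(incVar P c r j / r) := fun j hj => by
    obtain ⟨h0, h1, _⟩ := grid_mem hj
    have h := (xiD1_sub_mem (P := P) (c := c) h0 h1.le).1
    rw [hstep] at h
    refine Real.le_sqrt_of_sq_le ?_
    rw [div_pow, xiS_sq h0, incVar]
    calc xiD2 P c (j / r) / (r : ℝ) ^ 2 = xiD2 P c (j / r) * (1 / r) / r := by field_simp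
      _ ≤ _ := by gcongr
  have hsum := intervalIntegral.sum_integral_adjacent_intervals (μ := volume) (f := xiS P c)
    (a := fun j : ℕ => (j / r : ℝ)) (n := r) fun j _ => hI _ _
  rw [Nat.cast_zero, zero_div, div_self hr0.ne', hr, Finset.sum_range_succ, ← hr] at hsum
  have hlast := hup n (by omega)
  rw [← hr, div_self hr0.ne'] at hlast
  have htel := Finset.sum_range_sub (fun j : ℕ => xiS P c (j / r) / r) n
  have hmid : ∑ j ∈ Finset.range n, ∫ t in (j / r : ℝ)..((j + 1 : ℕ) / r : ℝ), xiS P c t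
      ≤ ∑ j ∈ Finset.range n, (√(incVar P c r j / r)
        + (xiS P c ((j + 1 : ℕ) / r) / r - xiS P c (j / r) / r)) :=
    Finset.sum_le_sum fun j hj => by
      have := Finset.mem_range.1 hj
      linarith [hup j (by omega), hlow j (by omega)]
  rw [Finset.sum_add_distrib, htel] at hmid
  have hn : xiS P c (n / r) / r ≤ xiS P c 1 / r := by
    have := grid_mem (show n < r by omega)
    gcongr
    exact xiS_mono this.1 (this.2.1.le.trans this.2.2)
  have h00 : 0 ≤ xiS P c ((0 : ℕ) / r) / r := div_nonneg (xiS_nonneg _) hr0.le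
  rw [div_self hr0.ne'] at hsum
  rw [← hsum, mul_div_assoc]
  linarith

lemma NoGap.eventually_le_integral_psi (h : NoGap P c) {η : ℝ} (hη : 0 < η) :
    ∀ᶠ N : ℕ in atTop,
      (∫ t in (0 : ℝ)..1, xiS P c t) - η ≤ (∫ x, psi N P c x ∂(stdGaussian _)) / N := by
  have hlim := (tendsto_inv_atTop_nhds_zero_nat (𝕜 := ℝ)).const_mul (2 * xiS P c 1)
  rw [mul_zero] at hlim
  obtain ⟨K, hK, hK1⟩ := ((hlim.eventually_lt_const (by positivity : 0 < η / 2)).and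
    (eventually_ge_atTop 1)).exists
  have hS := integral_xiS_sub_le (P := P) (c := c) hK1
  obtain ⟨A, hA⟩ : ∃ A, A = ∑ j ∈ Finset.range (K - 1), √(incVar P c K j / K) := ⟨_, rfl⟩
  rw [← hA, div_eq_mul_inv] at hS
  have hlim2 := (tendsto_inv_atTop_nhds_zero_nat (𝕜 := ℝ)).const_mul (K * A)
  rw [mul_zero] at hlim2
  filter_upwards [hlim2.eventually_lt_const (by positivity : 0 < η / 2),
    eventually_gt_atTop K] with N hN hKN
  have hN0 : (0 : ℝ) < N := by exact_mod_cast (Nat.zero_le K).trans_lt hKN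
  have hmain := le_integral_psi (P := P) (c := c) hK1 hKN fun j hj => by
    obtain ⟨h0, h1, h2⟩ := grid_mem hj
    exact sub_pos.2 (h.xiD1_lt h0 h1 h2)
  rw [← hA] at hmain
  rw [le_div_iff₀ hN0]
  have e : K * A = N * (K * A * (N : ℝ)⁻¹) := by field_simp
  have e1 := mul_le_mul_of_nonneg_left hN.le hN0.le
  have e2 := mul_le_mul_of_nonneg_left (hS.trans' (sub_le_sub_left hK.le _)) hN0.le
  linarith

end LowerBound

section MainLimit

variable {P : ℕ} {c : ℕ → ℝ}

lemma NoGap.tendsto_integral_maxH {Ω : Type*} [MeasureSpace Ω]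
    [IsProbabilityMeasure (ℙ : Measure Ω)] (h : NoGap P c)
    {G : (N : ℕ) → Ω → (k : ℕ) → (Fin k → Fin N) → ℝ}
    (hG : ∀ N, 1 ≤ N → StdGaussianCouplings N P (G N)) :
    Tendsto (fun N : ℕ => (∫ ω, maxH N P c (G N ω) ∂ℙ) / N) atTop
      (nhds (∫ t in Set.Ioo (0 : ℝ) 1, xiS P c t)) := by
  rw [← integral_Ioc_eq_integral_Ioo, ← intervalIntegral.integral_of_le zero_le_one,
    Metric.tendsto_atTop']
  intro η hη
  obtain ⟨n, hn⟩ := eventually_atTop.1 ((h.eventually_integral_psi_le (half_pos hη)).and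
    ((h.eventually_le_integral_psi (half_pos hη)).and (eventually_ge_atTop 1)))
  refine ⟨n, fun N hN => ?_⟩
  obtain ⟨h1, h2, hN1⟩ := hn N hN.le
  rw [integral_maxH hN1 (hG N hN1), Real.dist_eq, abs_lt]
  constructor <;> linarith

end MainLimit

end SpinGlass

/-- if `ξ'' > 0` on `(0,1]` and `ξ'''/ξ''^{3/2}` is non-decreasing (no overlap
gap), the Parisi formula value equals `ALG = ∫₀¹ √(ξ''(t)) dt`, and hence the normalized
expected maximum converges to `ALG`. -/
theorem statement_16 {Ω : Type*} [MeasureSpace Ω] [IsProbabilityMeasure (ℙ : Measure Ω)]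
    (P : ℕ) (hP : 2 ≤ P) (c : ℕ → ℝ) (hc : ∃ k ∈ Finset.Icc 2 P, c k ≠ 0)
    (hpos : ∀ t ∈ Set.Ioc (0 : ℝ) 1, 0 < xiD2 P c t)
    (hmono : MonotoneOn (fun t => xiD3 P c t / (xiD2 P c t) ^ ((3 : ℝ) / 2)) (Set.Ioo 0 1))
    (G : (N : ℕ) → Ω → (k : ℕ) → (Fin k → Fin N) → ℝ)
    (hG : ∀ N, 1 ≤ N → StdGaussianCouplings N P (G N)) :
    (⨅ γ ∈ calU, PFunE P c γ)
      = ENNReal.ofReal (∫ t in Set.Ioo (0 : ℝ) 1, Real.sqrt (xiD2 P c t))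
    ∧ Tendsto (fun N : ℕ => (∫ ω, maxH N P c (G N ω) ∂ℙ) / N) atTop
        (nhds (∫ t in Set.Ioo (0 : ℝ) 1, Real.sqrt (xiD2 P c t))) := by
  have h : SpinGlass.NoGap P c := ⟨hP, hpos, hmono⟩
  exact ⟨h.iInf_PFunE, h.tendsto_integral_maxH hG⟩
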